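/- Let n ≤ N be natural numbers satisfying one of the following conditions: (n ≥ 18 and N ≤ n+1), or (n ≥ 22 and N ≤ n+2), or (n ≥ 26 and N ≤ n+3), or (n ≥ 34 and N ≤ n+4). Then for every N-dimensional subspace F of C(ℝ,ℝ) there exists a non-resonant n-chord diagram (a_i, b_i), i = 1,…,n, such that the subspace {f ∈ F : f(a_i) = f(b_i) for all i = 1,…,n} has dimension at least N − n + 3 (i.e., codimension at most n − 3 in F). -/

import Mathlib

/-- The linear functional `f ↦ f b - f a` on the space `C(ℝ, ℝ)` of continuous
functions `ℝ → ℝ`. -/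
noncomputable def evalDiff (a b : ℝ) : C(ℝ, ℝ) →ₗ[ℝ] ℝ where
  toFun f := f b - f a
  map_add' f g := by simp; ring
  map_smul' c f := by simp [mul_sub]

set_option linter.unusedSectionVars false

/-- Shapes of binary trees; the flag of an internal vertex tells whether its two subtrees may be
exchanged. -/
inductive Shape : Type
  | leaf : Shape
  | bin : Bool → Shape → Shape → Shape

namespace Shape

/-- The leaves of a shape. -/
def L : Shape → Type
  | leaf => Unit
  | bin _ A B => A.L ⊕ B.L

/-- The flagged internal vertices of a shape. -/
def N : Shape → Type
  | leaf => Empty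
  | bin c A B => PLift (c = true) ⊕ (A.N ⊕ B.N)

noncomputable instance instFintypeL : (t : Shape) → Fintype t.L
  | leaf => inferInstanceAs (Fintype Unit)
  | bin _ A B => by
    haveI := instFintypeL A
    haveI := instFintypeL B
    exact inferInstanceAs (Fintype (A.L ⊕ B.L))

noncomputable instance instFintypeN : (t : Shape) → Fintype t.N
  | leaf => inferInstanceAs (Fintype Empty)
  | bin c A B => by
    haveI := instFintypeN A
    haveI := instFintypeN B
    exact inferInstanceAs (Fintype (PLift (c = true) ⊕ (A.N ⊕ B.N)))

noncomputable instance (t : Shape) : DecidableEq t.L := Classical.decEq _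
noncomputable instance (t : Shape) : DecidableEq t.N := Classical.decEq _

/-- States of the flagged vertices: an orientation bit and a bit telling whether it may change. -/
abbrev NS (t : Shape) := t.N → Bool × Bool

/-- States of the leaves: a sign, or nothing. -/
abbrev LS (t : Shape) := t.L → Option Bool

/-- The state without signs. -/
def emp (t : Shape) : t.LS := fun _ => none

/-- The state of the root, `(false, false)` if the root is not flagged. -/
def rt {c : Bool} {A B : Shape} (s : (bin c A B).NS) : Bool × Bool :=
  if h : c = true then s (Sum.inl ⟨h⟩) else (false, false)

/-- A bit as an element of `ZMod 2`. -/
def bit (b : Bool) : ZMod 2 := if b then 1 else 0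

/-- The first sign present in the order of the leaves prescribed by the vertex states; the value is
`c` if there is none. -/
def lead : (t : Shape) → ZMod 2 → t.NS → t.LS → ZMod 2
  | leaf, c, _, u => match u () with
    | none => c
    | some b => bit b
  | bin _ A B, c, s, u =>
    let sA : A.NS := fun ν => s (Sum.inr (Sum.inl ν))
    let sB : B.NS := fun ν => s (Sum.inr (Sum.inr ν))
    let a : A.LS := fun x => u (Sum.inl x)
    let b : B.LS := fun x => u (Sum.inr x)
    if (rt s).1 then lead B (lead A c sA a) sB b else lead A (lead B c sB b) sA a

/-- Erase a sign. -/
noncomputable def del {t : Shape} (u : t.LS) (x : t.L) : t.LS := Function.update u x none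

/-- Change the orientation of one vertex, for good. -/
noncomputable def flip {t : Shape} (s : t.NS) (ν : t.N) : t.NS :=
  Function.update s ν (!(s ν).1, false)

/-- The transfer operator summing over all moves which change the leading sign. -/
noncomputable def D (t : Shape) (c : ZMod 2) (f : t.NS → t.LS → ZMod 2) (s : t.NS) (u : t.LS) :
    ZMod 2 :=
  ∑ x, (t.lead c s u + t.lead c s (del u x)) * f s (del u x) +
  ∑ ν, (if (s ν).2 then (t.lead c s u + t.lead c (flip s ν) u) * f (flip s ν) u else 0)

/-- The number of vertices which may still change. -/
noncomputable def nf {t : Shape} (s : t.NS) : ℕ := (Finset.univ.filter fun ν => (s ν).2 = true).card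

/-- The number of signs present. -/
noncomputable def ns {t : Shape} (u : t.LS) : ℕ := (Finset.univ.filter fun x => u x ≠ none).card

theorem lead_emp (t : Shape) (c : ZMod 2) (s : t.NS) : t.lead c s t.emp = c := by
  induction t generalizing c with
  | leaf => rfl
  | bin d A B hA hB =>
    have h1 := hA; have h2 := hB
    unfold emp at h1 h2
    simp [lead, emp, h1, h2]

theorem ext_emp {d : Bool} {A B : Shape} (u : (bin d A B).LS)
    (h1 : (fun x => u (Sum.inl x)) = A.emp) (h2 : (fun x => u (Sum.inr x)) = B.emp) :
    u = emp _ := by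
  funext x
  rcases x with x | x
  · exact congrFun h1 x
  · exact congrFun h2 x

theorem lead_indep (t : Shape) (c c' : ZMod 2) (s : t.NS) (u : t.LS) (hu : u ≠ t.emp) :
    t.lead c s u = t.lead c' s u := by
  induction t generalizing c c' with
  | leaf =>
    simp only [lead]
    rcases h : u () with _ | b
    · exact absurd (funext fun _ => h) hu
    · rfl
  | bin d A B hA hB =>
    simp only [lead]
    by_cases h1 : (fun x => u (Sum.inl x)) = A.emp
    · have h2 : (fun x => u (Sum.inr x)) ≠ B.emp := fun h2 => hu (ext_emp u h1 h2)
      simp only [h1, lead_emp]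
      rw [hB c c' _ _ h2]
    · by_cases h2 : (fun x => u (Sum.inr x)) = B.emp
      · simp only [h2, lead_emp]
        rw [hA c c' _ _ h1]
      · rw [hA (B.lead c _ _) (B.lead c' _ _) _ _ h1, hB (A.lead c _ _) (A.lead c' _ _) _ _ h2]

theorem del_of_none {t : Shape} {u : t.LS} {x : t.L} (h : u x = none) : del u x = u := by
  simp [del, ← h]

theorem ns_del {t : Shape} {u : t.LS} {x : t.L} (h : u x ≠ none) : ns (del u x) + 1 = ns u := by
  unfold ns
  have : (Finset.univ.filter fun y => u y ≠ none) =
      insert x (Finset.univ.filter fun y => del u x y ≠ none) := by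
    ext y
    rw [Finset.mem_insert, Finset.mem_filter, Finset.mem_filter]
    by_cases hy : y = x
    · subst hy; simp [h]
    · simp [del, hy]
  rw [this, Finset.card_insert_of_notMem]
  rw [Finset.mem_filter]
  simp [del]

theorem nf_flip {t : Shape} {s : t.NS} {ν : t.N} (h : (s ν).2 = true) :
    nf (flip s ν) + 1 = nf s := by
  unfold nf
  have : (Finset.univ.filter fun y => (s y).2 = true) =
      insert ν (Finset.univ.filter fun y => (flip s ν y).2 = true) := by
    ext y
    rw [Finset.mem_insert, Finset.mem_filter, Finset.mem_filter]
    by_cases hy : y = ν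
    · subst hy; simp [h]
    · simp [flip, hy]
  rw [this, Finset.card_insert_of_notMem]
  rw [Finset.mem_filter]
  simp [flip]

theorem D_congr (t : Shape) (c c' : ZMod 2) (f g : t.NS → t.LS → ZMod 2) (s : t.NS) (u : t.LS)
    (h1 : ∀ x, u x ≠ none → (t.lead c s u + t.lead c s (del u x)) * f s (del u x) =
      (t.lead c' s u + t.lead c' s (del u x)) * g s (del u x))
    (h2 : ∀ ν, (s ν).2 = true → (t.lead c s u + t.lead c (flip s ν) u) * f (flip s ν) u =
      (t.lead c' s u + t.lead c' (flip s ν) u) * g (flip s ν) u) :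
    t.D c f s u = t.D c' g s u := by
  unfold D
  congr 1
  · refine Finset.sum_congr rfl fun x _ => ?_
    by_cases hx : u x = none
    · simp [del_of_none hx, CharTwo.add_self_eq_zero]
    · exact h1 x hx
  · refine Finset.sum_congr rfl fun ν _ => ?_
    split_ifs with h
    · exact h2 ν h
    · rfl

/-- `h` solves the transfer equation with boundary values `g` and source `f`. -/
def IsSol (t : Shape) (c : ZMod 2) (g : t.NS → ZMod 2) (f h : t.NS → t.LS → ZMod 2) : Prop :=
  (∀ s, h s t.emp = g s) ∧ ∀ s u, u ≠ t.emp → h s u = t.D c h s u + f s u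

theorem IsSol.unique {t : Shape} {c : ZMod 2} {g : t.NS → ZMod 2} {f h h' : t.NS → t.LS → ZMod 2}
    (H : IsSol t c g f h) (H' : IsSol t c g f h') : h = h' := by
  have key : ∀ k s u, nf s + ns u = k → h s u = h' s u := by
    intro k
    induction k using Nat.strong_induction_on with
    | _ k ih =>
      intro s u hk
      by_cases hu : u = t.emp
      · rw [hu, H.1, H'.1]
      · rw [H.2 s u hu, H'.2 s u hu]
        congr 1
        refine D_congr t c c h h' s u ?_ ?_
        · intro x hx
          have := ns_del hx
          rw [ih (nf s + ns (del u x)) (by omega) _ _ rfl]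
        · intro ν hν
          have := nf_flip hν
          rw [ih (nf (flip s ν) + ns u) (by omega) _ _ rfl]
  funext s u
  exact key _ s u rfl

open Classical in
/-- Approximations of the solution of the transfer equation. -/
noncomputable def approx (t : Shape) (c : ZMod 2) (g : t.NS → ZMod 2) (f : t.NS → t.LS → ZMod 2) :
    ℕ → t.NS → t.LS → ZMod 2
  | 0 => fun _ _ => 0
  | k + 1 => fun s u => if u = t.emp then g s else t.D c (approx t c g f k) s u + f s u

theorem approx_succ (t : Shape) (c : ZMod 2) (g : t.NS → ZMod 2) (f : t.NS → t.LS → ZMod 2)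
    (k : ℕ) (s : t.NS) (u : t.LS) (hk : nf s + ns u < k) :
    approx t c g f (k + 1) s u = approx t c g f k s u := by
  induction k generalizing s u with
  | zero => omega
  | succ k ih =>
    by_cases hu : u = t.emp
    · simp [approx, hu]
    · have e : ∀ j, approx t c g f (j + 1) s u = t.D c (approx t c g f j) s u + f s u :=
        fun j => if_neg hu
      rw [e, e]
      congr 1
      refine D_congr t c c _ _ s u ?_ ?_
      · intro x hx
        have := ns_del hx
        rw [ih _ _ (by omega)]
      · intro ν hν
        have := nf_flip hν
        rw [ih _ _ (by omega)]

/-- The solution of the transfer equation. -/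
noncomputable def Z (t : Shape) (c : ZMod 2) (g : t.NS → ZMod 2) (f : t.NS → t.LS → ZMod 2) :
    t.NS → t.LS → ZMod 2 :=
  approx t c g f (Fintype.card t.N + Fintype.card t.L + 1)

theorem Z_isSol (t : Shape) (c : ZMod 2) (g : t.NS → ZMod 2) (f : t.NS → t.LS → ZMod 2) :
    IsSol t c g f (Z t c g f) := by
  constructor
  · intro s
    simp [Z, approx]
  · intro s u hu
    have h1 : nf s ≤ Fintype.card t.N := Finset.card_le_univ _
    have h2 : ns u ≤ Fintype.card t.L := Finset.card_le_univ _
    unfold Z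
    rw [← approx_succ _ _ _ _ _ _ _ (by omega), approx]
    exact if_neg hu

theorem D_add (t : Shape) (c : ZMod 2) (f g : t.NS → t.LS → ZMod 2) (s : t.NS) (u : t.LS) :
    t.D c (fun s u => f s u + g s u) s u = t.D c f s u + t.D c g s u := by
  have h : ∀ (p : Prop) [Decidable p] (a b : ZMod 2),
      (if p then a + b else 0) = (if p then a else 0) + if p then b else 0 := by
    intro p _ a b; split_ifs <;> simp
  simp only [D, mul_add, Finset.sum_add_distrib, h]
  ring

theorem D_mul (t : Shape) (c r : ZMod 2) (f : t.NS → t.LS → ZMod 2) (s : t.NS) (u : t.LS) :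
    t.D c (fun s u => r * f s u) s u = r * t.D c f s u := by
  simp only [D, mul_add, Finset.mul_sum]
  congr 1
  · exact Finset.sum_congr rfl fun _ _ => by ring
  · refine Finset.sum_congr rfl fun _ _ => ?_
    split_ifs <;> ring

theorem Z_add (t : Shape) (c : ZMod 2) (g g' : t.NS → ZMod 2) (f f' : t.NS → t.LS → ZMod 2) :
    Z t c (fun s => g s + g' s) (fun s u => f s u + f' s u) =
      fun s u => Z t c g f s u + Z t c g' f' s u := by
  refine (Z_isSol t c _ _).unique ⟨?_, ?_⟩
  · intro s
    beta_reduce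
    rw [(Z_isSol t c g f).1, (Z_isSol t c g' f').1]
  · intro s u hu
    rw [D_add]
    beta_reduce
    rw [(Z_isSol t c g f).2 s u hu, (Z_isSol t c g' f').2 s u hu]
    ring

theorem Z_mul (t : Shape) (c r : ZMod 2) (g : t.NS → ZMod 2) (f : t.NS → t.LS → ZMod 2) :
    Z t c (fun s => r * g s) (fun s u => r * f s u) = fun s u => r * Z t c g f s u := by
  refine (Z_isSol t c _ _).unique ⟨?_, ?_⟩
  · intro s
    beta_reduce
    rw [(Z_isSol t c g f).1]
  · intro s u hu
    rw [D_mul]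
    beta_reduce
    rw [(Z_isSol t c g f).2 s u hu]
    ring

theorem Z_zero (t : Shape) (c : ZMod 2) : Z t c (fun _ => 0) (fun _ _ => 0) = fun _ _ => 0 := by
  simpa using Z_mul t c 0 (fun _ => 0) (fun _ _ => 0)

theorem Z_sum_source (t : Shape) (c : ZMod 2) {ι : Type*} (I : Finset ι)
    (f : ι → t.NS → t.LS → ZMod 2) :
    Z t c (fun _ => 0) (fun s u => ∑ i ∈ I, f i s u) =
      fun s u => ∑ i ∈ I, Z t c (fun _ => 0) (f i) s u := by
  classical
  induction I using Finset.induction_on with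
  | empty => simp [Z_zero]
  | insert i I hi ih =>
    simp only [Finset.sum_insert hi]
    have := Z_add t c (fun _ => 0) (fun _ => 0) (f i) (fun s u => ∑ i ∈ I, f i s u)
    rw [add_zero, ih] at this
    exact this

/-- Only the source at nonempty states matters. -/
theorem Z_congr_source (t : Shape) (c : ZMod 2) (g : t.NS → ZMod 2) (f f' : t.NS → t.LS → ZMod 2)
    (h : ∀ s u, u ≠ t.emp → f s u = f' s u) : Z t c g f = Z t c g f' := by
  refine (Z_isSol t c g f).unique ⟨(Z_isSol t c g f').1, fun s u hu => ?_⟩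
  rw [(Z_isSol t c g f').2 s u hu, h s u hu]

/-- With boundary value zero the external sign plays no role. -/
theorem Z_ext (t : Shape) (c c' : ZMod 2) (f : t.NS → t.LS → ZMod 2) :
    Z t c (fun _ => 0) f = Z t c' (fun _ => 0) f := by
  refine (Z_isSol t c _ f).unique ⟨(Z_isSol t c' _ f).1, fun s u hu => ?_⟩
  rw [(Z_isSol t c' _ f).2 s u hu]
  congr 1
  refine D_congr t c' c _ _ s u ?_ ?_
  · intro x _
    by_cases hx : del u x = t.emp
    · rw [hx, (Z_isSol t c' _ f).1, mul_zero, mul_zero]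
    · rw [lead_indep t c' c s u hu, lead_indep t c' c s _ hx]
  · intro ν _
    rw [lead_indep t c' c s u hu, lead_indep t c' c _ u hu]

/-- Inserting the solution as its own source counts the steps. -/
theorem Z_rank (t : Shape) (c : ZMod 2) (g : t.NS → ZMod 2) (s : t.NS) (u : t.LS) :
    Z t c (fun _ => 0) (Z t c g fun _ _ => 0) s u =
      ((nf s + ns u : ℕ) : ZMod 2) * Z t c g (fun _ _ => 0) s u +
        Z t c (fun s => (nf s : ZMod 2) * g s) (fun _ _ => 0) s u := by
  have hns : ns t.emp = 0 := by simp [ns, emp]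
  have hZ := Z_isSol t c g fun _ _ => 0
  have hZ' := Z_isSol t c (fun s => (nf s : ZMod 2) * g s) fun _ _ => 0
  have h1 : IsSol t c (fun _ => 0) (Z t c g fun _ _ => 0) fun s u =>
      ((nf s + ns u : ℕ) : ZMod 2) * Z t c g (fun _ _ => 0) s u +
        Z t c (fun s => (nf s : ZMod 2) * g s) (fun _ _ => 0) s u := by
    constructor
    · intro s
      beta_reduce
      rw [hZ.1, hZ'.1, hns, add_zero]
      exact CharTwo.add_self_eq_zero _
    · intro s u hu
      rw [D_add]
      have e : t.D c (fun s u => ((nf s + ns u : ℕ) : ZMod 2) * Z t c g (fun _ _ => 0) s u) s u =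
          t.D c (fun s' u' => (((nf s + ns u : ℕ) : ZMod 2) + 1) * Z t c g (fun _ _ => 0) s' u')
            s u := by
        refine D_congr t c c _ _ s u ?_ ?_
        · intro x hx
          have e1 : (nf s + ns (del u x)) + 1 = nf s + ns u := by have := ns_del hx; omega
          rw [← e1]; push_cast
          rw [add_assoc (_ + _ : ZMod 2) 1 1, CharTwo.add_self_eq_zero, add_zero]
        · intro ν hν
          have e1 : (nf (flip s ν) + ns u) + 1 = nf s + ns u := by have := nf_flip hν; omega
          rw [← e1]; push_cast
          rw [add_assoc (_ + _ : ZMod 2) 1 1, CharTwo.add_self_eq_zero, add_zero]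
      rw [e, D_mul]
      have h2 := hZ.2 s u hu
      have h3 := hZ'.2 s u hu
      rw [add_zero] at h2 h3
      rw [← h2, ← h3]
      have := CharTwo.add_self_eq_zero (Z t c g (fun _ _ => 0) s u)
      linear_combination -this
  exact congrFun (congrFun ((Z_isSol t c _ _).unique h1) s) u

end Shape

namespace Shape

/-- The state given by a full set of signs. -/
def ful {t : Shape} (v : t.L → Bool) : t.LS := fun x => some (v x)

theorem nonempty_L (t : Shape) : Nonempty t.L := by
  induction t with
  | leaf => exact ⟨()⟩
  | bin d A B hA hB => exact hA.elim fun x => ⟨Sum.inl x⟩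

theorem ful_ne_emp {t : Shape} (v : t.L → Bool) : ful v ≠ t.emp := by
  intro h
  obtain ⟨x⟩ := t.nonempty_L
  simpa [ful, emp] using congrFun h x

/-- The cardinality of a set of flagged vertices. -/
noncomputable def cj {t : Shape} (J : t.N → Bool) : ℕ := ∑ ν, if J ν then 1 else 0

/-- The number of leaves. -/
noncomputable def size (t : Shape) : ℕ := Fintype.card t.L

/-- Change the orientations of a set of vertices. -/
def jump {t : Shape} (s : t.NS) (J : t.N → Bool) : t.NS :=
  fun ν => if J ν then (!(s ν).1, false) else s ν

open Classical in
/-- The indicator of the sets of vertices which may change. -/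
noncomputable def ok {t : Shape} (s : t.NS) (J : t.N → Bool) : ZMod 2 :=
  if ∀ ν, J ν = true → (s ν).2 = true then 1 else 0

/-- The parity of the number of paths along which exactly a given set of vertices changes. -/
noncomputable def wt : (t : Shape) → (t.N → Bool) → ZMod 2
  | leaf, _ => 1
  | bin c A B, J =>
    let JA : A.N → Bool := fun ν => J (Sum.inr (Sum.inl ν))
    let JB : B.N → Bool := fun ν => J (Sum.inr (Sum.inr ν))
    (if h : c = true then
      (if J (Sum.inl ⟨h⟩) then ((A.size + cj JA : ℕ) : ZMod 2) * ((B.size + cj JB : ℕ) : ZMod 2)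
        else 1) else 1) * (wt A JA * wt B JB)

/-- The evaluation of the path sums starting from all full states. -/
def KProp (t : Shape) : Prop := ∀ (c c0 : ZMod 2) (g : t.NS → ZMod 2) (s : t.NS),
  ∑ v, (1 + c0 + t.lead 0 s (ful v)) * Z t c g (fun _ _ => 0) s (ful v) =
    ∑ J, ok s J * (1 + c + c0 + ((t.size + cj J : ℕ) : ZMod 2)) * wt t J * g (jump s J)

theorem lead_ful {t : Shape} (c : ZMod 2) (s : t.NS) (v : t.L → Bool) :
    t.lead c s (ful v) = t.lead 0 s (ful v) := lead_indep t c 0 s _ (ful_ne_emp v)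

theorem nf_jump {t : Shape} (s : t.NS) (J : t.N → Bool) :
    ok s J * (nf s : ZMod 2) = ok s J * ((nf (jump s J) + cj J : ℕ) : ZMod 2) := by
  unfold ok
  split_ifs with h
  · have : nf s = nf (jump s J) + cj J := by
      unfold nf cj
      rw [Finset.card_filter, Finset.card_filter, ← Finset.sum_add_distrib]
      refine Finset.sum_congr rfl fun ν _ => ?_
      unfold jump
      cases hJ : J ν
      · simp
      · simp [h ν hJ]
    rw [this]
  · simp

theorem ns_ful {t : Shape} (v : t.L → Bool) : ns (ful v) = t.size := by
  unfold ns size ful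
  simp

theorem zmod_split (G : ZMod 2 → ZMod 2) (l : ZMod 2) : G l = (1 + l) * G 0 + l * G 1 := by
  have h : l = 0 ∨ l = 1 := by revert l; decide
  rcases h with rfl | rfl
  · simp
  · have : (1 : ZMod 2) + 1 = 0 := by decide
    simp [this]

/-- The solution of the transfer equation for two blocks one after the other. -/
theorem pair_eq (A B : Shape) (c : ZMod 2) (g : A.NS → B.NS → ZMod 2)
    (F H : A.NS → A.LS → B.NS → B.LS → ZMod 2)
    (h0 : ∀ sA sB, H sA A.emp sB B.emp = g sA sB)
    (h1 : ∀ sA sB b, b ≠ B.emp → H sA A.emp sB b = B.D c (fun s u => H sA A.emp s u) sB b)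
    (h2 : ∀ sA a sB b, a ≠ A.emp → H sA a sB b =
      A.D (B.lead c sB b) (fun s u => H s u sB b) sA a + F sA a sB b)
    (sA : A.NS) (a : A.LS) (sB : B.NS) (b : B.LS) :
    H sA a sB b = Z A (B.lead c sB b) (fun sA' => Z B c (fun sB' => g sA' sB') (fun _ _ => 0) sB b)
      (fun s u => F s u sB b) sA a := by
  have e1 : ∀ sA sB b, H sA A.emp sB b = Z B c (fun sB' => g sA sB') (fun _ _ => 0) sB b := by
    intro sA sB b
    have : IsSol B c (fun sB' => g sA sB') (fun _ _ => 0) (fun s u => H sA A.emp s u) := by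
      refine ⟨fun s => h0 sA s, fun s u hu => ?_⟩
      beta_reduce
      rw [add_zero]
      exact h1 sA s u hu
    exact congrFun (congrFun (this.unique (Z_isSol B c _ _)) sB) b
  have : IsSol A (B.lead c sB b) (fun sA' => Z B c (fun sB' => g sA' sB') (fun _ _ => 0) sB b)
      (fun s u => F s u sB b) (fun s u => H s u sB b) :=
    ⟨fun s => e1 s sB b, fun s u hu => h2 s u sB b hu⟩
  exact congrFun (congrFun (this.unique (Z_isSol A _ _ _)) sA) a

theorem pairK_zero (A B : Shape) (KA : KProp A) (KB : KProp B) (c c0 : ZMod 2)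
    (g : A.NS → B.NS → ZMod 2) (sA : A.NS) (sB : B.NS) :
    ∑ va, ∑ vb, (1 + c0 + A.lead 0 sA (ful va)) * Z A (B.lead 0 sB (ful vb))
      (fun sA' => Z B c (fun sB' => g sA' sB') (fun _ _ => 0) sB (ful vb)) (fun _ _ => 0)
      sA (ful va) =
    ∑ JA, ∑ JB, ok sA JA * ok sB JB * (wt A JA * wt B JB) *
      (1 + c + c0 + ((A.size + cj JA : ℕ) : ZMod 2) + ((B.size + cj JB : ℕ) : ZMod 2)) *
      g (jump sA JA) (jump sB JB) := by
  rw [Finset.sum_comm]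
  have step : ∀ vb : B.L → Bool, ∑ va, (1 + c0 + A.lead 0 sA (ful va)) * Z A (B.lead 0 sB (ful vb))
      (fun sA' => Z B c (fun sB' => g sA' sB') (fun _ _ => 0) sB (ful vb)) (fun _ _ => 0)
      sA (ful va) = ∑ JA, ok sA JA * wt A JA *
        ((1 + (c0 + ((A.size + cj JA : ℕ) : ZMod 2)) + B.lead 0 sB (ful vb)) *
          Z B c (fun sB' => g (jump sA JA) sB') (fun _ _ => 0) sB (ful vb)) := by
    intro vb
    rw [KA]
    refine Finset.sum_congr rfl fun JA _ => ?_
    ring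
  rw [Finset.sum_congr rfl fun vb _ => step vb, Finset.sum_comm]
  refine Finset.sum_congr rfl fun JA _ => ?_
  rw [← Finset.mul_sum, KB, Finset.mul_sum]
  refine Finset.sum_congr rfl fun JB _ => ?_
  ring

theorem sum_exchange (A B : Shape) (KA : KProp A) (KB : KProp B) (c c0 : ZMod 2)
    (g : A.NS → B.NS → ZMod 2) (sA : A.NS) (sB : B.NS) :
    ∑ va, ∑ vb, (1 + c0 + A.lead 0 sA (ful va)) * Z A (B.lead 0 sB (ful vb)) (fun _ => 0)
      (fun s u => (A.lead (B.lead c sB (ful vb)) s u + B.lead (A.lead c s u) sB (ful vb)) *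
        Z B (A.lead c s u) (fun sB' => Z A c (fun sA' => g sA' sB') (fun _ _ => 0) s u)
          (fun _ _ => 0) sB (ful vb)) sA (ful va) =
    ∑ JA, ∑ JB, ok sA JA * ok sB JB * (wt A JA * wt B JB) *
      (((A.size + cj JA : ℕ) : ZMod 2) * ((B.size + cj JB : ℕ) : ZMod 2)) *
      (1 + c + c0 + ((A.size + cj JA : ℕ) : ZMod 2)) *
      g (jump sA JA) (jump sB JB) := by
  have two : ∀ x : ZMod 2, x + x = 0 := CharTwo.add_self_eq_zero
  set F : A.NS → A.LS → (B.L → Bool) → ZMod 2 := fun s u vb =>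
    (A.lead (B.lead c sB (ful vb)) s u + B.lead (A.lead c s u) sB (ful vb)) *
        Z B (A.lead c s u) (fun sB' => Z A c (fun sA' => g sA' sB') (fun _ _ => 0) s u)
          (fun _ _ => 0) sB (ful vb) with hF
  have hsum : ∀ s u, u ≠ A.emp → ∑ vb, F s u vb = ∑ JB, ok sB JB *
      ((B.size + cj JB : ℕ) : ZMod 2) * wt B JB *
      Z A c (fun sA' => g sA' (jump sB JB)) (fun _ _ => 0) s u := by
    intro s u hu
    set l := A.lead 0 s u with hl
    set G : B.NS → ZMod 2 := fun sB' => Z A c (fun sA' => g sA' sB') (fun _ _ => 0) s u with hG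
    have e : ∀ vb, F s u vb = l * ((1 + 0 + B.lead 0 sB (ful vb)) * Z B 1 G (fun _ _ => 0) sB (ful vb))
        + (l + 1) * ((1 + 1 + B.lead 0 sB (ful vb)) * Z B 0 G (fun _ _ => 0) sB (ful vb)) := by
      intro vb
      simp only [hF]
      rw [lead_indep A _ 0 s u hu, lead_indep A c 0 s u hu, lead_ful, ← hl, ← hG]
      set m := B.lead 0 sB (ful vb)
      have h := zmod_split (fun l => (l + m) * Z B l G (fun _ _ => 0) sB (ful vb)) l
      have h' := zmod_split (fun m => l * ((1 + 0 + m) * Z B 1 G (fun _ _ => 0) sB (ful vb))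
        + (l + 1) * ((1 + 1 + m) * Z B 0 G (fun _ _ => 0) sB (ful vb))) m
      have h2 : (1 : ZMod 2) + 1 = 0 := by decide
      beta_reduce at h h'
      rw [h, h2]
      ring
    rw [Finset.sum_congr rfl fun vb _ => e vb, Finset.sum_add_distrib, ← Finset.mul_sum,
      ← Finset.mul_sum, KB, KB, Finset.mul_sum, Finset.mul_sum, ← Finset.sum_add_distrib]
    refine Finset.sum_congr rfl fun JB _ => ?_
    have h2 : (1 : ZMod 2) + 1 = 0 := by decide
    have h3 : l + l = 0 := two l
    rw [add_zero, h2, add_zero, h2]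
    linear_combination (ok sB JB * ((B.size + cj JB : ℕ) : ZMod 2) * wt B JB * G (jump sB JB)) * h3
  have e1 : ∀ va : A.L → Bool, ∑ vb, (1 + c0 + A.lead 0 sA (ful va)) *
      Z A (B.lead 0 sB (ful vb)) (fun _ => 0) (fun s u => F s u vb) sA (ful va) =
      ∑ JB, ok sB JB * ((B.size + cj JB : ℕ) : ZMod 2) * wt B JB *
        ((nf sA + A.size : ℕ) * ((1 + c0 + A.lead 0 sA (ful va)) *
          Z A c (fun sA' => g sA' (jump sB JB)) (fun _ _ => 0) sA (ful va)) +
        (1 + c0 + A.lead 0 sA (ful va)) *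
          Z A c (fun sA' => (nf sA' : ZMod 2) * g sA' (jump sB JB)) (fun _ _ => 0) sA (ful va)) := by
    intro va
    rw [← Finset.mul_sum]
    have e2 : ∀ vb, Z A (B.lead 0 sB (ful vb)) (fun _ => 0) (fun s u => F s u vb) sA (ful va) =
      Z A c (fun _ => 0) (fun s u => F s u vb) sA (ful va) := fun vb => by rw [Z_ext A _ c]
    rw [Finset.sum_congr rfl fun vb _ => e2 vb]
    have e3 := congrFun (congrFun (Z_sum_source A c Finset.univ fun vb s u => F s u vb) sA) (ful va)
    beta_reduce at e3
    rw [← e3, Z_congr_source A c _ _ _ hsum, Z_sum_source, Finset.mul_sum]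
    refine Finset.sum_congr rfl fun JB _ => ?_
    have e4 := congrFun (congrFun (Z_mul A c (ok sB JB *
      ((B.size + cj JB : ℕ) : ZMod 2) * wt B JB) (fun _ => 0)
      (Z A c (fun sA' => g sA' (jump sB JB)) fun _ _ => 0)) sA) (ful va)
    simp only [mul_zero] at e4
    rw [e4, Z_rank, ns_ful]
    ring
  rw [Finset.sum_congr rfl fun va _ => e1 va, Finset.sum_comm]
  rw [Finset.sum_comm (s := (Finset.univ : Finset (A.N → Bool)))]
  refine Finset.sum_congr rfl fun JB _ => ?_
  rw [← Finset.mul_sum, Finset.sum_add_distrib, ← Finset.mul_sum, KA, KA, Finset.mul_sum,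
    ← Finset.sum_add_distrib, Finset.mul_sum]
  refine Finset.sum_congr rfl fun JA _ => ?_
  have h := nf_jump sA JA
  have h3 := two (nf (jump sA JA) : ZMod 2)
  push_cast at h ⊢
  linear_combination (ok sB JB * (B.size + cj JB) * wt B JB *
    (1 + c + c0 + (A.size + cj JA)) * wt A JA * g (jump sA JA) (jump sB JB)) * (h + ok sA JA * h3)

end Shape

namespace Shape

variable {d : Bool} {A B : Shape}

/-- Assemble a vertex state of a binary shape. -/
def mk (r : PLift (d = true) → Bool × Bool) (sA : A.NS) (sB : B.NS) : (bin d A B).NS :=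
  Sum.elim r (Sum.elim sA sB)

/-- Assemble a leaf state of a binary shape. -/
def mkL (d : Bool) (a : A.LS) (b : B.LS) : (bin d A B).LS := Sum.elim a b

/-- The root state as a pair of bits. -/
def rr (r : PLift (d = true) → Bool × Bool) : Bool × Bool :=
  if h : d = true then r ⟨h⟩ else (false, false)

/-- The root state after the change of orientation. -/
def st (r : PLift (d = true) → Bool × Bool) : PLift (d = true) → Bool × Bool :=
  fun h => (!(r h).1, false)

theorem lead_mk (c : ZMod 2) (r : PLift (d = true) → Bool × Bool) (sA : A.NS) (sB : B.NS)
    (a : A.LS) (b : B.LS) : (bin d A B).lead c (mk r sA sB) (mkL d a b) =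
      if (rr r).1 then B.lead (A.lead c sA a) sB b else A.lead (B.lead c sB b) sA a := rfl

theorem del_same {t : Shape} (u : t.LS) (x : t.L) : del u x x = none := by simp [del]

theorem del_ne {t : Shape} (u : t.LS) {x y : t.L} (h : y ≠ x) : del u x y = u y := by simp [del, h]

theorem flip_same {t : Shape} (s : t.NS) (ν : t.N) : flip s ν ν = (!(s ν).1, false) := by
  simp [flip]

theorem flip_ne {t : Shape} (s : t.NS) {ν μ : t.N} (h : μ ≠ ν) : flip s ν μ = s μ := by
  simp [flip, h]

theorem del_mkL_inl (a : A.LS) (b : B.LS) (x : A.L) :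
    del (mkL d a b) (Sum.inl x) = mkL d (del a x) b := by
  funext y
  rcases y with y | y
  · by_cases h : y = x
    · subst h
      exact (del_same (mkL d a b) (Sum.inl y)).trans (del_same a y).symm
    · exact (del_ne (mkL d a b) fun e => h (Sum.inl.inj e)).trans (del_ne a h).symm
  · exact del_ne (mkL d a b) (x := Sum.inl x) Sum.inr_ne_inl

theorem del_mkL_inr (a : A.LS) (b : B.LS) (x : B.L) :
    del (mkL d a b) (Sum.inr x) = mkL d a (del b x) := by
  funext y
  rcases y with y | y
  · exact del_ne (mkL d a b) (x := Sum.inr x) Sum.inl_ne_inr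
  · by_cases h : y = x
    · subst h
      exact (del_same (mkL d a b) (Sum.inr y)).trans (del_same b y).symm
    · exact (del_ne (mkL d a b) fun e => h (Sum.inr.inj e)).trans (del_ne b h).symm

theorem flip_mk_root (r : PLift (d = true) → Bool × Bool) (sA : A.NS) (sB : B.NS)
    (h : PLift (d = true)) : flip (mk r sA sB) (Sum.inl h) = mk (st r) sA sB := by
  funext y
  rcases y with y | y
  · obtain rfl : y = h := Subsingleton.elim _ _
    exact flip_same (mk r sA sB) (Sum.inl y)
  · exact flip_ne (mk r sA sB) (ν := Sum.inl h) Sum.inr_ne_inl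

theorem flip_mk_inl (r : PLift (d = true) → Bool × Bool) (sA : A.NS) (sB : B.NS)
    (ν : A.N) : flip (mk r sA sB) (Sum.inr (Sum.inl ν)) = mk r (flip sA ν) sB := by
  funext y
  rcases y with y | y | y
  · exact flip_ne (mk r sA sB) (ν := Sum.inr (Sum.inl ν)) Sum.inl_ne_inr
  · by_cases h : y = ν
    · subst h
      exact (flip_same (mk r sA sB) (Sum.inr (Sum.inl y))).trans (flip_same sA y).symm
    · exact (flip_ne (mk r sA sB) fun e => h (Sum.inl.inj (Sum.inr.inj e))).trans
        (flip_ne sA h).symm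
  · exact flip_ne (mk r sA sB) (ν := Sum.inr (Sum.inl ν)) fun e =>
      Sum.inr_ne_inl (Sum.inr.inj e)

theorem flip_mk_inr (r : PLift (d = true) → Bool × Bool) (sA : A.NS) (sB : B.NS)
    (ν : B.N) : flip (mk r sA sB) (Sum.inr (Sum.inr ν)) = mk r sA (flip sB ν) := by
  funext y
  rcases y with y | y | y
  · exact flip_ne (mk r sA sB) (ν := Sum.inr (Sum.inr ν)) Sum.inl_ne_inr
  · exact flip_ne (mk r sA sB) (ν := Sum.inr (Sum.inr ν)) fun e =>
      Sum.inl_ne_inr (Sum.inr.inj e)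
  · by_cases h : y = ν
    · subst h
      exact (flip_same (mk r sA sB) (Sum.inr (Sum.inr y))).trans (flip_same sB y).symm
    · exact (flip_ne (mk r sA sB) fun e => h (Sum.inr.inj (Sum.inr.inj e))).trans
        (flip_ne sB h).symm

theorem mkL_eq_emp {a : A.LS} {b : B.LS} : mkL d a b = emp _ ↔ a = A.emp ∧ b = B.emp := by
  constructor
  · intro h
    exact ⟨funext fun x => congrFun h (Sum.inl x), funext fun x => congrFun h (Sum.inr x)⟩
  · rintro ⟨rfl, rfl⟩
    funext x
    rcases x with x | x <;> rfl

/-- The contribution of the moves in the second of two blocks. -/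
noncomputable def DT (A B : Shape) (c : ZMod 2) (sA : A.NS) (a : A.LS)
    (f : B.NS → B.LS → ZMod 2) (sB : B.NS) (b : B.LS) : ZMod 2 :=
  ∑ x, (A.lead (B.lead c sB b) sA a + A.lead (B.lead c sB (del b x)) sA a) * f sB (del b x) +
  ∑ ν, (if (sB ν).2 then (A.lead (B.lead c sB b) sA a + A.lead (B.lead c (flip sB ν) b) sA a) *
    f (flip sB ν) b else 0)

theorem DT_emp (c : ZMod 2) (sA : A.NS) (f : B.NS → B.LS → ZMod 2) (sB : B.NS) (b : B.LS) :
    DT A B c sA A.emp f sB b = B.D c f sB b := by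
  simp only [DT, lead_emp, D]

theorem DT_of_ne (c : ZMod 2) (sA : A.NS) (a : A.LS) (ha : a ≠ A.emp) (f : B.NS → B.LS → ZMod 2)
    (sB : B.NS) (b : B.LS) : DT A B c sA a f sB b = 0 := by
  simp only [DT]
  rw [Finset.sum_eq_zero, Finset.sum_eq_zero, add_zero]
  · intro ν _
    rw [lead_indep A _ (B.lead c sB b) sA a ha, lead_indep A (B.lead c (flip sB ν) b)
      (B.lead c sB b) sA a ha, CharTwo.add_self_eq_zero]
    simp
  · intro x _
    rw [lead_indep A _ (B.lead c sB b) sA a ha, lead_indep A (B.lead c sB (del b x))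
      (B.lead c sB b) sA a ha, CharTwo.add_self_eq_zero]
    simp

theorem D_emp_zero (c : ZMod 2) (f : A.NS → A.LS → ZMod 2) (s : A.NS) : A.D c f s A.emp = 0 := by
  simp only [D]
  rw [Finset.sum_eq_zero, Finset.sum_eq_zero, add_zero]
  · intro ν _
    simp [lead_emp, CharTwo.add_self_eq_zero]
  · intro x _
    rw [del_of_none rfl, CharTwo.add_self_eq_zero, zero_mul]

theorem sum_root (F : PLift (d = true) → ZMod 2) (r : PLift (d = true) → Bool × Bool) (G : ZMod 2)
    (hF : ∀ h, F h = if (r h).2 then G else 0) :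
    ∑ h, F h = if (rr r).2 then G else 0 := by
  rw [Finset.sum_congr rfl fun h _ => hF h]
  cases d with
  | false =>
    have : IsEmpty (PLift (false = true)) := ⟨fun h => by simpa using h.down⟩
    simp [rr]
  | true =>
    let _ : Unique (PLift (true = true)) := ⟨⟨⟨rfl⟩⟩, fun _ => rfl⟩
    rw [Fintype.sum_unique]
    rfl

theorem rr_st_fst (r : PLift (d = true) → Bool × Bool) (h : (rr r).2 = true) :
    (rr (st r)).1 = !(rr r).1 := by
  cases d with
  | false => simp [rr] at h
  | true => rfl

theorem rr_st_snd (r : PLift (d = true) → Bool × Bool) : (rr (st r)).2 = false := by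
  cases d with
  | false => rfl
  | true => rfl

theorem D_bin_false (c : ZMod 2) (f : (bin d A B).NS → (bin d A B).LS → ZMod 2)
    (r : PLift (d = true) → Bool × Bool) (hr : (rr r).1 = false)
    (sA : A.NS) (sB : B.NS) (a : A.LS) (b : B.LS) :
    (bin d A B).D c f (mk r sA sB) (mkL d a b) =
      A.D (B.lead c sB b) (fun s u => f (mk r s sB) (mkL d u b)) sA a +
      DT A B c sA a (fun s u => f (mk r sA s) (mkL d a u)) sB b +
      (if (rr r).2 then (A.lead (B.lead c sB b) sA a + B.lead (A.lead c sA a) sB b) *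
        f (mk (st r) sA sB) (mkL d a b) else 0) := by
  have h1 := Fintype.sum_sum_type (α₁ := A.L) (α₂ := B.L) fun x => ((bin d A B).lead c (mk r sA sB)
    (mkL d a b) + (bin d A B).lead c (mk r sA sB) (del (mkL d a b) x)) *
    f (mk r sA sB) (del (mkL d a b) x)
  have h2 := Fintype.sum_sum_type (α₁ := PLift (d = true)) (α₂ := A.N ⊕ B.N) fun ν =>
    if (mk r sA sB ν).2 then ((bin d A B).lead c (mk r sA sB)
      (mkL d a b) + (bin d A B).lead c (flip (mk r sA sB) ν) (mkL d a b)) *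
      f (flip (mk r sA sB) ν) (mkL d a b) else 0
  have h3 := sum_root (fun h => if (mk (A := A) (B := B) r sA sB (Sum.inl h)).2 then
      ((bin d A B).lead c (mk r sA sB) (mkL d a b) +
        (bin d A B).lead c (flip (mk r sA sB) (Sum.inl h)) (mkL d a b)) *
      f (flip (mk r sA sB) (Sum.inl h)) (mkL d a b) else 0) r
      ((A.lead (B.lead c sB b) sA a + B.lead (A.lead c sA a) sB b) *
        f (mk (st r) sA sB) (mkL d a b)) (by
      intro h
      obtain ⟨h⟩ := h
      have e : rr r = r ⟨h⟩ := dif_pos h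
      change (if (r ⟨h⟩).2 then _ else _) = _
      split_ifs with h'
      · rw [flip_mk_root, lead_mk, lead_mk, rr_st_fst r (by rw [e, h']), hr]
        simp
      · rfl)
  rw [Fintype.sum_sum_type (α₁ := A.N) (α₂ := B.N)] at h2
  rw [h3] at h2
  refine (congrArg₂ (· + ·) h1 h2).trans ?_
  simp only [del_mkL_inl, del_mkL_inr, flip_mk_inl, flip_mk_inr, lead_mk, hr, D, DT]
  simp only [mk, Sum.elim_inr, Sum.elim_inl, Bool.false_eq_true, if_false]
  ring

theorem D_bin_true (c : ZMod 2) (f : (bin d A B).NS → (bin d A B).LS → ZMod 2)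
    (r : PLift (d = true) → Bool × Bool) (hr : (rr r).1 = true)
    (sA : A.NS) (sB : B.NS) (a : A.LS) (b : B.LS) :
    (bin d A B).D c f (mk r sA sB) (mkL d a b) =
      B.D (A.lead c sA a) (fun s u => f (mk r sA s) (mkL d a u)) sB b +
      DT B A c sB b (fun s u => f (mk r s sB) (mkL d u b)) sA a +
      (if (rr r).2 then (B.lead (A.lead c sA a) sB b + A.lead (B.lead c sB b) sA a) *
        f (mk (st r) sA sB) (mkL d a b) else 0) := by
  have h1 := Fintype.sum_sum_type (α₁ := A.L) (α₂ := B.L) fun x => ((bin d A B).lead c (mk r sA sB)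
    (mkL d a b) + (bin d A B).lead c (mk r sA sB) (del (mkL d a b) x)) *
    f (mk r sA sB) (del (mkL d a b) x)
  have h2 := Fintype.sum_sum_type (α₁ := PLift (d = true)) (α₂ := A.N ⊕ B.N) fun ν =>
    if (mk r sA sB ν).2 then ((bin d A B).lead c (mk r sA sB)
      (mkL d a b) + (bin d A B).lead c (flip (mk r sA sB) ν) (mkL d a b)) *
      f (flip (mk r sA sB) ν) (mkL d a b) else 0
  have h3 := sum_root (fun h => if (mk (A := A) (B := B) r sA sB (Sum.inl h)).2 then
      ((bin d A B).lead c (mk r sA sB) (mkL d a b) +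
        (bin d A B).lead c (flip (mk r sA sB) (Sum.inl h)) (mkL d a b)) *
      f (flip (mk r sA sB) (Sum.inl h)) (mkL d a b) else 0) r
      ((B.lead (A.lead c sA a) sB b + A.lead (B.lead c sB b) sA a) *
        f (mk (st r) sA sB) (mkL d a b)) (by
      intro h
      obtain ⟨h⟩ := h
      have e : rr r = r ⟨h⟩ := dif_pos h
      change (if (r ⟨h⟩).2 then _ else _) = _
      split_ifs with h'
      · rw [flip_mk_root, lead_mk, lead_mk, rr_st_fst r (by rw [e, h']), hr]
        simp
      · rfl)
  rw [Fintype.sum_sum_type (α₁ := A.N) (α₂ := B.N)] at h2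
  rw [h3] at h2
  refine (congrArg₂ (· + ·) h1 h2).trans ?_
  simp only [del_mkL_inl, del_mkL_inr, flip_mk_inl, flip_mk_inr, lead_mk, hr, D, DT]
  simp only [mk, Sum.elim_inr, Sum.elim_inl, if_true]
  ring

theorem Z_bin_false (c : ZMod 2) (g : (bin d A B).NS → ZMod 2)
    (r : PLift (d = true) → Bool × Bool) (hr : (rr r).1 = false)
    (sA : A.NS) (sB : B.NS) (a : A.LS) (b : B.LS) :
    Z (bin d A B) c g (fun _ _ => 0) (mk r sA sB) (mkL d a b) =
      Z A (B.lead c sB b)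
        (fun sA' => Z B c (fun sB' => g (mk r sA' sB')) (fun _ _ => 0) sB b)
        (fun s u => if (rr r).2 then (A.lead (B.lead c sB b) s u + B.lead (A.lead c s u) sB b) *
          Z (bin d A B) c g (fun _ _ => 0) (mk (st r) s sB) (mkL d u b) else 0) sA a := by
  have hZ := Z_isSol (bin d A B) c g fun _ _ => 0
  refine pair_eq A B c (fun sA sB => g (mk r sA sB))
    (fun s u sB b => if (rr r).2 then (A.lead (B.lead c sB b) s u + B.lead (A.lead c s u) sB b) *
          Z (bin d A B) c g (fun _ _ => 0) (mk (st r) s sB) (mkL d u b) else 0)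
    (fun sA a sB b => Z (bin d A B) c g (fun _ _ => 0) (mk r sA sB) (mkL d a b))
    ?_ ?_ ?_ sA a sB b
  · intro sA sB
    rw [mkL_eq_emp.2 ⟨rfl, rfl⟩, hZ.1]
  · intro sA sB b hb
    rw [hZ.2 _ _ fun h => hb (mkL_eq_emp.1 h).2, D_bin_false c _ r hr, DT_emp, D_emp_zero]
    simp [lead_emp, CharTwo.add_self_eq_zero]
  · intro sA a sB b ha
    rw [hZ.2 _ _ fun h => ha (mkL_eq_emp.1 h).1, D_bin_false c _ r hr, DT_of_ne _ _ _ ha]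
    simp

theorem Z_bin_true (c : ZMod 2) (g : (bin d A B).NS → ZMod 2)
    (r : PLift (d = true) → Bool × Bool) (hr : (rr r).1 = true)
    (sA : A.NS) (sB : B.NS) (a : A.LS) (b : B.LS) :
    Z (bin d A B) c g (fun _ _ => 0) (mk r sA sB) (mkL d a b) =
      Z B (A.lead c sA a)
        (fun sB' => Z A c (fun sA' => g (mk r sA' sB')) (fun _ _ => 0) sA a)
        (fun s u => if (rr r).2 then (B.lead (A.lead c sA a) s u + A.lead (B.lead c s u) sA a) *
          Z (bin d A B) c g (fun _ _ => 0) (mk (st r) sA s) (mkL d a u) else 0) sB b := by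
  have hZ := Z_isSol (bin d A B) c g fun _ _ => 0
  refine pair_eq B A c (fun sB sA => g (mk r sA sB))
    (fun s u sA a => if (rr r).2 then (B.lead (A.lead c sA a) s u + A.lead (B.lead c s u) sA a) *
          Z (bin d A B) c g (fun _ _ => 0) (mk (st r) sA s) (mkL d a u) else 0)
    (fun sB b sA a => Z (bin d A B) c g (fun _ _ => 0) (mk r sA sB) (mkL d a b))
    ?_ ?_ ?_ sB b sA a
  · intro sB sA
    rw [mkL_eq_emp.2 ⟨rfl, rfl⟩, hZ.1]
  · intro sB sA a ha
    rw [hZ.2 _ _ fun h => ha (mkL_eq_emp.1 h).1, D_bin_true c _ r hr, DT_emp, D_emp_zero]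
    simp [lead_emp, CharTwo.add_self_eq_zero]
  · intro sB b sA a hb
    rw [hZ.2 _ _ fun h => hb (mkL_eq_emp.1 h).2, D_bin_true c _ r hr, DT_of_ne _ _ _ hb]
    simp

theorem Z_split (t : Shape) (c : ZMod 2) (g : t.NS → ZMod 2) (f : t.NS → t.LS → ZMod 2)
    (s : t.NS) (u : t.LS) :
    Z t c g f s u = Z t c g (fun _ _ => 0) s u + Z t c (fun _ => 0) f s u := by
  have := congrFun (congrFun (Z_add t c g (fun _ => 0) (fun _ _ => 0) f) s) u
  simpa using this

/-- The common form of the evaluation at a binary shape. -/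
theorem sum_bin_false (KA : KProp A) (KB : KProp B) (c c0 : ZMod 2) (g : (bin d A B).NS → ZMod 2)
    (r : PLift (d = true) → Bool × Bool) (hr : (rr r).1 = false) (sA : A.NS) (sB : B.NS) :
    ∑ va : A.L → Bool, ∑ vb : B.L → Bool, (1 + c0 + A.lead 0 sA (ful va)) *
      Z (bin d A B) c g (fun _ _ => 0) (mk r sA sB) (mkL d (ful va) (ful vb)) =
    ∑ JA, ∑ JB, ok sA JA * ok sB JB * (wt A JA * wt B JB) *
      ((1 + c + c0 + ((A.size + cj JA : ℕ) : ZMod 2) + ((B.size + cj JB : ℕ) : ZMod 2)) *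
        g (mk r (jump sA JA) (jump sB JB)) +
      (if (rr r).2 then
        (((A.size + cj JA : ℕ) : ZMod 2) * ((B.size + cj JB : ℕ) : ZMod 2)) *
        (1 + c + c0 + ((A.size + cj JA : ℕ) : ZMod 2)) *
        g (mk (st r) (jump sA JA) (jump sB JB)) else 0)) := by
  have e : ∀ va : A.L → Bool, ∀ vb : B.L → Bool,
      Z (bin d A B) c g (fun _ _ => 0) (mk r sA sB) (mkL d (ful va) (ful vb)) =
      Z A (B.lead 0 sB (ful vb))
        (fun sA' => Z B c (fun sB' => g (mk r sA' sB')) (fun _ _ => 0) sB (ful vb))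
        (fun _ _ => 0) sA (ful va) +
      (if (rr r).2 then Z A (B.lead 0 sB (ful vb)) (fun _ => 0)
        (fun s u => (A.lead (B.lead c sB (ful vb)) s u + B.lead (A.lead c s u) sB (ful vb)) *
        Z B (A.lead c s u) (fun sB' => Z A c (fun sA' => g (mk (st r) sA' sB')) (fun _ _ => 0) s u)
          (fun _ _ => 0) sB (ful vb)) sA (ful va) else 0) := by
    intro va vb
    rw [Z_bin_false c g r hr, lead_ful, Z_split]
    congr 1
    split_ifs with h
    · congr 1
      funext s u
      rw [Z_bin_true c g (st r) (by rw [rr_st_fst r h, hr]; rfl), rr_st_snd]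
      simp [lead_ful]
    · rw [Z_zero]
  simp only [e, mul_add, Finset.sum_add_distrib]
  congr 1
  · rw [pairK_zero A B KA KB c c0 (fun sA sB => g (mk r sA sB))]
    refine Finset.sum_congr rfl fun JA _ => Finset.sum_congr rfl fun JB _ => ?_
    ring
  · split_ifs with h
    · rw [sum_exchange A B KA KB c c0 (fun sA sB => g (mk (st r) sA sB))]
      refine Finset.sum_congr rfl fun JA _ => Finset.sum_congr rfl fun JB _ => ?_
      ring
    · simp

theorem sum_bin_true (KA : KProp A) (KB : KProp B) (c c0 : ZMod 2) (g : (bin d A B).NS → ZMod 2)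
    (r : PLift (d = true) → Bool × Bool) (hr : (rr r).1 = true) (sA : A.NS) (sB : B.NS) :
    ∑ vb : B.L → Bool, ∑ va : A.L → Bool, (1 + c0 + B.lead 0 sB (ful vb)) *
      Z (bin d A B) c g (fun _ _ => 0) (mk r sA sB) (mkL d (ful va) (ful vb)) =
    ∑ JB, ∑ JA, ok sB JB * ok sA JA * (wt B JB * wt A JA) *
      ((1 + c + c0 + ((B.size + cj JB : ℕ) : ZMod 2) + ((A.size + cj JA : ℕ) : ZMod 2)) *
        g (mk r (jump sA JA) (jump sB JB)) +
      (if (rr r).2 then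
        (((B.size + cj JB : ℕ) : ZMod 2) * ((A.size + cj JA : ℕ) : ZMod 2)) *
        (1 + c + c0 + ((B.size + cj JB : ℕ) : ZMod 2)) *
        g (mk (st r) (jump sA JA) (jump sB JB)) else 0)) := by
  have e : ∀ vb : B.L → Bool, ∀ va : A.L → Bool,
      Z (bin d A B) c g (fun _ _ => 0) (mk r sA sB) (mkL d (ful va) (ful vb)) =
      Z B (A.lead 0 sA (ful va))
        (fun sB' => Z A c (fun sA' => g (mk r sA' sB')) (fun _ _ => 0) sA (ful va))
        (fun _ _ => 0) sB (ful vb) +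
      (if (rr r).2 then Z B (A.lead 0 sA (ful va)) (fun _ => 0)
        (fun s u => (B.lead (A.lead c sA (ful va)) s u + A.lead (B.lead c s u) sA (ful va)) *
        Z A (B.lead c s u) (fun sA' => Z B c (fun sB' => g (mk (st r) sA' sB')) (fun _ _ => 0) s u)
          (fun _ _ => 0) sA (ful va)) sB (ful vb) else 0) := by
    intro vb va
    rw [Z_bin_true c g r hr, lead_ful, Z_split]
    congr 1
    split_ifs with h
    · congr 1
      funext s u
      rw [Z_bin_false c g (st r) (by rw [rr_st_fst r h, hr]; rfl), rr_st_snd]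
      simp [lead_ful]
    · rw [Z_zero]
  simp only [e, mul_add, Finset.sum_add_distrib]
  congr 1
  · rw [pairK_zero B A KB KA c c0 (fun sB sA => g (mk r sA sB))]
    refine Finset.sum_congr rfl fun JB _ => Finset.sum_congr rfl fun JA _ => ?_
    ring
  · split_ifs with h
    · rw [sum_exchange B A KB KA c c0 (fun sB sA => g (mk (st r) sA sB))]
      refine Finset.sum_congr rfl fun JB _ => Finset.sum_congr rfl fun JA _ => ?_
      ring
    · simp

end Shape

namespace Shape

variable {d : Bool} {A B : Shape}

theorem mk_eta (s : (bin d A B).NS) : mk (fun h => s (Sum.inl h)) (fun ν => s (Sum.inr (Sum.inl ν)))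
    (fun ν => s (Sum.inr (Sum.inr ν))) = s := by
  funext y
  rcases y with y | y | y <;> rfl

/-- Assemble a set of vertices of a binary shape. -/
def mkJ (d : Bool) (j : Bool) (JA : A.N → Bool) (JB : B.N → Bool) : (bin d A B).N → Bool :=
  Sum.elim (fun _ => j) (Sum.elim JA JB)

theorem sum_L (F : ((bin d A B).L → Bool) → ZMod 2) :
    ∑ v, F v = ∑ va : A.L → Bool, ∑ vb : B.L → Bool, F (Sum.elim va vb) := by
  let e : ((bin d A B).L → Bool) ≃ (A.L → Bool) × (B.L → Bool) :=
    Equiv.sumArrowEquivProdArrow A.L B.L Bool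
  rw [← Fintype.sum_prod_type' fun va vb => F (Sum.elim va vb)]
  refine Fintype.sum_equiv e _ _ fun v => congrArg F ?_
  exact (e.symm_apply_apply v).symm

theorem sum_N (F : ((bin d A B).N → Bool) → ZMod 2) :
    ∑ J, F J = ∑ JA : A.N → Bool, ∑ JB : B.N → Bool, (F (mkJ d false JA JB) +
      if d then F (mkJ d true JA JB) else 0) := by
  let e : ((bin d A B).N → Bool) ≃ (PLift (d = true) → Bool) × (A.N ⊕ B.N → Bool) :=
    Equiv.sumArrowEquivProdArrow _ _ Bool
  have h1 : ∑ J, F J = ∑ j : PLift (d = true) → Bool, ∑ J' : A.N ⊕ B.N → Bool,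
      F (Sum.elim j J') := by
    rw [← Fintype.sum_prod_type' fun (j : PLift (d = true) → Bool) (J' : A.N ⊕ B.N → Bool) =>
      F (Sum.elim j J')]
    exact Fintype.sum_equiv e _ _ fun v => congrArg F (e.symm_apply_apply v).symm
  have h2 : ∀ j : PLift (d = true) → Bool, ∑ J' : A.N ⊕ B.N → Bool, F (Sum.elim j J') =
      ∑ JA : A.N → Bool, ∑ JB : B.N → Bool, F (Sum.elim j (Sum.elim JA JB)) := by
    intro j
    rw [← Fintype.sum_prod_type']
    exact (Fintype.sum_equiv (Equiv.sumArrowEquivProdArrow _ _ Bool).symm _ _ fun _ => rfl).symm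
  rw [h1, Finset.sum_congr rfl fun j _ => h2 j]
  simp only [Finset.sum_add_distrib]
  cases d with
  | false =>
    have : IsEmpty (PLift (false = true)) := ⟨fun h => by simpa using h.down⟩
    rw [Fintype.sum_unique]
    simp only [Bool.false_eq_true, if_false, Finset.sum_const_zero, add_zero]
    refine Finset.sum_congr rfl fun JA _ => Finset.sum_congr rfl fun JB _ => congrArg F ?_
    funext y
    rcases y with y | y
    · exact isEmptyElim y
    · rfl
  | true =>
    have e : ∀ G : (PLift (true = true) → Bool) → ZMod 2, ∑ j, G j = G (fun _ => false) +
        G (fun _ => true) := by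
      intro G
      let _ : Unique (PLift (true = true)) := ⟨⟨⟨rfl⟩⟩, fun _ => rfl⟩
      rw [← Fintype.sum_equiv (Equiv.funUnique (PLift (true = true)) Bool).symm
        (fun b => G (fun _ => b)) _ (fun b => rfl), Fintype.sum_bool]
      ring
    rw [e]
    rfl

theorem ful_elim (va : A.L → Bool) (vb : B.L → Bool) :
    ful (t := bin d A B) (Sum.elim va vb) = mkL d (ful va) (ful vb) := by
  funext y
  rcases y with y | y <;> rfl

theorem size_bin : (bin d A B).size = A.size + B.size :=
  Fintype.card_sum (α := A.L) (β := B.L)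

theorem cj_mkJ (j : Bool) (JA : A.N → Bool) (JB : B.N → Bool) :
    cj (mkJ d j JA JB) = (if d && j then 1 else 0) + cj JA + cj JB := by
  have h1 := Fintype.sum_sum_type (α₁ := PLift (d = true)) (α₂ := A.N ⊕ B.N) fun ν =>
    if mkJ d j JA JB ν then 1 else 0
  rw [Fintype.sum_sum_type (α₁ := A.N) (α₂ := B.N)] at h1
  refine h1.trans ?_
  rw [add_assoc]
  congr 1
  cases d with
  | false =>
    have : IsEmpty (PLift (false = true)) := ⟨fun h => by simpa using h.down⟩
    simp
  | true => cases j <;> simp [mkJ]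

theorem ok_mkJ_false (r : PLift (d = true) → Bool × Bool) (sA : A.NS) (sB : B.NS)
    (JA : A.N → Bool) (JB : B.N → Bool) :
    ok (mk r sA sB) (mkJ d false JA JB) = ok sA JA * ok sB JB := by
  unfold ok
  have : (∀ ν, mkJ d false JA JB ν = true → (mk r sA sB ν).2 = true) ↔
      (∀ ν, JA ν = true → (sA ν).2 = true) ∧ ∀ ν, JB ν = true → (sB ν).2 = true := by
    constructor
    · exact fun h => ⟨fun ν => h (Sum.inr (Sum.inl ν)), fun ν => h (Sum.inr (Sum.inr ν))⟩
    · rintro ⟨h1, h2⟩ (ν | ν | ν) hν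
      · exact absurd hν Bool.false_ne_true
      · exact h1 ν hν
      · exact h2 ν hν
  simp only [this]
  split_ifs <;> simp_all

theorem ok_mkJ_true (r : PLift (true = true) → Bool × Bool) (sA : A.NS) (sB : B.NS)
    (JA : A.N → Bool) (JB : B.N → Bool) :
    ok (mk r sA sB) (mkJ true true JA JB) = if (rr r).2 then ok sA JA * ok sB JB else 0 := by
  unfold ok
  have : (∀ ν, mkJ true true JA JB ν = true → (mk r sA sB ν).2 = true) ↔ (rr r).2 = true ∧
      (∀ ν, JA ν = true → (sA ν).2 = true) ∧ ∀ ν, JB ν = true → (sB ν).2 = true := by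
    constructor
    · exact fun h => ⟨h (Sum.inl ⟨rfl⟩) rfl, fun ν => h (Sum.inr (Sum.inl ν)),
        fun ν => h (Sum.inr (Sum.inr ν))⟩
    · rintro ⟨h0, h1, h2⟩ (ν | ν | ν) hν
      · exact h0
      · exact h1 ν hν
      · exact h2 ν hν
  simp only [this]
  split_ifs <;> simp_all

theorem jump_mkJ_false (r : PLift (d = true) → Bool × Bool) (sA : A.NS) (sB : B.NS)
    (JA : A.N → Bool) (JB : B.N → Bool) :
    jump (mk r sA sB) (mkJ d false JA JB) = mk r (jump sA JA) (jump sB JB) := by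
  funext ν
  rcases ν with ν | ν | ν <;> rfl

theorem jump_mkJ_true (r : PLift (d = true) → Bool × Bool) (sA : A.NS) (sB : B.NS)
    (JA : A.N → Bool) (JB : B.N → Bool) :
    jump (mk r sA sB) (mkJ d true JA JB) = mk (st r) (jump sA JA) (jump sB JB) := by
  funext ν
  rcases ν with ν | ν | ν <;> rfl

theorem wt_mkJ_false (JA : A.N → Bool) (JB : B.N → Bool) :
    wt (bin d A B) (mkJ d false JA JB) = wt A JA * wt B JB := by
  cases d <;> simp [wt, mkJ]

theorem wt_mkJ_true (JA : A.N → Bool) (JB : B.N → Bool) :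
    wt (bin true A B) (mkJ true true JA JB) =
      ((A.size + cj JA : ℕ) : ZMod 2) * ((B.size + cj JB : ℕ) : ZMod 2) * (wt A JA * wt B JB) := by
  simp [wt, mkJ]

theorem kProp_leaf : KProp leaf := by
  intro c c0 g s
  have hs : ∀ s' : leaf.NS, s' = s := fun s' => funext fun x => nomatch x
  have hZ := Z_isSol leaf c g fun _ _ => 0
  have e : ∀ b : Bool, Z leaf c g (fun _ _ => 0) s (ful fun _ => b) = (bit b + c) * g s := by
    intro b
    rw [hZ.2 _ _ (ful_ne_emp _), add_zero, D]
    have h1 : ∀ x : leaf.L, del (ful fun _ => b) x = leaf.emp := by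
      intro x
      funext y
      exact del_same _ y
    simp only [h1, hZ.1, lead_emp]
    have : IsEmpty leaf.N := inferInstanceAs (IsEmpty Empty)
    have h2 : ∀ G : leaf.L → ZMod 2, ∑ x, G x = G () := fun G => Fintype.sum_unique (ι := Unit) G
    rw [h2]
    simp [lead, ful]
  have e1 : ∀ F : (leaf.L → Bool) → ZMod 2, ∑ v, F v = F (fun _ => false) + F (fun _ => true) := by
    intro F
    let e : Bool ≃ (leaf.L → Bool) := (Equiv.funUnique Unit Bool).symm
    rw [← Fintype.sum_equiv e (fun b => F (fun _ => b)) F (fun b => rfl), Fintype.sum_bool]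
    ring
  have : IsEmpty leaf.N := inferInstanceAs (IsEmpty Empty)
  rw [e1, Fintype.sum_unique, e, e, hs (jump s _)]
  have h2 : (1 : ZMod 2) + 1 = 0 := by decide
  have h3 : leaf.size = 1 := rfl
  have h4 : ∀ J : leaf.N → Bool, cj J = 0 := by simp [cj]
  have h5 : ∀ J : leaf.N → Bool, ok s J = 1 := by simp [ok]
  rw [h3, h4, h5]
  simp only [lead, ful, bit, wt]
  have : ∀ c c0 G : ZMod 2, (1 + c0 + (if false = true then (1 : ZMod 2) else 0)) *
    (((if false = true then (1 : ZMod 2) else 0) + c) * G) +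
    (1 + c0 + (if true = true then (1 : ZMod 2) else 0)) *
    (((if true = true then (1 : ZMod 2) else 0) + c) * G) =
    1 * (1 + c + c0 + ((1 + 0 : ℕ) : ZMod 2)) * 1 * G := by decide
  exact this c c0 (g s)

theorem kProp_bin (KA : KProp A) (KB : KProp B) : KProp (bin d A B) := by
  intro c c0 g s
  have two : ∀ x : ZMod 2, x + x = 0 := CharTwo.add_self_eq_zero
  have sq : ∀ y : ZMod 2, y * y = y := by decide
  rw [← mk_eta s]
  set r : PLift (d = true) → Bool × Bool := fun h => s (Sum.inl h)
  set sA : A.NS := fun ν => s (Sum.inr (Sum.inl ν))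
  set sB : B.NS := fun ν => s (Sum.inr (Sum.inr ν))
  rw [sum_L, sum_N]
  simp only [ful_elim, lead_mk, ok_mkJ_false, jump_mkJ_false, jump_mkJ_true, wt_mkJ_false, cj_mkJ,
    size_bin, Bool.and_false, Bool.and_true]
  by_cases hr : (rr r).1 = true
  · simp only [hr, if_true, lead_ful (A.lead _ _ _)]
    rw [Finset.sum_comm, sum_bin_true KA KB c c0 g r hr, Finset.sum_comm]
    refine Finset.sum_congr rfl fun JA _ => Finset.sum_congr rfl fun JB _ => ?_
    cases d with
    | false =>
      simp only [rr, Bool.false_eq_true, dite_false, if_false]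
      push_cast; ring
    | true =>
      rw [ok_mkJ_true, wt_mkJ_true]
      simp only [↓reduceIte, Bool.false_eq_true]
      by_cases h : (rr r).2 = true
      all_goals simp only [h, ↓reduceIte, Bool.false_eq_true]
      · push_cast
        have h3 := sq (A.size + cj JA : ZMod 2)
        have h4 := two (A.size + cj JA : ZMod 2)
        linear_combination (-(ok sA JA * ok sB JB * (wt A JA * wt B JB) * (B.size + cj JB) *
          g (mk (st r) (jump sA JA) (jump sB JB)))) * (h3 + h4)
      · push_cast; ring
  · have hr' : (rr r).1 = false := by simpa using hr
    simp only [hr', Bool.false_eq_true, if_false, lead_ful (B.lead _ _ _)]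
    rw [sum_bin_false KA KB c c0 g r hr']
    refine Finset.sum_congr rfl fun JA _ => Finset.sum_congr rfl fun JB _ => ?_
    cases d with
    | false =>
      simp only [rr, Bool.false_eq_true, dite_false, if_false]
      push_cast; ring
    | true =>
      rw [ok_mkJ_true, wt_mkJ_true]
      simp only [↓reduceIte]
      by_cases h : (rr r).2 = true
      all_goals simp only [h, ↓reduceIte, Bool.false_eq_true]
      · push_cast
        have h3 := sq (B.size + cj JB : ZMod 2)
        have h4 := two (B.size + cj JB : ZMod 2)
        linear_combination (-(ok sA JA * ok sB JB * (wt A JA * wt B JB) * (A.size + cj JA) *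
          g (mk (st r) (jump sA JA) (jump sB JB)))) * (h3 + h4)
      · push_cast; ring

theorem kProp (t : Shape) : KProp t := by
  induction t with
  | leaf => exact kProp_leaf
  | bin d A B hA hB => exact kProp_bin hA hB

end Shape

namespace Shape

variable {t : Shape}

open Classical in
/-- The transfer operator without the moves which erase the last sign. -/
noncomputable def Dh (t : Shape) (f : t.NS → t.LS → ZMod 2) : t.NS → t.LS → ZMod 2 :=
  t.D 0 fun s u => if u = t.emp then 0 else f s u

/-- Restrict a function of the vertex states to the states with one sign. -/
noncomputable def one (g : t.NS → ZMod 2) : t.NS → t.LS → ZMod 2 :=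
  fun s u => if ns u = 1 then g s else 0

theorem ns_emp : ns t.emp = 0 := by simp [ns, emp]

theorem ns_pos {u : t.LS} (hu : u ≠ t.emp) : 0 < ns u := by
  rw [ns, Finset.card_pos]
  by_contra h
  rw [Finset.not_nonempty_iff_eq_empty, Finset.filter_eq_empty_iff] at h
  exact hu (funext fun x => not_not.1 (h (Finset.mem_univ x)))

theorem D_zero_of {c : ZMod 2} {f : t.NS → t.LS → ZMod 2} {s : t.NS} {u : t.LS}
    (h1 : ∀ x, u x ≠ none → f s (del u x) = 0)
    (h2 : ∀ ν, (s ν).2 = true → f (flip s ν) u = 0) : t.D c f s u = 0 := by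
  have : t.D c f s u = t.D c (fun _ _ => 0) s u := by
    refine D_congr t c c _ _ s u (fun x hx => ?_) (fun ν hν => ?_)
    · rw [h1 x hx]
    · rw [h2 ν hν]
  rw [this]
  simpa using D_mul t c 0 (fun _ _ => 0) s u

theorem Z_eq_zero {c : ZMod 2} {g : t.NS → ZMod 2} {m : ℕ} (hg : ∀ s, g s ≠ 0 → nf s = m)
    (s : t.NS) (u : t.LS) (h : nf s < m) : Z t c g (fun _ _ => 0) s u = 0 := by
  have key : ∀ k s u, nf s + ns u = k → nf s < m → Z t c g (fun _ _ => 0) s u = 0 := by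
    intro k
    induction k using Nat.strong_induction_on with
    | _ k ih =>
      intro s u hk hs
      by_cases hu : u = t.emp
      · rw [hu, (Z_isSol t c g _).1]
        by_contra h0
        exact hs.ne (hg s h0)
      · rw [(Z_isSol t c g _).2 s u hu, add_zero]
        refine D_zero_of (fun x hx => ?_) (fun ν hν => ?_)
        · have := ns_del hx
          exact ih _ (by omega) _ _ rfl hs
        · have := nf_flip hν
          exact ih _ (by omega) _ _ rfl (by omega)
  exact key _ s u rfl h

theorem Z_eq_iterate {g : t.NS → ZMod 2} {m : ℕ} (hg : ∀ s, g s ≠ 0 → nf s = m) (a : ℕ) :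
    ∀ (s : t.NS) (u : t.LS), u ≠ t.emp → nf s + ns u = a + 1 + m →
      Z t (t.lead 0 s u + a + 1) g (fun _ _ => 0) s u = (Dh t)^[a] (one g) s u := by
  have z2 : ∀ l l' : ZMod 2, l + l' = 0 ∨ l' = l + 1 := by decide
  induction a with
  | zero =>
    intro s u hu h
    rw [Function.iterate_zero_apply, one]
    have hpos := ns_pos hu
    split_ifs with h1
    · rw [(Z_isSol t _ g _).2 s u hu, add_zero]
      have h2 : Finset.card (Finset.univ.filter fun x => u x ≠ none) = 1 := h1
      obtain ⟨x0, hx0⟩ := Finset.card_eq_one.1 h2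
      have hx : u x0 ≠ none := by
        have : x0 ∈ Finset.univ.filter fun x => u x ≠ none := by rw [hx0]; simp
        simpa using this
      have hd : del u x0 = t.emp := by
        by_contra hne
        have := ns_pos hne
        have := ns_del hx
        omega
      rw [D, Finset.sum_eq_single x0, Finset.sum_eq_zero, hd, (Z_isSol t _ g _).1, lead_emp,
        lead_indep t _ 0 s u hu]
      · have : ∀ l g : ZMod 2, (l + (l + ((0 : ℕ) : ZMod 2) + 1)) * g + 0 = g := by decide
        exact this _ _
      · intro ν _
        split_ifs with hν
        · rw [Z_eq_zero hg, mul_zero]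
          have := nf_flip hν
          omega
        · rfl
      · intro y _ hy
        have : u y = none := by
          by_contra h3
          have : y ∈ Finset.univ.filter fun x => u x ≠ none := by simpa using h3
          rw [hx0] at this
          exact hy (by simpa using this)
        rw [del_of_none this, CharTwo.add_self_eq_zero, zero_mul]
      · simp
    · exact Z_eq_zero hg _ _ (by omega)
  | succ a ih =>
    intro s u hu h
    rw [Function.iterate_succ_apply', Dh, (Z_isSol t _ g _).2 s u hu, add_zero]
    refine D_congr t _ _ _ _ s u (fun x hx => ?_) (fun ν hν => ?_)
    · have h1 := ns_del hx
      split_ifs with he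
      · rw [he, (Z_isSol t _ g _).1]
        have : g s = 0 := by
          by_contra h0
          have := hg s h0
          rw [he, ns_emp] at h1
          omega
        rw [this, mul_zero, mul_zero]
      · rw [lead_indep t _ 0 s u hu, lead_indep t _ 0 s _ he]
        rcases z2 (t.lead 0 s u) (t.lead 0 s (del u x)) with h0 | h0
        · rw [h0, zero_mul, zero_mul]
        · rw [← ih s _ he (by omega), h0]
          congr 2
          push_cast
          ring
    · have h1 := nf_flip hν
      rw [if_neg hu, lead_indep t _ 0 s u hu, lead_indep t _ 0 (flip s ν) u hu]
      rcases z2 (t.lead 0 s u) (t.lead 0 (flip s ν) u) with h0 | h0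
      · rw [h0, zero_mul, zero_mul]
      · rw [← ih _ u hu (by omega), h0]
        congr 2
        push_cast
        ring

theorem iterate_support {F : t.NS → t.LS → ZMod 2} {p : ℕ} (hF : ∀ s u, F s u ≠ 0 → nf s + ns u = p)
    (a : ℕ) (s : t.NS) (u : t.LS) (h : (Dh t)^[a] F s u ≠ 0) : nf s + ns u = p + a := by
  induction a generalizing s u with
  | zero => exact hF s u h
  | succ a ih =>
    by_contra hne
    rw [Function.iterate_succ_apply', Dh] at h
    refine h (D_zero_of (fun x hx => ?_) (fun ν hν => ?_))
    · have h1 := ns_del hx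
      split_ifs with he
      · rfl
      · by_contra h0
        have := ih _ _ h0
        omega
    · have h1 := nf_flip hν
      split_ifs with he
      · rfl
      · by_contra h0
        have := ih _ _ h0
        omega

/-- The path sums over a full set of signs with positive leading sign. -/
noncomputable def W (t : Shape) (a : ℕ) (g : t.NS → ZMod 2) (s : t.NS) : ZMod 2 :=
  ∑ v, (1 + t.lead 0 s (ful v)) * (Dh t)^[a] (one g) s (ful v)

theorem cj_of_ok {s : t.NS} {J : t.N → Bool} (h : ok s J ≠ 0) : nf s = nf (jump s J) + cj J := by
  have h' : ∀ ν, J ν = true → (s ν).2 = true := by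
    by_contra h0
    exact h (if_neg h0)
  unfold nf cj
  rw [Finset.card_filter, Finset.card_filter, ← Finset.sum_add_distrib]
  refine Finset.sum_congr rfl fun ν _ => ?_
  unfold jump
  cases hJ : J ν
  · simp
  · simp [h' ν hJ]

theorem W_eq {g : t.NS → ZMod 2} {m : ℕ} (hg : ∀ s, g s ≠ 0 → nf s = m) {a j : ℕ}
    (ha : a + 1 = t.size + j) (s : t.NS) :
    W t a g s = ∑ J, if cj J = j then ok s J * wt t J * g (jump s J) else 0 := by
  by_cases h : nf s = j + m
  · have e : ∀ v, (1 + t.lead 0 s (ful v)) * (Dh t)^[a] (one g) s (ful v) =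
        (1 + 0 + t.lead 0 s (ful v)) * Z t (a + 1) g (fun _ _ => 0) s (ful v) := by
      intro v
      rw [← Z_eq_iterate hg a s _ (ful_ne_emp v) (by rw [ns_ful]; omega), add_zero]
      generalize t.lead 0 s (ful v) = l
      have : l = 0 ∨ l = 1 := by revert l; decide
      rcases this with rfl | rfl
      · rw [zero_add]
      · have : (1 : ZMod 2) + 1 = 0 := by decide
        rw [this, zero_mul, zero_mul]
    rw [W, Finset.sum_congr rfl fun v _ => e v, kProp]
    refine Finset.sum_congr rfl fun J _ => ?_
    by_cases h1 : ok s J = 0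
    · simp [h1]
    by_cases h2 : g (jump s J) = 0
    · simp [h2]
    have h3 := cj_of_ok h1
    have h4 := hg _ h2
    have h5 : cj J = j := by omega
    rw [if_pos h5, h5, ← ha]
    push_cast
    have : ∀ x : ZMod 2, 1 + x + 0 + x = 1 := by decide
    rw [this, mul_one]
  · have e : ∀ v, (Dh t)^[a] (one g) s (ful v) = 0 := by
      intro v
      by_contra h0
      have := iterate_support (F := one g) (p := m + 1) (by
        intro s u h1
        unfold one at h1
        split_ifs at h1 with h2
        · rw [hg s h1, h2]
        · exact absurd rfl h1) a s _ h0
      rw [ns_ful] at this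
      omega
    rw [W, Finset.sum_eq_zero fun v _ => by rw [e v, mul_zero], Finset.sum_eq_zero]
    intro J _
    split_ifs with h0
    · by_cases h1 : ok s J = 0
      · simp [h1]
      by_cases h2 : g (jump s J) = 0
      · simp [h2]
      have h3 := cj_of_ok h1
      have h4 := hg _ h2
      omega
    · rfl

theorem W_support {g : t.NS → ZMod 2} {m : ℕ} (hg : ∀ s, g s ≠ 0 → nf s = m) {a j : ℕ}
    (ha : a + 1 = t.size + j) (s : t.NS) (h : W t a g s ≠ 0) : nf s = m + j := by
  rw [W_eq hg ha] at h
  obtain ⟨J, -, hJ⟩ := Finset.exists_ne_zero_of_sum_ne_zero h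
  split_ifs at hJ with h0
  · have h1 : ok s J ≠ 0 := fun h1 => hJ (by simp [h1])
    have h2 : g (jump s J) ≠ 0 := fun h2 => hJ (by simp [h2])
    rw [cj_of_ok h1, hg _ h2, h0]
  · exact absurd rfl hJ

/-- Change all signs. -/
def neg (u : t.LS) : t.LS := fun x => (u x).map not

theorem neg_neg (u : t.LS) : neg (neg u) = u := by
  funext x
  rcases h : u x with _ | b <;> simp [neg, h]

theorem neg_emp : neg t.emp = t.emp := rfl

theorem neg_eq_emp {u : t.LS} : neg u = t.emp ↔ u = t.emp :=
  ⟨fun h => by rw [← neg_neg u, h, neg_emp], fun h => by rw [h, neg_emp]⟩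

theorem del_neg (u : t.LS) (x : t.L) : del (neg u) x = neg (del u x) := by
  funext y
  by_cases h : y = x
  · subst h
    rw [del_same, neg, del_same, Option.map_none]
  · rw [del_ne _ h, neg, neg, del_ne _ h]

theorem ns_neg (u : t.LS) : ns (neg u) = ns u := by
  unfold ns neg
  congr 1
  ext x
  simp

theorem lead_neg (t : Shape) (c : ZMod 2) (s : t.NS) (u : t.LS) :
    t.lead (c + 1) s (neg u) = t.lead c s u + 1 := by
  induction t generalizing c with
  | leaf =>
    have : ∀ o : Option Bool, (match o.map not with | none => c + 1 | some b => bit b) =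
      (match o with | none => c | some b => bit b) + 1 := by
      rintro (_ | _ | _)
      · rfl
      · change (1 : ZMod 2) = 0 + 1
        decide
      · change (0 : ZMod 2) = 1 + 1
        decide
    exact this (u ())
  | bin d A B hA hB =>
    have h1 := fun c => hA c (fun ν => s (Sum.inr (Sum.inl ν))) (fun x => u (Sum.inl x))
    have h2 := fun c => hB c (fun ν => s (Sum.inr (Sum.inr ν))) (fun x => u (Sum.inr x))
    unfold neg at h1 h2
    simp only [lead, neg, h1, h2]
    split_ifs <;> rfl

theorem lead_neg_of_ne (s : t.NS) {u : t.LS} (hu : u ≠ t.emp) :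
    t.lead 0 s (neg u) = t.lead 0 s u + 1 := by
  rw [← lead_neg, lead_indep t 0 (0 + 1) s _ (fun h => hu (neg_eq_emp.1 h))]

theorem Dh_neg {f : t.NS → t.LS → ZMod 2} (hf : ∀ s u, f s (neg u) = f s u) (s : t.NS) (u : t.LS) :
    Dh t f s (neg u) = Dh t f s u := by
  by_cases hu : u = t.emp
  · rw [hu, neg_emp]
  have z2 : ∀ l l' : ZMod 2, l + 1 + (l' + 1) = l + l' := by decide
  unfold Dh D
  congr 1
  · refine Finset.sum_congr rfl fun x _ => ?_
    rw [del_neg]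
    beta_reduce
    by_cases he : del u x = t.emp
    · rw [if_pos he, if_pos (neg_eq_emp.2 he), mul_zero, mul_zero]
    · rw [if_neg he, if_neg (fun h => he (neg_eq_emp.1 h)), lead_neg_of_ne s hu,
        lead_neg_of_ne s he, z2, hf]
  · refine Finset.sum_congr rfl fun ν _ => ?_
    beta_reduce
    rw [if_neg hu, if_neg (fun h => hu (neg_eq_emp.1 h)), lead_neg_of_ne s hu,
        lead_neg_of_ne _ hu, z2, hf]

theorem iterate_neg (g : t.NS → ZMod 2) (a : ℕ) (s : t.NS) (u : t.LS) :
    (Dh t)^[a] (one g) s (neg u) = (Dh t)^[a] (one g) s u := by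
  induction a generalizing s u with
  | zero => simp only [Function.iterate_zero_apply, one, ns_neg]
  | succ a ih =>
    rw [Function.iterate_succ_apply']
    exact Dh_neg (fun s u => ih s u) s u

theorem neg_ful (v : t.L → Bool) : neg (ful v) = ful fun x => !v x := rfl

/-- The leading sign may be normalised with respect to any vertex state. -/
theorem W_base (s s' : t.NS) (a : ℕ) (g : t.NS → ZMod 2) :
    ∑ v, (1 + t.lead 0 s' (ful v)) * (Dh t)^[a] (one g) s (ful v) = W t a g s := by
  have z2 : ∀ l l' h : ZMod 2, (l + l') * h + (l + 1 + (l' + 1)) * h = 0 := by decide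
  have h0 : ∑ v, (t.lead 0 s' (ful v) + t.lead 0 s (ful v)) *
      (Dh t)^[a] (one g) s (ful v) = 0 := by
    refine Finset.sum_ninvolution (fun v x => !v x) ?_ ?_ (fun _ => Finset.mem_univ _) ?_
    · intro v
      rw [← neg_ful, lead_neg_of_ne _ (ful_ne_emp v), lead_neg_of_ne _ (ful_ne_emp v), iterate_neg,
        z2]
    · intro v _ h
      obtain ⟨x⟩ := t.nonempty_L
      simpa using congrFun h x
    · intro v
      simp
  rw [W, ← sub_eq_zero, ← Finset.sum_sub_distrib]
  refine Eq.trans ?_ h0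
  refine Finset.sum_congr rfl fun v _ => ?_
  have : ∀ l l' h : ZMod 2, (1 + l) * h - (1 + l') * h = (l + l') * h := by decide
  exact this _ _ _

end Shape

namespace Shape

variable {d : Bool} {A B t : Shape}

/-- A colour class. -/
def col (κ : t.N → Fin 3) (k : Fin 3) : t.N → Bool := fun ν => decide (κ ν = k)

/-- The sizes of the colour classes. -/
noncomputable def cnt (κ : t.N → Fin 3) (k : Fin 3) : ℕ := cj (col κ k)

/-- The weighted sum over all colourings of a function of the sizes of the colour classes. -/
noncomputable def E (t : Shape) (F : (Fin 3 → ℕ) → ZMod 2) : ZMod 2 :=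
  ∑ κ : t.N → Fin 3, (∏ k, wt t (col κ k)) * F (cnt κ)

/-- The triple path sum. -/
noncomputable def Q3 (t : Shape) (a b c : ℕ) : ZMod 2 :=
  W t a (W t b (W t c fun s => if nf s = 0 then 1 else 0)) fun _ => (false, true)

theorem ok_ne_zero {s : t.NS} {J : t.N → Bool} : ok s J ≠ 0 ↔ ∀ ν, J ν = true → (s ν).2 = true := by
  unfold ok
  split_ifs with h
  · simpa using h
  · simpa using h

theorem ok_of {s : t.NS} {J : t.N → Bool} (h : ∀ ν, J ν = true → (s ν).2 = true) : ok s J = 1 :=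
  if_pos h

theorem nf_eq_zero {s : t.NS} : nf s = 0 ↔ ∀ ν, (s ν).2 = false := by
  simp [nf, Finset.filter_eq_empty_iff]

theorem Q3_eq {a b c a' b' c' : ℕ} (ha : a + 1 = t.size + a') (hb : b + 1 = t.size + b')
    (hc : c + 1 = t.size + c') :
    Q3 t a b c = E t fun v => if v = ![a', b', c'] then 1 else 0 := by
  set g0 : t.NS → ZMod 2 := fun s => if nf s = 0 then 1 else 0 with hg0
  have h0 : ∀ s, g0 s ≠ 0 → nf s = 0 := by
    intro s h
    by_contra h1
    exact h (if_neg h1)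
  have h1 : ∀ s, W t c g0 s ≠ 0 → nf s = c' := by
    intro s h
    have := W_support h0 hc s h
    omega
  have h2 : ∀ s, W t b (W t c g0) s ≠ 0 → nf s = c' + b' := W_support h1 hb
  set base : t.NS := fun _ => (false, true)
  let G : (t.N → Bool) × (t.N → Bool) × (t.N → Bool) → ZMod 2 := fun p =>
    if cj p.1 = a' then ok base p.1 * wt t p.1 * (if cj p.2.1 = b' then
      ok (jump base p.1) p.2.1 * wt t p.2.1 * (if cj p.2.2 = c' then
        ok (jump (jump base p.1) p.2.1) p.2.2 * wt t p.2.2 *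
          g0 (jump (jump (jump base p.1) p.2.1) p.2.2) else 0) else 0) else 0
  have e : Q3 t a b c = ∑ p, G p := by
    rw [Fintype.sum_prod_type]
    simp only [Fintype.sum_prod_type, G]
    rw [Q3, W_eq h2 ha]
    refine Finset.sum_congr rfl fun J1 _ => ?_
    by_cases hJ1 : cj J1 = a'
    · simp only [hJ1, if_true]
      rw [W_eq h1 hb]
      simp only [Finset.mul_sum]
      refine Finset.sum_congr rfl fun J2 _ => ?_
      by_cases hJ2 : cj J2 = b'
      · simp only [hJ2, if_true]
        rw [W_eq h0 hc]
        simp only [Finset.mul_sum]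
        rfl
      · simp [hJ2]
    · simp [hJ1]
  rw [e, E]
  symm
  refine Finset.sum_of_injOn (fun κ => (col κ 0, col κ 1, col κ 2)) ?_
    (fun _ _ => Finset.mem_coe.2 (Finset.mem_univ _)) ?_ ?_
  · intro κ _ κ' _ h
    simp only [Prod.mk.injEq] at h
    funext ν
    have h1 : decide (κ ν = 0) = decide (κ' ν = 0) := congrFun h.1 ν
    have h2 : decide (κ ν = 1) = decide (κ' ν = 1) := congrFun h.2.1 ν
    revert h1 h2
    generalize κ ν = x
    generalize κ' ν = y
    revert x y
    decide
  · rintro ⟨J1, J2, J3⟩ _ h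
    by_contra hG
    simp only [G] at hG
    have hJ1 : cj J1 = a' := by
      by_contra h'; simp [h'] at hG
    have hJ2 : cj J2 = b' := by
      by_contra h'; simp [h'] at hG
    have hJ3 : cj J3 = c' := by
      by_contra h'; simp [h'] at hG
    simp only [hJ1, hJ2, hJ3, if_true, mul_ne_zero_iff] at hG
    obtain ⟨-, ⟨o2, -⟩, ⟨o3, -⟩, g⟩ := hG
    rw [ok_ne_zero] at o2 o3
    have hg := nf_eq_zero.1 (h0 _ g)
    refine h ⟨fun ν => if J1 ν then 0 else if J2 ν then 1 else 2, Finset.mem_coe.2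
      (Finset.mem_univ _), ?_⟩
    have key : ∀ ν, (J1 ν = true ∧ J2 ν = false ∧ J3 ν = false) ∨
        (J1 ν = false ∧ J2 ν = true ∧ J3 ν = false) ∨
        (J1 ν = false ∧ J2 ν = false ∧ J3 ν = true) := by
      intro ν
      have p2 := o2 ν
      have p3 := o3 ν
      have p4 := hg ν
      simp only [jump, base] at p2 p3 p4
      revert p2 p3 p4
      cases J1 ν <;> cases J2 ν <;> cases J3 ν <;> simp
    simp only [Prod.mk.injEq]
    refine ⟨?_, ?_, ?_⟩
    all_goals
      funext ν
      rcases key ν with ⟨p1, p2, p3⟩ | ⟨p1, p2, p3⟩ | ⟨p1, p2, p3⟩ <;> simp [col, p1, p2, p3]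
  · intro κ _
    have c1 : ok base (col κ 0) = 1 := ok_of fun _ _ => rfl
    have c2 : ok (jump base (col κ 0)) (col κ 1) = 1 := ok_of fun ν h => by
      simp only [col, decide_eq_true_eq] at h
      simp [jump, col, h, base]
    have c3 : ok (jump (jump base (col κ 0)) (col κ 1)) (col κ 2) = 1 := ok_of fun ν h => by
      simp only [col, decide_eq_true_eq] at h
      simp [jump, col, h, base]
    have c4 : g0 (jump (jump (jump base (col κ 0)) (col κ 1)) (col κ 2)) = 1 := by
      refine if_pos (nf_eq_zero.2 fun ν => ?_)
      simp only [jump, col, base, decide_eq_true_eq]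
      generalize κ ν = x
      revert x
      decide
    simp only [G, c1, c2, c3, c4, Fin.prod_univ_three]
    have : (cnt κ = ![a', b', c']) ↔ cj (col κ 0) = a' ∧ cj (col κ 1) = b' ∧ cj (col κ 2) = c' := by
      constructor
      · intro h
        exact ⟨congrFun h 0, congrFun h 1, congrFun h 2⟩
      · rintro ⟨h1, h2, h3⟩
        funext k
        fin_cases k
        · exact h1
        · exact h2
        · exact h3
    simp only [this]
    by_cases p1 : cj (col κ 0) = a' <;> by_cases p2 : cj (col κ 1) = b' <;>
      by_cases p3 : cj (col κ 2) = c' <;> simp [p1, p2, p3, mul_assoc]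

/-- Assemble a colouring of a binary shape. -/
def mk3 (d : Bool) (j : Fin 3) (κA : A.N → Fin 3) (κB : B.N → Fin 3) : (bin d A B).N → Fin 3 :=
  Sum.elim (fun _ => j) (Sum.elim κA κB)

theorem sum_col (F : ((bin d A B).N → Fin 3) → ZMod 2) :
    ∑ κ, F κ = if d then ∑ j, ∑ κA : A.N → Fin 3, ∑ κB : B.N → Fin 3, F (mk3 d j κA κB)
      else ∑ κA : A.N → Fin 3, ∑ κB : B.N → Fin 3, F (mk3 d 0 κA κB) := by
  let e : ((bin d A B).N → Fin 3) ≃ (PLift (d = true) → Fin 3) × (A.N ⊕ B.N → Fin 3) :=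
    Equiv.sumArrowEquivProdArrow _ _ _
  have h1 : ∑ J, F J = ∑ j : PLift (d = true) → Fin 3, ∑ J' : A.N ⊕ B.N → Fin 3,
      F (Sum.elim j J') := by
    rw [← Fintype.sum_prod_type' fun (j : PLift (d = true) → Fin 3) (J' : A.N ⊕ B.N → Fin 3) =>
      F (Sum.elim j J')]
    exact Fintype.sum_equiv e _ _ fun v => congrArg F (e.symm_apply_apply v).symm
  have h2 : ∀ j : PLift (d = true) → Fin 3, ∑ J' : A.N ⊕ B.N → Fin 3, F (Sum.elim j J') =
      ∑ JA : A.N → Fin 3, ∑ JB : B.N → Fin 3, F (Sum.elim j (Sum.elim JA JB)) := by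
    intro j
    rw [← Fintype.sum_prod_type']
    exact (Fintype.sum_equiv (Equiv.sumArrowEquivProdArrow _ _ _).symm _ _ fun _ => rfl).symm
  rw [h1, Finset.sum_congr rfl fun j _ => h2 j]
  cases d with
  | false =>
    have : IsEmpty (PLift (false = true)) := ⟨fun h => by simpa using h.down⟩
    rw [Fintype.sum_unique]
    simp only [Bool.false_eq_true, if_false]
    refine Finset.sum_congr rfl fun JA _ => Finset.sum_congr rfl fun JB _ => congrArg F ?_
    funext y
    rcases y with y | y
    · exact isEmptyElim y
    · rfl
  | true =>
    let _ : Unique (PLift (true = true)) := ⟨⟨⟨rfl⟩⟩, fun _ => rfl⟩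
    rw [if_pos rfl]
    exact (Fintype.sum_equiv (Equiv.funUnique (PLift (true = true)) (Fin 3)).symm _ _
      (fun b => rfl)).symm

theorem col_mk3 (d : Bool) (j : Fin 3) (κA : A.N → Fin 3) (κB : B.N → Fin 3) (k : Fin 3) :
    col (mk3 d j κA κB) k = mkJ d (decide (j = k)) (col κA k) (col κB k) := by
  funext y
  rcases y with y | y | y <;> rfl

theorem E_bin_false (F : (Fin 3 → ℕ) → ZMod 2) :
    E (bin false A B) F = E A fun x => E B fun y => F (x + y) := by
  simp only [E]
  rw [sum_col, if_neg Bool.false_ne_true]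
  refine Finset.sum_congr rfl fun κA _ => ?_
  rw [Finset.mul_sum]
  refine Finset.sum_congr rfl fun κB _ => ?_
  have h1 : cnt (mk3 false 0 κA κB) = cnt κA + cnt κB := by
    funext k
    simp only [cnt, col_mk3, cj_mkJ, Bool.false_and, Bool.false_eq_true, if_false, zero_add,
      Pi.add_apply]
  have h2 : ∀ k, wt (bin false A B) (col (mk3 false 0 κA κB) k) =
      wt A (col κA k) * wt B (col κB k) := fun k => by
    rw [col_mk3]
    simp [wt, mkJ]
  rw [h1, Finset.prod_congr rfl fun k _ => h2 k, Finset.prod_mul_distrib]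
  ring

theorem E_bin_true (F : (Fin 3 → ℕ) → ZMod 2) :
    E (bin true A B) F = ∑ j, E A fun x => ((A.size + x j : ℕ) : ZMod 2) *
      E B fun y => ((B.size + y j : ℕ) : ZMod 2) * F (Pi.single j 1 + x + y) := by
  simp only [E]
  rw [sum_col, if_pos rfl]
  refine Finset.sum_congr rfl fun j _ => Finset.sum_congr rfl fun κA _ => ?_
  rw [Finset.mul_sum, Finset.mul_sum]
  refine Finset.sum_congr rfl fun κB _ => ?_
  have h1 : cnt (mk3 true j κA κB) = Pi.single j 1 + cnt κA + cnt κB := by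
    funext k
    simp only [cnt, col_mk3, cj_mkJ, Bool.true_and, decide_eq_true_eq, Pi.add_apply,
      Pi.single_apply, @eq_comm _ j k]
  have h2 : ∀ k, wt (bin true A B) (col (mk3 true j κA κB) k) =
      (if j = k then ((A.size + cnt κA k : ℕ) : ZMod 2) * ((B.size + cnt κB k : ℕ) : ZMod 2) else 1)
      * (wt A (col κA k) * wt B (col κB k)) := fun k => by
    rw [col_mk3]
    simp [wt, mkJ, cnt]
  rw [h1, Finset.prod_congr rfl fun k _ => h2 k, Finset.prod_mul_distrib, Finset.prod_mul_distrib,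
    Finset.prod_ite_eq, if_pos (Finset.mem_univ j)]
  ring

theorem E_leaf (F : (Fin 3 → ℕ) → ZMod 2) : E leaf F = F 0 := by
  have : IsEmpty leaf.N := inferInstanceAs (IsEmpty Empty)
  rw [E, Fintype.sum_unique]
  have h : ∀ κ : leaf.N → Fin 3, cnt κ = 0 := by
    intro κ
    funext k
    simp [cnt, cj]
  rw [h]
  simp [wt]

end Shape

/-- Shapes whose flagged vertices have two equal subtrees. -/
inductive SymTree : Type
  | leaf : SymTree
  | cat : SymTree → SymTree → SymTree
  | dbl : SymTree → SymTree

namespace SymTree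

open Shape

/-- The underlying shape. -/
def toShape : SymTree → Shape
  | leaf => Shape.leaf
  | cat A B => Shape.bin false A.toShape B.toShape
  | dbl A => Shape.bin true A.toShape A.toShape

/-- The complete tree of a given depth all of whose vertices are flagged. -/
def blk : ℕ → SymTree
  | 0 => leaf
  | i + 1 => dbl (blk i)

/-- A union of complete trees, one of which has depth one. -/
def forest : List ℕ → SymTree
  | [] => blk 1
  | i :: l => cat (blk i) (forest l)

theorem size_blk (i : ℕ) : (blk i).toShape.size = 2 ^ i := by
  induction i with
  | zero => rfl
  | succ i ih =>
    have : (blk (i + 1)).toShape.size = (blk i).toShape.size + (blk i).toShape.size := size_bin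
    rw [this, ih]; ring

theorem card_N_bin (d : Bool) (A B : Shape) : Fintype.card (bin d A B).N =
    (if d then 1 else 0) + (Fintype.card A.N + Fintype.card B.N) := by
  have : Fintype.card (bin d A B).N = Fintype.card (PLift (d = true) ⊕ (A.N ⊕ B.N)) := rfl
  rw [this, Fintype.card_sum, Fintype.card_sum]
  congr 1
  cases d with
  | false => exact Fintype.card_eq_zero_iff.2 ⟨fun h => Bool.false_ne_true h.down⟩
  | true => exact Fintype.card_eq_one_iff.2 ⟨⟨rfl⟩, fun _ => rfl⟩

theorem card_N_blk (i : ℕ) : Fintype.card (blk i).toShape.N + 1 = 2 ^ i := by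
  induction i with
  | zero => rfl
  | succ i ih =>
    have : Fintype.card (blk (i + 1)).toShape.N = _ := card_N_bin _ _ _
    rw [this, pow_succ, ← ih, if_pos rfl]
    ring

theorem E_blk (i : ℕ) (hi : 1 ≤ i) (F : (Fin 3 → ℕ) → ZMod 2) :
    E (blk i).toShape F = ∑ k, F (Pi.single k (2 ^ i - 1)) := by
  induction i, hi using Nat.le_induction generalizing F with
  | base =>
    change E (bin true Shape.leaf Shape.leaf) F = _
    rw [E_bin_true]
    simp only [E_leaf]
    refine Finset.sum_congr rfl fun j _ => ?_
    have : (Shape.leaf.size : ZMod 2) = 1 := by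
      change ((Fintype.card Unit : ℕ) : ZMod 2) = 1
      simp
    simp [this]
  | succ i hi ih =>
    change E (bin true (blk i).toShape (blk i).toShape) F = _
    rw [E_bin_true]
    refine Finset.sum_congr rfl fun j _ => ?_
    have e : ∀ k : Fin 3, (((blk i).toShape.size + (Pi.single k (2 ^ i - 1) : Fin 3 → ℕ) j : ℕ) :
        ZMod 2) = if k = j then 1 else 0 := by
      intro k
      have h2 : ((2 ^ i : ℕ) : ZMod 2) = 0 :=
        (ZMod.natCast_eq_zero_iff _ _).2 (dvd_pow_self 2 (by omega))
      rw [size_blk, Nat.cast_add, h2, zero_add, Pi.single_apply]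
      by_cases h : k = j
      · subst h
        rw [if_pos rfl, if_pos rfl, Nat.cast_sub Nat.one_le_two_pow, h2]
        decide
      · rw [if_neg (Ne.symm h), if_neg h, Nat.cast_zero]
    rw [ih]
    simp only [ih, e, ite_mul, one_mul, zero_mul, Finset.sum_ite_eq', Finset.mem_univ, if_true]
    congr 1
    rw [add_assoc, ← Pi.single_add, ← Pi.single_add]
    congr 1
    have := Nat.one_le_two_pow (n := i)
    rw [pow_succ]
    omega

/-- The number of ways to distribute the complete trees of a forest over three classes with given
numbers of vertices. -/
def ways : List ℕ → ℕ → ℕ → ℕ → ℕ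
  | [], a, b, c => if a + b + c = 1 then 1 else 0
  | i :: l, a, b, c =>
    (if 2 ^ i - 1 ≤ a then ways l (a - (2 ^ i - 1)) b c else 0) +
    (if 2 ^ i - 1 ≤ b then ways l a (b - (2 ^ i - 1)) c else 0) +
    (if 2 ^ i - 1 ≤ c then ways l a b (c - (2 ^ i - 1)) else 0)

theorem E_forest (l : List ℕ) (hl : ∀ i ∈ l, 1 ≤ i) (a b c : ℕ) :
    E (forest l).toShape (fun v => if v = ![a, b, c] then 1 else 0) = (ways l a b c : ZMod 2) := by
  have key : ∀ x y z a b c : ℕ, (![x, y, z] : Fin 3 → ℕ) = ![a, b, c] ↔ x = a ∧ y = b ∧ z = c := by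
    intro x y z a b c
    constructor
    · intro h
      exact ⟨congrFun h 0, congrFun h 1, congrFun h 2⟩
    · rintro ⟨rfl, rfl, rfl⟩; rfl
  have s0 : ∀ w : ℕ, (Pi.single 0 w : Fin 3 → ℕ) = ![w, 0, 0] := fun w => by
    funext k; fin_cases k <;> rfl
  have s1 : ∀ w : ℕ, (Pi.single 1 w : Fin 3 → ℕ) = ![0, w, 0] := fun w => by
    funext k; fin_cases k <;> rfl
  have s2 : ∀ w : ℕ, (Pi.single 2 w : Fin 3 → ℕ) = ![0, 0, w] := fun w => by
    funext k; fin_cases k <;> rfl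
  induction l generalizing a b c with
  | nil =>
    rw [forest, E_blk 1 le_rfl, Fin.sum_univ_three, s0, s1, s2]
    simp only [key, ways]
    rcases a with _ | _ | a <;> rcases b with _ | _ | b <;> rcases c with _ | _ | c <;>
      simp <;> omega
  | cons i l ih =>
    change E (bin false (blk i).toShape (forest l).toShape) _ = _
    rw [E_bin_false, E_blk i (hl i (by simp)), Fin.sum_univ_three]
    have e : ∀ p q r : ℕ, (E (forest l).toShape fun y =>
        if (![p, q, r] : Fin 3 → ℕ) + y = ![a, b, c] then 1 else 0) =
        if p ≤ a ∧ q ≤ b ∧ r ≤ c then (ways l (a - p) (b - q) (c - r) : ZMod 2) else 0 := by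
      intro p q r
      split_ifs with h
      · rw [← ih fun j hj => hl j (by simp [hj])]
        congr 1
        funext y
        have : (![p, q, r] : Fin 3 → ℕ) + y = ![a, b, c] ↔ y = ![a - p, b - q, c - r] := by
          constructor
          · intro h'
            have h0 := congrFun h' 0
            have h1 := congrFun h' 1
            have h2 := congrFun h' 2
            simp at h0 h1 h2
            funext k
            fin_cases k <;> simp <;> omega
          · rintro rfl
            funext k
            fin_cases k <;> simp <;> omega
        simp only [this]
      · have : (fun y : Fin 3 → ℕ => if (![p, q, r] : Fin 3 → ℕ) + y = ![a, b, c] then (1 : ZMod 2)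
            else 0) = fun _ => 0 := by
          funext y
          refine if_neg fun h' => h ?_
          have h0 := congrFun h' 0
          have h1 := congrFun h' 1
          have h2 := congrFun h' 2
          simp at h0 h1 h2
          omega
        rw [this]
        simp [E]
    rw [s0, s1, s2, e, e, e]
    simp [ways]

theorem E_pad (p : ℕ) (l : List ℕ) (F : (Fin 3 → ℕ) → ZMod 2) :
    E (forest (List.replicate p 0 ++ l)).toShape F = E (forest l).toShape F := by
  induction p generalizing F with
  | zero => rfl
  | succ p ih =>
    have h : (forest (List.replicate (p + 1) 0 ++ l)).toShape =
        bin false Shape.leaf (forest (List.replicate p 0 ++ l)).toShape := by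
      rw [List.replicate_succ, List.cons_append, forest, toShape]
      rfl
    rw [h, E_bin_false, E_leaf]
    simp only [zero_add]
    exact ih F

theorem size_forest (l : List ℕ) : (forest l).toShape.size = 2 + (l.map (2 ^ ·)).sum := by
  induction l with
  | nil => exact size_blk 1
  | cons i l ih =>
    have : (forest (i :: l)).toShape.size = (blk i).toShape.size + (forest l).toShape.size :=
      size_bin
    rw [this, ih, size_blk]
    simp
    ring

theorem card_N_forest (l : List ℕ) :
    Fintype.card (forest l).toShape.N + l.length = 1 + (l.map (2 ^ ·)).sum := by
  induction l with
  | nil =>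
    have := card_N_blk 1
    change Fintype.card (blk 1).toShape.N + 0 = 1 + 0
    omega
  | cons i l ih =>
    have : Fintype.card (forest (i :: l)).toShape.N = _ := card_N_bin _ _ _
    rw [this, if_neg Bool.false_ne_true]
    have := card_N_blk i
    simp only [List.length_cons, List.map_cons, List.sum_cons]
    omega

/-- The total number of colourings with class sizes in the relevant list. -/
noncomputable def total (t : Shape) (m : ℕ) : ZMod 2 :=
  let e := fun a b c : ℕ => E t fun v => if v = ![a, b, c] then 1 else 0
  e (m + 2) m (m - 2) + e (m + 2) (m - 1) (m - 1) + e (m + 1) (m + 1) (m - 2) +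
    e m (m + 1) (m - 1) + e (m + 1) (m - 1) m + e m m m

theorem exists_forest (l : List ℕ) (hl : ∀ i ∈ l, 1 ≤ i) (m n : ℕ)
    (hn : 2 + (l.map (2 ^ ·)).sum ≤ n) (hm : 3 * m + l.length = 1 + (l.map (2 ^ ·)).sum)
    (hw : (ways l (m + 2) m (m - 2) + ways l (m + 2) (m - 1) (m - 1) +
      ways l (m + 1) (m + 1) (m - 2) + ways l m (m + 1) (m - 1) + ways l (m + 1) (m - 1) m +
      ways l m m m) % 2 = 1) :
    ∃ T : SymTree, T.toShape.size = n ∧ Fintype.card T.toShape.N = 3 * m ∧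
      total T.toShape m = 1 := by
  obtain ⟨p, rfl⟩ := Nat.exists_eq_add_of_le hn
  refine ⟨forest (List.replicate p 0 ++ l), ?_, ?_, ?_⟩
  · rw [size_forest]
    simp
    omega
  · have := card_N_forest (List.replicate p 0 ++ l)
    simp at this
    omega
  · simp only [total, E_pad, E_forest l hl]
    have := congrArg (Nat.cast : ℕ → ZMod 2) hw
    rw [ZMod.natCast_mod] at this
    push_cast at this
    rw [← this]

theorem exists_tree {n m : ℕ} (h : (m = 4 ∧ 18 ≤ n) ∨ (m = 5 ∧ 22 ≤ n) ∨ (m = 6 ∧ 26 ≤ n) ∨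
    (m = 7 ∧ 30 ≤ n)) :
    ∃ T : SymTree, T.toShape.size = n ∧ Fintype.card T.toShape.N = 3 * m ∧
      total T.toShape m = 1 := by
  rcases h with ⟨rfl, h⟩ | ⟨rfl, h⟩ | ⟨rfl, h⟩ | ⟨rfl, h⟩
  · exact exists_forest [1, 1, 2, 2, 2] (by decide) 4 n h (by decide) (by decide +kernel)
  · exact exists_forest [1, 1, 1, 1, 2, 3] (by decide) 5 n h (by decide) (by decide +kernel)
  · exact exists_forest [1, 1, 1, 1, 2, 2, 3] (by decide) 6 n h (by decide) (by decide +kernel)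
  · exact exists_forest [1, 1, 1, 1, 2, 2, 2, 3] (by decide) 7 n h (by decide) (by decide +kernel)

end SymTree

/-- Multiplication by a function. -/
noncomputable def mulOp {X : Type} (s : X → ZMod 2) : Module.End (ZMod 2) (X → ZMod 2) :=
  LinearMap.mulLeft (ZMod 2) s

/-- Composition with a map. -/
noncomputable def pull {X : Type} (γ : X → X) : Module.End (ZMod 2) (X → ZMod 2) :=
  LinearMap.funLeft (ZMod 2) (ZMod 2) γ

/-- A coboundary operator on functions modulo two with symmetries, an invariant cocycle, and a
functional vanishing on coboundaries of invariant functions. -/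
structure Machine (X : Type) where
  /-- The coboundary. -/
  U : Module.End (ZMod 2) (X → ZMod 2)
  /-- The symmetries. -/
  G : Set (X → X)
  /-- The cocycle. -/
  e : X → ZMod 2
  /-- The functional. -/
  r : (X → ZMod 2) →ₗ[ZMod 2] ZMod 2
  sq : U * U = 0
  U_e : U e = 0
  pull_e : ∀ γ ∈ G, pull γ e = e
  pull_U : ∀ γ ∈ G, pull γ * U = U * pull γ
  r_U : ∀ f, (∀ γ ∈ G, pull γ f = f) → r (U f) = 0

namespace Machine

variable {X : Type} (Y : Machine X)

theorem end_add_self (A : Module.End (ZMod 2) (X → ZMod 2)) : A + A = 0 := by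
  ext f x
  exact CharTwo.add_self_eq_zero _

/-- The commutator of a multiplication with the coboundary. -/
noncomputable def D (s : X → ZMod 2) : Module.End (ZMod 2) (X → ZMod 2) :=
  mulOp s * Y.U + Y.U * mulOp s

/-- The product of the operators attached to a list of functions. -/
noncomputable def word (l : List (X → ZMod 2)) : Module.End (ZMod 2) (X → ZMod 2) :=
  (l.map Y.D).prod

/-- The evaluation of a list of functions. -/
noncomputable def Q (l : List (X → ZMod 2)) : ZMod 2 := Y.r (Y.word l Y.e)

/-- Functions which change by constants under the symmetries. -/
def IsLabel (s : X → ZMod 2) : Prop := ∀ γ ∈ Y.G, ∃ c : ZMod 2, ∀ x, s (γ x) = s x + c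

/-- Operators commuting with the symmetries. -/
def IsInv (A : Module.End (ZMod 2) (X → ZMod 2)) : Prop := ∀ γ ∈ Y.G, pull γ * A = A * pull γ

variable {Y}

theorem IsInv.mul {A B : Module.End (ZMod 2) (X → ZMod 2)} (hA : Y.IsInv A) (hB : Y.IsInv B) :
    Y.IsInv (A * B) := fun γ h => by rw [← mul_assoc, hA γ h, mul_assoc, hB γ h, mul_assoc]

theorem IsLabel.pull_mulOp {s : X → ZMod 2} (hs : Y.IsLabel s) {γ : X → X} (h : γ ∈ Y.G) :
    ∃ c : ZMod 2, pull γ * mulOp s = (mulOp s + algebraMap _ _ c) * pull γ := by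
  obtain ⟨c, hc⟩ := hs γ h
  refine ⟨c, ?_⟩
  refine LinearMap.ext fun f => funext fun x => ?_
  change s (γ x) * f (γ x) = s x * f (γ x) + c * f (γ x)
  rw [hc, add_mul]

/-- Commutators of labels with invariant operators are invariant. -/
theorem IsLabel.comm {s : X → ZMod 2} (hs : Y.IsLabel s) {A : Module.End (ZMod 2) (X → ZMod 2)}
    (hA : Y.IsInv A) : Y.IsInv (mulOp s * A + A * mulOp s) := by
  intro γ h
  obtain ⟨c, hc⟩ := hs.pull_mulOp h
  have h1 : A * algebraMap _ _ c = algebraMap _ _ c * A := (Algebra.commutes c A).symm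
  have h2 := end_add_self (algebraMap (ZMod 2) _ c * A * pull γ)
  calc pull γ * (mulOp s * A + A * mulOp s) = (pull γ * mulOp s) * A + (pull γ * A) * mulOp s := by
        rw [mul_add, mul_assoc, mul_assoc]
    _ = (mulOp s * A + A * mulOp s) * pull γ +
        (algebraMap (ZMod 2) _ c * A * pull γ + algebraMap (ZMod 2) _ c * A * pull γ) := by
        rw [hc, hA γ h, mul_assoc, hA γ h, mul_assoc A, hc, ← mul_assoc A, mul_add A, h1]
        noncomm_ring
    _ = _ := by rw [h2, add_zero]

theorem IsLabel.D {s : X → ZMod 2} (hs : Y.IsLabel s) : Y.IsInv (Y.D s) := hs.comm Y.pull_U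

theorem word_inv {l : List (X → ZMod 2)} (hl : ∀ s ∈ l, Y.IsLabel s) : Y.IsInv (Y.word l) := by
  induction l with
  | nil => intro γ _; simp [word]
  | cons s l ih =>
    have : Y.word (s :: l) = Y.D s * Y.word l := by simp [word]
    rw [this]
    exact (hl s (by simp)).D.mul (ih fun t ht => hl t (by simp [ht]))

theorem U_D (s : X → ZMod 2) : Y.U * Y.D s = Y.D s * Y.U := by
  have := Y.sq
  rw [D, mul_add, add_mul, ← mul_assoc Y.U Y.U, mul_assoc (mulOp s), this]
  simp [mul_assoc]

theorem U_word (l : List (X → ZMod 2)) : Y.U * Y.word l = Y.word l * Y.U := by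
  induction l with
  | nil => simp [word]
  | cons s l ih =>
    have : Y.word (s :: l) = Y.D s * Y.word l := by simp [word]
    rw [this, ← mul_assoc, U_D, mul_assoc, ih, mul_assoc]

theorem r_comm {l l' : List (X → ZMod 2)} (hl : ∀ s ∈ l, Y.IsLabel s) (hl' : ∀ s ∈ l', Y.IsLabel s)
    {C : Module.End (ZMod 2) (X → ZMod 2)} (hC : Y.IsInv C) :
    Y.r ((Y.word l * ((C * Y.U + Y.U * C) * Y.word l')) Y.e) = 0 := by
  have h1 : Y.word l * ((C * Y.U + Y.U * C) * Y.word l') =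
      Y.word l * (C * Y.word l') * Y.U + Y.U * (Y.word l * (C * Y.word l')) := by
    rw [add_mul, mul_assoc C, U_word, mul_add, ← mul_assoc Y.U, U_word]
    simp only [mul_assoc]
  rw [h1, LinearMap.add_apply, map_add, Module.End.mul_apply, Y.U_e, map_zero, map_zero, zero_add,
    Module.End.mul_apply]
  refine Y.r_U _ fun γ hγ => ?_
  have := (word_inv hl).mul (hC.mul (word_inv hl')) γ hγ
  rw [← Module.End.mul_apply, this, Module.End.mul_apply, Y.pull_e γ hγ]

theorem word_append (l l' : List (X → ZMod 2)) : Y.word (l ++ l') = Y.word l * Y.word l' := by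
  simp [word]

theorem word_cons (s : X → ZMod 2) (l : List (X → ZMod 2)) : Y.word (s :: l) = Y.D s * Y.word l := by
  simp [word]

theorem D_add (s t : X → ZMod 2) : Y.D (s + t) = Y.D s + Y.D t := by
  have : mulOp (s + t) = mulOp s + mulOp t := by
    refine LinearMap.ext fun f => funext fun x => add_mul _ _ _
  rw [D, D, D, this]
  noncomm_ring

theorem Q_add (s t : X → ZMod 2) (l : List (X → ZMod 2)) :
    Y.Q ((s + t) :: l) = Y.Q (s :: l) + Y.Q (t :: l) := by
  simp only [Q, word_cons, D_add, add_mul, LinearMap.add_apply, map_add]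

theorem Q_swap {s t : X → ZMod 2} {p l : List (X → ZMod 2)} (hs : Y.IsLabel s) (ht : Y.IsLabel t)
    (hp : ∀ s ∈ p, Y.IsLabel s) (hl : ∀ s ∈ l, Y.IsLabel s) :
    Y.Q (p ++ s :: t :: l) = Y.Q (p ++ t :: s :: l) := by
  have h := r_comm hp hl (hs.comm ht.D)
  have e1 : (mulOp s * Y.D t + Y.D t * mulOp s) * Y.U + Y.U * (mulOp s * Y.D t + Y.D t * mulOp s) =
      Y.D s * Y.D t + Y.D t * Y.D s := by
    have h1 : Y.D s * Y.D t + Y.D t * Y.D s = mulOp s * (Y.U * Y.D t) + Y.U * mulOp s * Y.D t +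
        (Y.D t * mulOp s * Y.U + (Y.D t * Y.U) * mulOp s) := by
      have hD : Y.D s = mulOp s * Y.U + Y.U * mulOp s := rfl
      rw [hD]
      noncomm_ring
    rw [h1, show mulOp s * (Y.U * Y.D t) = mulOp s * (Y.D t * Y.U) by rw [U_D],
      show Y.D t * Y.U * mulOp s = Y.U * Y.D t * mulOp s by rw [U_D]]
    noncomm_ring
  rw [e1] at h
  have h2 : Y.Q (p ++ s :: t :: l) + Y.Q (p ++ t :: s :: l) = 0 := by
    rw [← h, Q, Q, ← map_add, ← LinearMap.add_apply, word_append, word_append, word_cons, word_cons,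
      word_cons, word_cons]
    congr 2
    noncomm_ring
  exact CharTwo.add_eq_zero.1 h2

theorem Q_perm_append {l l' : List (X → ZMod 2)} (h : l.Perm l') (p : List (X → ZMod 2))
    (hp : ∀ s ∈ p, Y.IsLabel s) (hl : ∀ s ∈ l, Y.IsLabel s) : Y.Q (p ++ l) = Y.Q (p ++ l') := by
  induction h generalizing p with
  | nil => rfl
  | cons x h ih =>
    have := ih (p ++ [x]) (fun s hs => ?_) fun s hs => hl s (by simp [hs])
    · simpa using this
    · rcases List.mem_append.1 hs with h | h
      · exact hp s h
      · rw [List.mem_singleton.1 h]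
        exact hl x (by simp)
  | swap x y l =>
    exact Q_swap (hl y (by simp)) (hl x (by simp)) hp fun s hs => hl s (by simp [hs])
  | trans h1 h2 ih1 ih2 =>
    rw [ih1 p hp hl, ih2 p hp fun s hs => hl s (h1.mem_iff.2 hs)]

/-- The evaluation does not depend on the order of labels. -/
theorem Q_perm {l l' : List (X → ZMod 2)} (h : l.Perm l') (hl : ∀ s ∈ l, Y.IsLabel s) :
    Y.Q l = Y.Q l' := Q_perm_append h [] (by simp) hl

/-- The evaluation does not change if labels with the same behaviour are exchanged. -/
theorem Q_replace {s t : X → ZMod 2} {l : List (X → ZMod 2)} (hl : ∀ s ∈ l, Y.IsLabel s)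
    (h : ∀ γ ∈ Y.G, ∃ c : ZMod 2, (∀ x, s (γ x) = s x + c) ∧ ∀ x, t (γ x) = t x + c) :
    Y.Q (s :: l) = Y.Q (t :: l) := by
  have h1 : Y.Q ((s + t) :: l) = 0 := by
    have hC : Y.IsInv (mulOp (s + t)) := by
      intro γ hγ
      obtain ⟨c, h1, h2⟩ := h γ hγ
      refine LinearMap.ext fun f => funext fun x => ?_
      change (s (γ x) + t (γ x)) * f (γ x) = (s x + t x) * f (γ x)
      rw [h1, h2]
      linear_combination f (γ x) * CharTwo.add_self_eq_zero c
    have := r_comm (l := []) (by simp) hl hC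
    rw [Q, word_cons]
    simpa [word, D] using this
  rw [Q_add] at h1
  exact CharTwo.add_eq_zero.1 h1

end Machine

/-- Lattice points of a product of boundaries of cubes. -/
def Box {C Φ : Type} (fib : C → Φ) (R : ℤ) : Set (C → ℤ) :=
  {x | (∀ c, |x c| ≤ R) ∧ ∀ φ, ∃ c, fib c = φ ∧ |x c| = R}

namespace Box

variable {C Φ : Type} [Fintype C] [DecidableEq C] [Fintype Φ] [DecidableEq Φ] {fib : C → Φ} {R : ℤ}

theorem finite : (Box fib R).Finite := by
  refine (Set.Finite.pi (t := fun _ : C => Set.Icc (-R) R) fun _ => Set.finite_Icc _ _).subset ?_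
  intro x hx c _
  exact abs_le.1 (hx.1 c)

noncomputable instance : Fintype (Box fib R) := finite.fintype

open Classical in
/-- Extension by zero. -/
noncomputable def ext (f : Box fib R → ZMod 2) (z : C → ℤ) : ZMod 2 :=
  if h : z ∈ Box fib R then f ⟨z, h⟩ else 0

theorem ext_mem (f : Box fib R → ZMod 2) {z : C → ℤ} (h : z ∈ Box fib R) : ext f z = f ⟨z, h⟩ :=
  dif_pos h

theorem ext_notMem (f : Box fib R → ZMod 2) {z : C → ℤ} (h : z ∉ Box fib R) : ext f z = 0 :=
  dif_neg h

theorem ext_eq_sum (f : Box fib R → ZMod 2) (z : C → ℤ) :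
    ext f z = ∑ y : Box fib R, if y.1 = z then f y else 0 := by
  by_cases h : z ∈ Box fib R
  · rw [ext_mem f h, Finset.sum_eq_single ⟨z, h⟩]
    · simp
    · intro y _ hy
      exact if_neg fun h' => hy (Subtype.ext h')
    · simp
  · rw [ext_notMem f h]
    refine (Finset.sum_eq_zero fun y _ => if_neg ?_).symm
    rintro rfl
    exact h y.2

/-- Translations are adjoint to each other. -/
theorem sum_ext (f g : Box fib R → ZMod 2) (w : C → ℤ) :
    ∑ x, g x * ext f (x.1 + w) = ∑ y, f y * ext g (y.1 - w) := by
  simp only [ext_eq_sum, Finset.mul_sum]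
  rw [Finset.sum_comm]
  refine Finset.sum_congr rfl fun y _ => Finset.sum_congr rfl fun x _ => ?_
  have : y.1 = x.1 + w ↔ x.1 = y.1 - w := by
    rw [eq_sub_iff_add_eq, eq_comm]
  simp only [this]
  split_ifs <;> ring

/-- The coboundary. -/
noncomputable def cob : Module.End (ZMod 2) (Box fib R → ZMod 2) where
  toFun f x := ∑ p : C × ℤˣ, if Even (x.1 p.1) then ext f (x.1 + Pi.single p.1 (p.2 : ℤ)) else 0
  map_add' f g := by
    funext x
    rw [Pi.add_apply, ← Finset.sum_add_distrib]
    refine Finset.sum_congr rfl fun p _ => ?_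
    have : ∀ z, ext (f + g) z = ext f z + ext g z := by
      intro z
      unfold ext
      split_ifs <;> simp
    rw [this]
    split_ifs <;> simp
  map_smul' r f := by
    funext x
    rw [Pi.smul_apply, Finset.smul_sum]
    refine Finset.sum_congr rfl fun p _ => ?_
    have : ∀ z, ext (r • f) z = r • ext f z := by
      intro z
      unfold ext
      split_ifs <;> simp
    rw [this]
    split_ifs <;> simp

theorem cob_apply (f : Box fib R → ZMod 2) (x : Box fib R) : cob f x =
    ∑ p : C × ℤˣ, if Even (x.1 p.1) then ext f (x.1 + Pi.single p.1 (p.2 : ℤ)) else 0 := rfl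

theorem not_even_add {a : ℤ} (h : Even a) (v : ℤˣ) : ¬ Even (a + v) := by
  rcases Int.units_eq_one_or v with rfl | rfl
  · simpa [Int.even_add_one] using h
  · rw [Int.not_even_iff_odd]
    exact h.add_odd (by decide)

theorem even_of_abs {a : ℤ} (hR : Even R) (h : |a| = R) : Even a := by
  rw [← even_abs, h]
  exact hR

theorem step_same (x : C → ℤ) (c : C) (v : ℤ) : (x + Pi.single c v : C → ℤ) c = x c + v := by simp

theorem step_ne (x : C → ℤ) {c c' : C} (h : c' ≠ c) (v : ℤ) : (x + Pi.single c v : C → ℤ) c' = x c' := by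
  simp [h]

theorem sum_symm {P : Type} [Fintype P] (a : P → P → ZMod 2) (h1 : ∀ p q, a p q = a q p)
    (h2 : ∀ p, a p p = 0) : ∑ p, ∑ q, a p q = 0 := by
  rw [← Fintype.sum_prod_type']
  refine Finset.sum_involution (fun p _ => (p.2, p.1)) ?_ ?_ ?_ ?_
  · intro p _
    rw [h1]
    exact CharTwo.add_self_eq_zero _
  · rintro ⟨p, q⟩ _ h h'
    simp only [Prod.mk.injEq] at h'
    obtain ⟨rfl, -⟩ := h'
    exact h (h2 _)
  · simp
  · simp

theorem cob_sq (hR : Even R) : (cob : Module.End (ZMod 2) (Box fib R → ZMod 2)) * cob = 0 := by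
  refine LinearMap.ext fun f => funext fun x => ?_
  let a : C × ℤˣ → C × ℤˣ → ZMod 2 := fun p q =>
    if p.1 ≠ q.1 ∧ Even (x.1 p.1) ∧ Even (x.1 q.1) then
      ext f (x.1 + Pi.single p.1 (p.2 : ℤ) + Pi.single q.1 (q.2 : ℤ)) else 0
  have h : (cob (cob f)) x = ∑ p, ∑ q, a p q := by
    rw [cob_apply]
    refine Finset.sum_congr rfl fun p _ => ?_
    by_cases hp : Even (x.1 p.1)
    · rw [if_pos hp]
      by_cases hm : x.1 + Pi.single p.1 (p.2 : ℤ) ∈ Box fib R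
      · rw [ext_mem _ hm, cob_apply]
        refine Finset.sum_congr rfl fun q _ => ?_
        simp only [a]
        by_cases hpq : p.1 = q.1
        · rw [if_neg, if_neg]
          · exact fun h => h.1 hpq
          · rw [← hpq, step_same]
            exact not_even_add hp _
        · rw [step_ne _ (Ne.symm hpq)]
          simp [hpq, hp]
      · rw [ext_notMem _ hm]
        symm
        refine Finset.sum_eq_zero fun q _ => ?_
        simp only [a]
        split_ifs with h
        · refine ext_notMem _ fun h' => hm ⟨fun c => ?_, fun φ => ?_⟩
          · by_cases hc : c = q.1
            · subst hc
              rw [step_ne _ (Ne.symm h.1)]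
              exact x.2.1 _
            · have := h'.1 c
              rwa [step_ne _ hc] at this
          · obtain ⟨c, hc, hc'⟩ := h'.2 φ
            refine ⟨c, hc, ?_⟩
            rwa [step_ne] at hc'
            rintro rfl
            have := even_of_abs hR hc'
            rw [step_same, step_ne _ (Ne.symm h.1)] at this
            exact not_even_add h.2.2 _ this
        · rfl
    · rw [if_neg hp]
      symm
      exact Finset.sum_eq_zero fun q _ => if_neg fun h => hp h.2.1
  change cob (cob f) x = 0
  rw [h]
  refine sum_symm a (fun p q => ?_) fun p => if_neg fun h => h.1 rfl
  simp only [a]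
  rw [add_right_comm]
  refine if_congr ?_ rfl rfl
  tauto

/-- The even coordinates of a fibre. -/
def evens (fib : C → Φ) (x : C → ℤ) (φ : Φ) : Finset C :=
  Finset.univ.filter fun c => fib c = φ ∧ Even (x c)

theorem mem_evens {x : C → ℤ} {φ : Φ} {c : C} : c ∈ evens fib x φ ↔ fib c = φ ∧ Even (x c) := by
  simp [evens]

/-- The indicator of the points with exactly one even coordinate in each fibre. -/
def top (fib : C → Φ) (x : C → ℤ) : ZMod 2 :=
  if ∀ φ, (evens fib x φ).card = 1 then 1 else 0

/-- The distinguished cocycle. -/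
def coc (x : Box fib R) : ZMod 2 := top fib x.1

theorem evens_step {x : C → ℤ} {c : C} (h : Even (x c)) (v : ℤˣ) (φ : Φ) :
    evens fib (x + Pi.single c (v : ℤ)) φ = (evens fib x φ).erase c := by
  ext c'
  rw [Finset.mem_erase, mem_evens, mem_evens]
  by_cases hc : c' = c
  · subst hc
    rw [step_same]
    simp [not_even_add h v]
  · rw [step_ne _ hc]
    simp [hc]

theorem step_mem (hR : Even R) {x : C → ℤ} (hx : x ∈ Box fib R) {c : C} (h : Even (x c)) (v : ℤˣ) :
    x + Pi.single c (v : ℤ) ∈ Box fib R ↔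
      |x c + v| ≤ R ∧ ∃ c', c' ≠ c ∧ fib c' = fib c ∧ |x c'| = R := by
  constructor
  · intro h'
    refine ⟨by simpa using h'.1 c, ?_⟩
    obtain ⟨c', h1, h2⟩ := h'.2 (fib c)
    have hc : c' ≠ c := by
      rintro rfl
      have := even_of_abs hR h2
      rw [step_same] at this
      exact not_even_add h v this
    exact ⟨c', hc, h1, by rwa [step_ne _ hc] at h2⟩
  · rintro ⟨h1, c', h2, h3, h4⟩
    refine ⟨fun d => ?_, fun φ => ?_⟩
    · by_cases hd : d = c
      · subst hd
        rwa [step_same]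
      · rw [step_ne _ hd]
        exact hx.1 d
    · by_cases hφ : φ = fib c
      · exact ⟨c', h3.trans hφ.symm, by rwa [step_ne _ h2]⟩
      · obtain ⟨d, hd, hd'⟩ := hx.2 φ
        refine ⟨d, hd, ?_⟩
        rwa [step_ne]
        rintro rfl
        exact hφ hd.symm

theorem cob_coc (hR : Even R) (hR0 : 0 < R) : cob (coc : Box fib R → ZMod 2) = 0 := by
  classical
  funext x
  rw [cob_apply, Fintype.sum_prod_type, Pi.zero_apply]
  let P : Φ → Prop := fun φ => (evens fib x.1 φ).card = 2 ∧
    (∀ c ∈ evens fib x.1 φ, |x.1 c| = R) ∧ ∀ ψ, ψ ≠ φ → (evens fib x.1 ψ).card = 1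
  have key : ∀ c, (∑ v : ℤˣ, if Even (x.1 c) then ext (coc (fib := fib) (R := R)) (x.1 + Pi.single c (v : ℤ)) else 0) =
      if P (fib c) ∧ Even (x.1 c) then (1 : ZMod 2) else 0 := by
    intro c
    by_cases hc : Even (x.1 c)
    · have hcE : c ∈ evens fib x.1 (fib c) := mem_evens.2 ⟨rfl, hc⟩
      have htop : ∀ v : ℤˣ, top fib (x.1 + Pi.single c (v : ℤ)) =
          if (evens fib x.1 (fib c)).card = 2 ∧ ∀ ψ, ψ ≠ fib c → (evens fib x.1 ψ).card = 1
          then 1 else 0 := by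
        intro v
        refine if_congr ?_ rfl rfl
        simp only [evens_step hc]
        have e : ∀ ψ, ψ ≠ fib c → (evens fib x.1 ψ).erase c = evens fib x.1 ψ := fun ψ hψ =>
          Finset.erase_eq_of_notMem fun h => hψ (mem_evens.1 h).1.symm
        have e' := Finset.card_erase_add_one hcE
        constructor
        · intro h
          refine ⟨by have := h (fib c); omega, fun ψ hψ => ?_⟩
          rw [← e ψ hψ]
          exact h ψ
        · rintro ⟨h1, h2⟩ ψ
          by_cases hψ : ψ = fib c
          · subst hψ; omega
          · rw [e ψ hψ, h2 ψ hψ]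
      have hext : ∀ v : ℤˣ, ext (coc (fib := fib) (R := R)) (x.1 + Pi.single c (v : ℤ)) =
          if |x.1 c + v| ≤ R ∧ ∃ c', c' ≠ c ∧ fib c' = fib c ∧ |x.1 c'| = R then
            top fib (x.1 + Pi.single c (v : ℤ)) else 0 := by
        intro v
        split_ifs with h
        · exact ext_mem _ ((step_mem hR x.2 hc v).2 h)
        · exact ext_notMem _ fun h' => h ((step_mem hR x.2 hc v).1 h')
      simp only [hc, if_true, and_true, hext, htop, UnitsInt.univ]
      rw [Finset.sum_pair (by decide)]
      by_cases hext : |x.1 c| = R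
      · have hP : P (fib c) ↔ ((∃ c', c' ≠ c ∧ fib c' = fib c ∧ |x.1 c'| = R) ∧
            (evens fib x.1 (fib c)).card = 2 ∧ ∀ ψ, ψ ≠ fib c → (evens fib x.1 ψ).card = 1) := by
          constructor
          · rintro ⟨h1, h2, h3⟩
            refine ⟨?_, h1, h3⟩
            obtain ⟨c', h4, h5⟩ := Finset.exists_mem_ne (by omega : 1 < (evens fib x.1 (fib c)).card) c
            exact ⟨c', h5, (mem_evens.1 h4).1, h2 c' h4⟩
          · rintro ⟨⟨c', h4, h5, h6⟩, h1, h3⟩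
            refine ⟨h1, ?_, h3⟩
            have : ({c, c'} : Finset C) = evens fib x.1 (fib c) := by
              refine Finset.eq_of_subset_of_card_le ?_ ?_
              · intro d hd
                rcases Finset.mem_insert.1 hd with rfl | hd
                · exact hcE
                · rw [Finset.mem_singleton.1 hd]
                  exact mem_evens.2 ⟨h5, even_of_abs hR h6⟩
              · rw [h1, Finset.card_pair (Ne.symm h4)]
            rw [← this]
            intro d hd
            rcases Finset.mem_insert.1 hd with rfl | hd
            · exact hext
            · rwa [Finset.mem_singleton.1 hd]
        rw [if_congr hP rfl rfl]
        rcases abs_choice (x.1 c) with h | h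
        · have h1 : |x.1 c + ((-1 : ℤˣ) : ℤ)| ≤ R := by
            rw [abs_le, Units.val_neg, Units.val_one]; omega
          have h2 : ¬ |x.1 c + ((1 : ℤˣ) : ℤ)| ≤ R := by
            rw [abs_le, Units.val_one]; omega
          simp only [h1, h2, true_and, false_and, if_false, zero_add, ite_and]
        · have h1 : ¬ |x.1 c + ((-1 : ℤˣ) : ℤ)| ≤ R := by
            rw [abs_le, Units.val_neg, Units.val_one]; omega
          have h2 : |x.1 c + ((1 : ℤˣ) : ℤ)| ≤ R := by
            rw [abs_le, Units.val_one]; omega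
          simp only [h1, h2, true_and, false_and, if_false, add_zero, ite_and]
      · have hlt := lt_of_le_of_ne (x.2.1 c) hext
        have hb : ∀ v : ℤˣ, |x.1 c + v| ≤ R := by
          intro v
          rcases Int.units_eq_one_or v with rfl | rfl
          · have := abs_add_le (x.1 c) ((1 : ℤˣ) : ℤ)
            rw [Units.val_one, abs_one] at this
            rw [Units.val_one]; omega
          · have := abs_add_le (x.1 c) ((-1 : ℤˣ) : ℤ)
            rw [Units.val_neg, Units.val_one, abs_neg, abs_one] at this
            rw [Units.val_neg, Units.val_one]; omega
        have hP : ¬ P (fib c) := fun h => hext (h.2.1 c hcE)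
        rw [if_neg hP]
        simp only [hb]
        exact CharTwo.add_self_eq_zero _
    · simp [hc]
  simp only [key]
  rw [← Finset.sum_fiberwise Finset.univ fib]
  refine Finset.sum_eq_zero fun φ _ => ?_
  by_cases hP : P φ
  · have : (∑ c ∈ Finset.univ.filter fun c => fib c = φ, if P (fib c) ∧ Even (x.1 c) then
        (1 : ZMod 2) else 0) = ((evens fib x.1 φ).card : ZMod 2) := by
      rw [evens, ← Finset.filter_filter, Finset.card_filter, Nat.cast_sum]
      refine Finset.sum_congr rfl fun c hc => ?_
      rw [(Finset.mem_filter.1 hc).2]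
      simp [hP]
    rw [this, hP.1]
    decide
  · refine Finset.sum_eq_zero fun c hc => if_neg ?_
    rw [(Finset.mem_filter.1 hc).2]
    exact fun h => hP h.1

end Box

/-- Signed permutations of coordinates respecting fibres. -/
structure SignedSymm {C Φ : Type} (fib : C → Φ) where
  /-- The permutation of the coordinates. -/
  perm : Equiv.Perm C
  /-- The permutation of the fibres. -/
  base : Equiv.Perm Φ
  /-- The signs. -/
  sign : C → ℤˣ
  fib_perm : ∀ c, fib (perm c) = base (fib c)

namespace SignedSymm

open Box

variable {C Φ : Type} [Fintype C] [DecidableEq C] [Fintype Φ] [DecidableEq Φ] {fib : C → Φ} {R : ℤ}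
variable (g : SignedSymm fib)

/-- The action on lattice points. -/
def act (x : C → ℤ) : C → ℤ := fun c => g.sign c * x (g.perm c)

theorem abs_act (x : C → ℤ) (c : C) : |g.act x c| = |x (g.perm c)| := by
  rw [act, abs_mul, ← Int.natCast_natAbs, Int.units_natAbs, Nat.cast_one, one_mul]

theorem even_act (x : C → ℤ) (c : C) : Even (g.act x c) ↔ Even (x (g.perm c)) := by
  rw [← even_abs, abs_act, even_abs]

theorem act_mem {x : C → ℤ} : g.act x ∈ Box fib R ↔ x ∈ Box fib R := by
  constructor
  · intro h
    refine ⟨fun c => ?_, fun φ => ?_⟩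
    · have := h.1 (g.perm.symm c)
      rwa [abs_act, Equiv.apply_symm_apply] at this
    · obtain ⟨c, h1, h2⟩ := h.2 (g.base.symm φ)
      rw [abs_act] at h2
      exact ⟨_, by rw [g.fib_perm, h1, Equiv.apply_symm_apply], h2⟩
  · intro h
    refine ⟨fun c => ?_, fun φ => ?_⟩
    · rw [abs_act]
      exact h.1 _
    · obtain ⟨c, h1, h2⟩ := h.2 (g.base φ)
      refine ⟨g.perm.symm c, ?_, ?_⟩
      · apply g.base.injective
        rw [← g.fib_perm, Equiv.apply_symm_apply, h1]
      · rwa [abs_act, Equiv.apply_symm_apply]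

/-- The action on points of the box. -/
def map (x : Box fib R) : Box fib R := ⟨g.act x.1, g.act_mem.2 x.2⟩

theorem act_add (x y : C → ℤ) : g.act (x + y) = g.act x + g.act y := by
  funext c
  simp [act, mul_add]

theorem act_single (c : C) (v : ℤ) :
    g.act (Pi.single (g.perm c) v) = Pi.single c (g.sign c * v) := by
  funext d
  by_cases h : d = c
  · subst h; simp [act]
  · have : g.perm d ≠ g.perm c := fun h' => h (g.perm.injective h')
    simp [act, h, this]

theorem ext_act (f : Box fib R → ZMod 2) (z : C → ℤ) : ext f (g.act z) = ext (pull g.map f) z := by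
  by_cases h : z ∈ Box fib R
  · rw [ext_mem _ h, ext_mem _ (g.act_mem.2 h)]
    rfl
  · rw [ext_notMem _ h, ext_notMem _ fun h' => h (g.act_mem.1 h')]

theorem pull_cob : pull (g.map (R := R)) * cob = cob * pull g.map := by
  refine LinearMap.ext fun f => funext fun x => ?_
  change cob f (g.map x) = cob (pull g.map f) x
  rw [cob_apply, cob_apply]
  let E : C × ℤˣ ≃ C × ℤˣ :=
    { toFun := fun p => (g.perm p.1, g.sign p.1 * p.2)
      invFun := fun p => (g.perm.symm p.1, g.sign (g.perm.symm p.1) * p.2)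
      left_inv := fun p => by simp [← mul_assoc]
      right_inv := fun p => by simp [← mul_assoc] }
  refine Fintype.sum_equiv E _ _ fun p => ?_
  have h1 : Even ((g.map x).1 p.1) ↔ Even (x.1 (E p).1) := g.even_act _ _
  have h2 : (g.map x).1 + Pi.single p.1 (p.2 : ℤ) = g.act (x.1 + Pi.single (E p).1 ((E p).2 : ℤ)) := by
    rw [act_add]
    refine congrArg (g.act x.1 + ·) ((congrArg (Pi.single p.1) ?_).trans (g.act_single _ _).symm)
    change _ = (g.sign p.1 : ℤ) * ((g.sign p.1 * p.2 : ℤˣ) : ℤ)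
    rw [← Units.val_mul, ← mul_assoc, Int.units_mul_self, one_mul]
  rw [h2, ext_act]
  exact if_congr h1 rfl rfl

theorem pull_coc : pull (g.map (R := R)) coc = coc := by
  funext x
  refine if_congr ?_ rfl rfl
  have h : ∀ φ, (evens fib (g.map x).1 φ).card = (evens fib x.1 (g.base φ)).card := by
    intro φ
    refine Finset.card_bij (fun c _ => g.perm c) ?_ ?_ ?_
    · intro c hc
      rw [mem_evens] at hc ⊢
      exact ⟨by rw [g.fib_perm, hc.1], (g.even_act _ _).1 hc.2⟩
    · intro c _ d _ h
      exact g.perm.injective h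
    · intro c hc
      rw [mem_evens] at hc
      refine ⟨g.perm.symm c, mem_evens.2 ⟨?_, (g.even_act _ _).2 ?_⟩, by simp⟩
      · apply g.base.injective
        rw [← g.fib_perm, Equiv.apply_symm_apply, hc.1]
      · rw [Equiv.apply_symm_apply]
        exact hc.2
  simp only [h]
  exact ⟨fun h φ => by simpa using h (g.base.symm φ), fun h φ => h _⟩

/-- Sums invariant under a free involution vanish. -/
theorem sum_eq_zero {X : Type} [Fintype X] {S : Finset X} {γ : X → X} {F : X → ZMod 2}
    (h1 : ∀ x ∈ S, γ x ∈ S) (h2 : ∀ x ∈ S, γ (γ x) = x) (h3 : ∀ x ∈ S, γ x ≠ x)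
    (h4 : ∀ x ∈ S, F (γ x) = F x) : ∑ x ∈ S, F x = 0 := by
  refine Finset.sum_involution (fun x _ => γ x) ?_ ?_ ?_ ?_
  · intro x hx
    rw [h4 x hx]
    exact CharTwo.add_self_eq_zero _
  · intro x hx _
    exact h3 x hx
  · exact h1
  · exact h2

end SignedSymm

namespace SymTree

open Shape

/-- The exchange of the two subtrees at a vertex, acting on vertices. -/
def swapN : (T : SymTree) → T.toShape.N → Equiv.Perm T.toShape.N
  | leaf, ν => Empty.elim ν
  | cat A B, ν => Sum.elim (fun h => absurd h.down Bool.false_ne_true)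
      (Sum.elim (fun μ => (Equiv.refl _).sumCongr ((swapN A μ).sumCongr (Equiv.refl _)))
        (fun μ => (Equiv.refl _).sumCongr ((Equiv.refl _).sumCongr (swapN B μ)))) ν
  | dbl A, ν => Sum.elim (fun _ => (Equiv.refl _).sumCongr (Equiv.sumComm _ _))
      (Sum.elim (fun μ => (Equiv.refl _).sumCongr ((swapN A μ).sumCongr (Equiv.refl _)))
        (fun μ => (Equiv.refl _).sumCongr ((Equiv.refl _).sumCongr (swapN A μ)))) ν

/-- The exchange of the two subtrees at a vertex, acting on leaves. -/
def swapL : (T : SymTree) → T.toShape.N → Equiv.Perm T.toShape.L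
  | leaf, ν => Empty.elim ν
  | cat A B, ν => Sum.elim (fun h => absurd h.down Bool.false_ne_true)
      (Sum.elim (fun μ => (swapL A μ).sumCongr (Equiv.refl _))
        (fun μ => (Equiv.refl _).sumCongr (swapL B μ))) ν
  | dbl A, ν => Sum.elim (fun _ => Equiv.sumComm _ _)
      (Sum.elim (fun μ => (swapL A μ).sumCongr (Equiv.refl _))
        (fun μ => (Equiv.refl _).sumCongr (swapL A μ))) ν

theorem swapN_self (T : SymTree) (ν : T.toShape.N) : T.swapN ν ν = ν := by
  induction T with
  | leaf => exact Empty.elim ν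
  | cat A B hA hB =>
    rcases ν with h | ν | ν
    · exact absurd h.down Bool.false_ne_true
    · exact congrArg (fun μ => Sum.inr (Sum.inl μ)) (hA ν)
    · exact congrArg (fun μ => Sum.inr (Sum.inr μ)) (hB ν)
  | dbl A hA =>
    rcases ν with h | ν | ν
    · rfl
    · exact congrArg (fun μ => Sum.inr (Sum.inl μ)) (hA ν)
    · exact congrArg (fun μ => Sum.inr (Sum.inr μ)) (hA ν)

theorem swapN_swapN (T : SymTree) (ν μ : T.toShape.N) : T.swapN ν (T.swapN ν μ) = μ := by
  induction T with
  | leaf => exact Empty.elim ν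
  | cat A B hA hB =>
    rcases ν with h | ν | ν
    · exact absurd h.down Bool.false_ne_true
    · rcases μ with h | μ | μ
      · rfl
      · exact congrArg (fun μ => Sum.inr (Sum.inl μ)) (hA ν μ)
      · rfl
    · rcases μ with h | μ | μ
      · rfl
      · rfl
      · exact congrArg (fun μ => Sum.inr (Sum.inr μ)) (hB ν μ)
  | dbl A hA =>
    rcases ν with h | ν | ν
    · rcases μ with h | μ | μ <;> rfl
    · rcases μ with h | μ | μ
      · rfl
      · exact congrArg (fun μ => Sum.inr (Sum.inl μ)) (hA ν μ)
      · rfl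
    · rcases μ with h | μ | μ
      · rfl
      · rfl
      · exact congrArg (fun μ => Sum.inr (Sum.inr μ)) (hA ν μ)

theorem swapL_swapL (T : SymTree) (ν : T.toShape.N) (x : T.toShape.L) :
    T.swapL ν (T.swapL ν x) = x := by
  induction T with
  | leaf => exact Empty.elim ν
  | cat A B hA hB =>
    rcases ν with h | ν | ν
    · exact absurd h.down Bool.false_ne_true
    · rcases x with x | x
      · exact congrArg Sum.inl (hA ν x)
      · rfl
    · rcases x with x | x
      · rfl
      · exact congrArg Sum.inr (hB ν x)
  | dbl A hA =>
    rcases ν with h | ν | ν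
    · rcases x with x | x <;> rfl
    · rcases x with x | x
      · exact congrArg Sum.inl (hA ν x)
      · rfl
    · rcases x with x | x
      · rfl
      · exact congrArg Sum.inr (hA ν x)

/-- Leading signs only depend on the orientations. -/
theorem lead_congr (t : Shape) (c : ZMod 2) {s s' : t.NS} (h : ∀ ν, (s ν).1 = (s' ν).1) (u : t.LS) :
    t.lead c s u = t.lead c s' u := by
  induction t generalizing c with
  | leaf => rfl
  | bin d A B hA hB =>
    have hr : (rt s).1 = (rt s').1 := by
      unfold rt
      split_ifs
      · exact h _
      · rfl
    have h1 := fun c u => hA c (s := fun ν => s (Sum.inr (Sum.inl ν)))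
      (s' := fun ν => s' (Sum.inr (Sum.inl ν))) (fun ν => h _) u
    have h2 := fun c u => hB c (s := fun ν => s (Sum.inr (Sum.inr ν)))
      (s' := fun ν => s' (Sum.inr (Sum.inr ν))) (fun ν => h _) u
    simp only [lead, hr, h1, h2]

theorem lead_cat {A B : Shape} (c : ZMod 2) (s : (bin false A B).NS) (u : (bin false A B).LS) :
    lead (bin false A B) c s u = lead A (lead B c (fun ν => s (Sum.inr (Sum.inr ν)))
      fun x => u (Sum.inr x)) (fun ν => s (Sum.inr (Sum.inl ν))) fun x => u (Sum.inl x) := rfl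

theorem lead_dbl {A : Shape} (c : ZMod 2) (s : (bin true A A).NS) (u : (bin true A A).LS) :
    lead (bin true A A) c s u = if (s (Sum.inl ⟨rfl⟩)).1 = true then
      lead A (lead A c (fun ν => s (Sum.inr (Sum.inl ν))) fun x => u (Sum.inl x))
        (fun ν => s (Sum.inr (Sum.inr ν))) fun x => u (Sum.inr x)
    else lead A (lead A c (fun ν => s (Sum.inr (Sum.inr ν))) fun x => u (Sum.inr x))
        (fun ν => s (Sum.inr (Sum.inl ν))) fun x => u (Sum.inl x) := rfl

/-- Leading signs are invariant under exchanges. -/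
theorem lead_swap (T : SymTree) (ν : T.toShape.N) (c : ZMod 2) {s s' : T.toShape.NS}
    (h1 : ∀ μ, μ ≠ ν → (s' μ).1 = (s (T.swapN ν μ)).1) (h2 : (s' ν).1 = !(s ν).1)
    (u : T.toShape.LS) : T.toShape.lead c s' (fun x => u (T.swapL ν x)) = T.toShape.lead c s u := by
  induction T generalizing c with
  | leaf => exact Empty.elim ν
  | cat A B hA hB =>
    rcases ν with h | ν | ν
    · exact absurd h.down Bool.false_ne_true
    · have e1 := fun c => hA ν c (s := fun μ => s (Sum.inr (Sum.inl μ)))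
        (s' := fun μ => s' (Sum.inr (Sum.inl μ)))
        (fun μ hμ => h1 (Sum.inr (Sum.inl μ)) fun h => hμ (Sum.inl.inj (Sum.inr.inj h))) h2
        (fun x => u (Sum.inl x))
      have e2 := fun c => lead_congr B.toShape c (s := fun μ => s (Sum.inr (Sum.inr μ)))
        (s' := fun μ => s' (Sum.inr (Sum.inr μ))) (fun μ => (h1 (Sum.inr (Sum.inr μ)) nofun).symm)
        (fun x => u (Sum.inr x))
      refine (lead_cat c s' _).trans (Eq.trans ?_ (lead_cat c s u).symm)
      rw [e2]
      exact e1 _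
    · have e1 := fun c => hB ν c (s := fun μ => s (Sum.inr (Sum.inr μ)))
        (s' := fun μ => s' (Sum.inr (Sum.inr μ)))
        (fun μ hμ => h1 (Sum.inr (Sum.inr μ)) fun h => hμ (Sum.inr.inj (Sum.inr.inj h))) h2
        (fun x => u (Sum.inr x))
      have e2 := fun c => lead_congr A.toShape c (s := fun μ => s (Sum.inr (Sum.inl μ)))
        (s' := fun μ => s' (Sum.inr (Sum.inl μ))) (fun μ => (h1 (Sum.inr (Sum.inl μ)) nofun).symm)
        (fun x => u (Sum.inl x))
      refine (lead_cat c s' _).trans (Eq.trans ?_ (lead_cat c s u).symm)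
      rw [e2]
      exact congrArg (fun c => lead A.toShape c _ _) (e1 _)
  | dbl A hA =>
    rcases ν with h | ν | ν
    · have e1 := fun c => lead_congr A.toShape c (s := fun μ => s' (Sum.inr (Sum.inl μ)))
        (s' := fun μ => s (Sum.inr (Sum.inr μ))) (fun μ => h1 (Sum.inr (Sum.inl μ)) nofun)
        (fun x => u (Sum.inr x))
      have e2 := fun c => lead_congr A.toShape c (s := fun μ => s' (Sum.inr (Sum.inr μ)))
        (s' := fun μ => s (Sum.inr (Sum.inl μ))) (fun μ => h1 (Sum.inr (Sum.inr μ)) nofun)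
        (fun x => u (Sum.inl x))
      refine (lead_dbl c s' _).trans (Eq.trans ?_ (lead_dbl c s u).symm)
      have h2' : (s' (Sum.inl ⟨rfl⟩)).1 = !(s (Sum.inl ⟨rfl⟩)).1 := h2
      rw [h2']
      cases (s (Sum.inl ⟨rfl⟩)).1
      · exact (congrArg (fun c => lead A.toShape c _ _) (e1 c)).trans (e2 _)
      · exact (congrArg (fun c => lead A.toShape c _ _) (e2 c)).trans (e1 _)
    · have e1 := fun c => hA ν c (s := fun μ => s (Sum.inr (Sum.inl μ)))
        (s' := fun μ => s' (Sum.inr (Sum.inl μ)))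
        (fun μ hμ => h1 (Sum.inr (Sum.inl μ)) fun h => hμ (Sum.inl.inj (Sum.inr.inj h))) h2
        (fun x => u (Sum.inl x))
      have e2 := fun c => lead_congr A.toShape c (s' := fun μ => s (Sum.inr (Sum.inr μ)))
        (s := fun μ => s' (Sum.inr (Sum.inr μ))) (fun μ => h1 (Sum.inr (Sum.inr μ)) nofun)
        (fun x => u (Sum.inr x))
      have e3 : (s' (Sum.inl ⟨rfl⟩)).1 = (s (Sum.inl ⟨rfl⟩)).1 := h1 (Sum.inl ⟨rfl⟩) nofun
      refine (lead_dbl c s' _).trans (Eq.trans ?_ (lead_dbl c s u).symm)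
      rw [e3]
      refine if_congr Iff.rfl ?_ ?_
      · exact (congrArg (fun c => lead A.toShape c _ _) (e1 c)).trans (e2 _)
      · exact (congrArg (fun c => lead A.toShape c _ _) (e2 c)).trans (e1 _)
    · have e1 := fun c => hA ν c (s := fun μ => s (Sum.inr (Sum.inr μ)))
        (s' := fun μ => s' (Sum.inr (Sum.inr μ)))
        (fun μ hμ => h1 (Sum.inr (Sum.inr μ)) fun h => hμ (Sum.inr.inj (Sum.inr.inj h))) h2
        (fun x => u (Sum.inr x))
      have e2 := fun c => lead_congr A.toShape c (s' := fun μ => s (Sum.inr (Sum.inl μ)))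
        (s := fun μ => s' (Sum.inr (Sum.inl μ))) (fun μ => h1 (Sum.inr (Sum.inl μ)) nofun)
        (fun x => u (Sum.inl x))
      have e3 : (s' (Sum.inl ⟨rfl⟩)).1 = (s (Sum.inl ⟨rfl⟩)).1 := h1 (Sum.inl ⟨rfl⟩) nofun
      refine (lead_dbl c s' _).trans (Eq.trans ?_ (lead_dbl c s u).symm)
      rw [e3]
      refine if_congr Iff.rfl ?_ ?_
      · exact (congrArg (fun c => lead A.toShape c _ _) (e2 c)).trans (e1 _)
      · exact (congrArg (fun c => lead A.toShape c _ _) (e1 c)).trans (e2 _)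

end SymTree

namespace Shape

variable {t : Shape}

/-- Coordinates: two for each vertex, and three families indexed by the leaves. -/
abbrev Crd (t : Shape) : Type := (t.N × Bool) ⊕ (Fin 3 × t.L)

/-- The faces: one for each vertex and one for each family. -/
abbrev Fac (t : Shape) : Type := t.N ⊕ Fin 3

/-- The face of a coordinate. -/
def fib (t : Shape) : t.Crd → t.Fac := Sum.map Prod.fst Prod.fst

/-- The orientations read off from a point. -/
def state (x : t.Crd → ℤ) : t.NS := fun ν =>
  (decide (x (Sum.inl (ν, false)) < 0 ∨ (x (Sum.inl (ν, false)) = 0 ∧ x (Sum.inl (ν, true)) < 0)),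
    decide (x (Sum.inl (ν, false)) = 0))

/-- The signs of the extremal coordinates in a family. -/
def signs (R : ℤ) (x : t.Crd → ℤ) (k : Fin 3) : t.LS := fun l =>
  if |x (Sum.inr (k, l))| = R then some (decide (x (Sum.inr (k, l)) < 0)) else none

/-- The leading sign of a family. -/
def sgm (R : ℤ) (k : Fin 3) (x : t.Crd → ℤ) : ZMod 2 := t.lead 0 (state x) (signs R x k)

/-- The negation of a family. -/
def negS (t : Shape) (k : Fin 3) : SignedSymm t.fib where
  perm := Equiv.refl _
  base := Equiv.refl _
  sign := Sum.elim (fun _ => 1) fun p => if p.1 = k then -1 else 1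
  fib_perm _ := rfl

theorem negS_inl (k : Fin 3) (x : t.Crd → ℤ) (p) :
    (negS t k).act x (Sum.inl p) = x (Sum.inl p) := by
  simp [SignedSymm.act, negS]

theorem negS_same (k : Fin 3) (x : t.Crd → ℤ) (l) :
    (negS t k).act x (Sum.inr (k, l)) = -x (Sum.inr (k, l)) := by
  simp [SignedSymm.act, negS]

theorem negS_ne {j k : Fin 3} (h : j ≠ k) (x : t.Crd → ℤ) (l) :
    (negS t k).act x (Sum.inr (j, l)) = x (Sum.inr (j, l)) := by
  simp [SignedSymm.act, negS, h]

theorem negS_negS (k : Fin 3) (x : t.Crd → ℤ) : (negS t k).act ((negS t k).act x) = x := by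
  funext c
  rcases c with p | ⟨j, l⟩
  · rw [negS_inl, negS_inl]
  · by_cases h : j = k
    · subst h
      rw [negS_same, negS_same, _root_.neg_neg]
    · rw [negS_ne h, negS_ne h]

theorem state_negS (k : Fin 3) (x : t.Crd → ℤ) : state ((negS t k).act x) = state x := by
  funext ν
  simp only [state, negS_inl]

theorem signs_negS_ne (R : ℤ) {j k : Fin 3} (h : j ≠ k) (x : t.Crd → ℤ) :
    signs R ((negS t k).act x) j = signs R x j := by
  funext l
  simp only [signs, negS_ne h]

theorem signs_negS_same {R : ℤ} (hR : 0 < R) (k : Fin 3) (x : t.Crd → ℤ) :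
    signs R ((negS t k).act x) k = neg (signs R x k) := by
  funext l
  simp only [signs, negS_same, neg, abs_neg]
  split_ifs with h
  · have h0 : x (Sum.inr (k, l)) ≠ 0 := fun h0 => by rw [h0, abs_zero] at h; omega
    simp only [Option.map_some, Option.some.injEq]
    rcases lt_or_gt_of_ne h0 with h1 | h1
    · simp [h1, h1.le]
    · simp [h1, h1.le]
  · rfl

theorem signs_ne_emp {R : ℤ} {x : t.Crd → ℤ} (hx : x ∈ Box t.fib R) (k : Fin 3) :
    signs R x k ≠ t.emp := by
  obtain ⟨c, h1, h2⟩ := hx.2 (Sum.inr k)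
  rcases c with p | ⟨j, l⟩
  · exact absurd h1 nofun
  · obtain rfl : j = k := Sum.inr.inj h1
    intro h
    have := congrFun h l
    rw [signs, if_pos h2] at this
    exact absurd this nofun

theorem sgm_negS {R : ℤ} (hR : 0 < R) {x : t.Crd → ℤ} (hx : x ∈ Box t.fib R) (j k : Fin 3) :
    sgm R j ((negS t k).act x) = sgm R j x + if j = k then 1 else 0 := by
  unfold sgm
  rw [state_negS]
  split_ifs with h
  · subst h
    rw [signs_negS_same hR, lead_neg_of_ne _ (signs_ne_emp hx _)]
  · rw [signs_negS_ne R h, add_zero]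

theorem node_ne {R : ℤ} (hR : 0 < R) {x : t.Crd → ℤ} (hx : x ∈ Box t.fib R) (ν : t.N) :
    x (Sum.inl (ν, false)) ≠ 0 ∨ x (Sum.inl (ν, true)) ≠ 0 := by
  obtain ⟨c, h1, h2⟩ := hx.2 (Sum.inl ν)
  rcases c with ⟨μ, b⟩ | p
  · obtain rfl : μ = ν := Sum.inl.inj h1
    have h0 : x (Sum.inl (μ, b)) ≠ 0 := fun h0 => by rw [h0, abs_zero] at h2; omega
    cases b
    · exact Or.inl h0
    · exact Or.inr h0
  · exact absurd h1 nofun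

theorem negS_fix {R : ℤ} (hR : 0 < R) {x : t.Crd → ℤ} (hx : x ∈ Box t.fib R) (k : Fin 3) :
    (negS t k).act x ≠ x := by
  intro h
  have := sgm_negS hR hx k k
  rw [h, if_pos rfl] at this
  simp at this

variable {R : ℤ}

theorem state_step_inr (x : t.Crd → ℤ) (p v) :
    state (x + Pi.single (Sum.inr p) v) = state x := by
  funext ν
  simp [state]

theorem signs_step_ne (x : t.Crd → ℤ) {k j : Fin 3} (h : j ≠ k) (l v) :
    signs R (x + Pi.single (Sum.inr (k, l)) v) j = signs R x j := by
  funext i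
  simp [signs, h]

theorem signs_step_inl (x : t.Crd → ℤ) (p v j) :
    signs R (x + Pi.single (Sum.inl p) v) j = signs R x j := by
  funext i
  simp [signs]

theorem state_step_ne (x : t.Crd → ℤ) {ν μ : t.N} (h : μ ≠ ν) (b v) :
    state (x + Pi.single (Sum.inl (ν, b)) v) μ = state x μ := by
  simp [state, h]

end Shape

namespace SymTree

open Shape

variable {T : SymTree}

/-- The exchange of the two subtrees at a vertex. -/
noncomputable def swapS (T : SymTree) (ν : T.toShape.N) : SignedSymm T.toShape.fib where
  perm := ((T.swapN ν).prodCongr (Equiv.refl _)).sumCongr ((Equiv.refl _).prodCongr (T.swapL ν))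
  base := (T.swapN ν).sumCongr (Equiv.refl _)
  sign := Sum.elim (fun p => if p.1 = ν then -1 else 1) fun _ => 1
  fib_perm c := by rcases c with p | p <;> rfl

theorem swapS_inr (ν : T.toShape.N) (x : T.toShape.Crd → ℤ) (k l) :
    (swapS T ν).act x (Sum.inr (k, l)) = x (Sum.inr (k, T.swapL ν l)) := by
  simp [SignedSymm.act, swapS]

theorem swapS_same (ν : T.toShape.N) (x : T.toShape.Crd → ℤ) (b) :
    (swapS T ν).act x (Sum.inl (ν, b)) = -x (Sum.inl (ν, b)) := by
  simp [SignedSymm.act, swapS, swapN_self]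

theorem swapS_ne {μ ν : T.toShape.N} (h : μ ≠ ν) (x : T.toShape.Crd → ℤ) (b) :
    (swapS T ν).act x (Sum.inl (μ, b)) = x (Sum.inl (T.swapN ν μ, b)) := by
  simp [SignedSymm.act, swapS, h]

theorem swapN_ne {μ ν : T.toShape.N} (h : μ ≠ ν) : T.swapN ν μ ≠ ν := fun h' =>
  h (by rw [← T.swapN_swapN ν μ, h', swapN_self])

theorem swapS_swapS (ν : T.toShape.N) (x : T.toShape.Crd → ℤ) :
    (swapS T ν).act ((swapS T ν).act x) = x := by
  funext c
  rcases c with ⟨μ, b⟩ | ⟨j, l⟩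
  · by_cases h : μ = ν
    · subst h
      rw [swapS_same, swapS_same, _root_.neg_neg]
    · rw [swapS_ne h, swapS_ne (swapN_ne h), swapN_swapN]
  · rw [swapS_inr, swapS_inr, swapL_swapL]

theorem state_swapS_ne {μ ν : T.toShape.N} (h : μ ≠ ν) (x : T.toShape.Crd → ℤ) :
    state ((swapS T ν).act x) μ = state x (T.swapN ν μ) := by
  simp only [state, swapS_ne h]

theorem state_swapS_same {R : ℤ} (hR : 0 < R) {x : T.toShape.Crd → ℤ}
    (hx : x ∈ Box T.toShape.fib R) (ν : T.toShape.N) :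
    (state ((swapS T ν).act x) ν).1 = !(state x ν).1 := by
  simp only [state, swapS_same]
  have h := node_ne hR hx ν
  rw [Bool.eq_iff_iff]
  simp only [decide_eq_true_eq, Bool.not_eq_true', decide_eq_false_iff_not]
  omega

theorem signs_swapS (R : ℤ) (ν : T.toShape.N) (x : T.toShape.Crd → ℤ) (k : Fin 3) :
    signs R ((swapS T ν).act x) k = fun l => signs R x k (T.swapL ν l) := by
  funext l
  simp only [signs, swapS_inr]

theorem sgm_swapS {R : ℤ} (hR : 0 < R) {x : T.toShape.Crd → ℤ}
    (hx : x ∈ Box T.toShape.fib R) (ν : T.toShape.N) (k : Fin 3) :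
    sgm R k ((swapS T ν).act x) = sgm R k x := by
  unfold sgm
  rw [signs_swapS]
  exact lead_swap T ν 0 (fun μ hμ => by rw [state_swapS_ne hμ]) (state_swapS_same hR hx ν) _

theorem swapS_fix {R : ℤ} (hR : 0 < R) {x : T.toShape.Crd → ℤ}
    (hx : x ∈ Box T.toShape.fib R) (ν : T.toShape.N) : (swapS T ν).act x ≠ x := by
  intro h
  have := state_swapS_same hR hx ν
  rw [h] at this
  cases h : (state x ν).1 <;> simp [h] at this

end SymTree

/-- Factors with the same behaviour under a family of free involutions may be exchanged. -/
theorem SignedSymm.sum_prod_replace {X K : Type} [Fintype X] [Fintype K] [DecidableEq K]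
    {S : Finset X} {γ : K → X → X} {f : X → ZMod 2} {m m' : K → X → ZMod 2}
    (h1 : ∀ k, ∀ x ∈ S, γ k x ∈ S) (h2 : ∀ k, ∀ x ∈ S, γ k (γ k x) = x)
    (h3 : ∀ k, ∀ x ∈ S, γ k x ≠ x) (h4 : ∀ k, ∀ x ∈ S, f (γ k x) = f x)
    (h5 : ∀ k j, ∀ x ∈ S, m j (γ k x) = m j x + if j = k then 1 else 0)
    (h6 : ∀ k j, ∀ x ∈ S, m' j (γ k x) = m' j x + if j = k then 1 else 0) :
    ∑ x ∈ S, f x * ∏ j, m j x = ∑ x ∈ S, f x * ∏ j, m' j x := by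
  suffices H : ∀ U : Finset K, ∑ x ∈ S, f x * ∏ j, m j x =
      ∑ x ∈ S, f x * ∏ j, (if j ∈ U then m' j x else m j x) by
    simpa using H Finset.univ
  intro U
  induction U using Finset.induction_on with
  | empty => simp
  | insert k U hk ih =>
    rw [ih, ← CharTwo.add_eq_zero, ← Finset.sum_add_distrib]
    have e : ∀ x, f x * ∏ j, (if j ∈ U then m' j x else m j x) +
        f x * ∏ j, (if j ∈ insert k U then m' j x else m j x) =
        f x * ((m k x + m' k x) * ∏ j ∈ Finset.univ.erase k, if j ∈ U then m' j x else m j x) := by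
      intro x
      rw [← Finset.mul_prod_erase _ _ (Finset.mem_univ k),
        ← Finset.mul_prod_erase _ (fun j => if j ∈ insert k U then m' j x else m j x)
          (Finset.mem_univ k), if_neg hk, if_pos (Finset.mem_insert_self _ _)]
      have : ∏ j ∈ Finset.univ.erase k, (if j ∈ insert k U then m' j x else m j x) =
          ∏ j ∈ Finset.univ.erase k, if j ∈ U then m' j x else m j x := by
        refine Finset.prod_congr rfl fun j hj => ?_
        simp only [Finset.mem_insert, or_iff_right (Finset.ne_of_mem_erase hj)]
      rw [this]
      ring
    simp only [e]
    refine sum_eq_zero (h1 k) (h2 k) (h3 k) fun x hx => ?_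
    rw [h4 k x hx, h5 k k x hx, h6 k k x hx, if_pos rfl]
    congr 2
    · rw [add_add_add_comm, CharTwo.add_self_eq_zero, add_zero]
    · refine Finset.prod_congr rfl fun j hj => ?_
      rw [h5 k j x hx, h6 k j x hx, if_neg (Finset.ne_of_mem_erase hj), add_zero, add_zero]

namespace SymTree

open Shape Box SignedSymm

variable {T : SymTree} {R : ℤ}

/-- The weight defining the evaluation, without the parity condition. -/
noncomputable def core (T : SymTree) (R : ℤ) (x : T.toShape.Crd → ℤ) : ZMod 2 :=
  (∏ ν, (1 + bit (state x ν).1)) * ∏ k, (1 + sgm R k x)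

open Classical in
/-- The weight defining the evaluation. -/
noncomputable def rho (T : SymTree) (R : ℤ) (x : Box T.toShape.fib R) : ZMod 2 :=
  if ∀ c, Even (x.1 c) then core T R x.1 else 0

theorem ext_rho_of_not {z : T.toShape.Crd → ℤ} (c) (h : ¬ Even (z c)) : ext (rho T R) z = 0 := by
  by_cases hz : z ∈ Box T.toShape.fib R
  · rw [ext_mem _ hz]
    exact if_neg fun h' => h (h' c)
  · exact ext_notMem _ hz

/-- The points with a single odd coordinate. -/
noncomputable def odds (T : SymTree) (R : ℤ) (c : T.toShape.Crd) : Finset (Box T.toShape.fib R) := by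
  classical
  exact Finset.univ.filter fun y => ¬ Even (y.1 c) ∧ ∀ d, d ≠ c → Even (y.1 d)

theorem mem_odds {c : T.toShape.Crd} {y : Box T.toShape.fib R} :
    y ∈ odds T R c ↔ ¬ Even (y.1 c) ∧ ∀ d, d ≠ c → Even (y.1 d) := by
  classical
  simp [odds]

theorem odds_step (hR : Even R) {c : T.toShape.Crd} {y : Box T.toShape.fib R} (hy : y ∈ odds T R c)
    (v : ℤˣ) : y.1 + Pi.single c (v : ℤ) ∈ Box T.toShape.fib R := by
  rw [mem_odds] at hy
  have hlt : ∀ d, |y.1 d| = R → d ≠ c := by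
    rintro d h rfl
    exact hy.1 (even_of_abs hR h)
  refine ⟨fun d => ?_, fun φ => ?_⟩
  · by_cases h : d = c
    · subst h
      rw [step_same]
      have h1 := y.2.1 d
      have h2 : |y.1 d| ≠ R := fun h => hlt d h rfl
      have h3 : |y.1 d + v| ≤ |y.1 d| + 1 := (abs_add_le _ _).trans (by
        rcases Int.units_eq_one_or v with rfl | rfl <;> simp)
      omega
    · rw [step_ne _ h]
      exact y.2.1 d
  · obtain ⟨d, h1, h2⟩ := y.2.2 φ
    exact ⟨d, h1, by rw [step_ne _ (hlt d h2), h2]⟩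

theorem ext_rho_odds (hR : Even R) {c : T.toShape.Crd} {y : Box T.toShape.fib R}
    (hy : y ∈ odds T R c) (v : ℤˣ) :
    ext (rho T R) (y.1 + Pi.single c (v : ℤ)) = core T R (y.1 + Pi.single c (v : ℤ)) := by
  rw [ext_mem _ (odds_step hR hy v)]
  rw [mem_odds] at hy
  refine if_pos fun d => ?_
  by_cases h : d = c
  · subst h
    change Even ((y.1 + Pi.single d (v : ℤ) : T.toShape.Crd → ℤ) d)
    rw [step_same]
    rcases Int.units_eq_one_or v with rfl | rfl
    · exact Int.even_add_one.2 hy.1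
    · exact (Int.not_even_iff_odd.1 hy.1).add_odd (by decide)
  · change Even ((y.1 + Pi.single c (v : ℤ) : T.toShape.Crd → ℤ) d)
    rw [step_ne _ h]
    exact hy.2 d h

theorem sum_rho_cob (hR : Even R) (f : Box T.toShape.fib R → ZMod 2) :
    ∑ x, rho T R x * cob f x = ∑ c, ∑ y ∈ odds T R c, f y * (core T R (y.1 + Pi.single c 1) +
      core T R (y.1 + Pi.single c (-1))) := by
  have h1 : ∀ x, rho T R x * cob f x =
      ∑ p : T.toShape.Crd × ℤˣ, rho T R x * ext f (x.1 + Pi.single p.1 (p.2 : ℤ)) := by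
    intro x
    rw [cob_apply, Finset.mul_sum]
    refine Finset.sum_congr rfl fun p _ => ?_
    split_ifs with h
    · rfl
    · have : rho T R x = 0 := if_neg fun h' => h (h' _)
      rw [this, zero_mul, zero_mul]
  simp only [h1]
  rw [Finset.sum_comm, Fintype.sum_prod_type]
  refine Finset.sum_congr rfl fun c _ => ?_
  simp only [sum_ext]
  rw [UnitsInt.univ, Finset.sum_pair (by decide), ← Finset.sum_add_distrib]
  have hs : ∀ (y : T.toShape.Crd → ℤ) (v : ℤ), y - Pi.single c v = y + Pi.single c (-v) := by
    intro y v
    rw [Pi.single_neg, sub_eq_add_neg]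
  simp only [hs, Units.val_one, Units.val_neg, _root_.neg_neg]
  rw [← Finset.sum_subset (Finset.subset_univ (odds T R c))]
  · refine Finset.sum_congr rfl fun y hy => ?_
    have e1 := ext_rho_odds hR hy 1
    have e2 := ext_rho_odds hR hy (-1)
    rw [Units.val_one] at e1
    rw [Units.val_neg, Units.val_one] at e2
    rw [e1, e2]
    ring
  · intro y _ hy
    have h0 : ∀ v : ℤˣ, ext (rho T R) (y.1 + Pi.single c (v : ℤ)) = 0 := by
      intro v
      by_cases h : Even (y.1 c)
      · exact ext_rho_of_not c (by rw [step_same]; exact not_even_add h v)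
      · rw [mem_odds] at hy
        push Not at hy
        obtain ⟨d, hd, h'⟩ := hy h
        exact ext_rho_of_not d (by rw [step_ne _ hd]; exact h')
    have e1 := h0 1
    have e2 := h0 (-1)
    rw [Units.val_one] at e1
    rw [Units.val_neg, Units.val_one] at e2
    rw [e1, e2]
    simp

theorem odds_map {g : SignedSymm T.toShape.fib} {c : T.toShape.Crd} (hc : g.perm c = c)
    {y : Box T.toShape.fib R} (hy : y ∈ odds T R c) : g.map y ∈ odds T R c := by
  rw [mem_odds] at hy ⊢
  refine ⟨?_, fun d hd => ?_⟩
  · change ¬ Even (g.act y.1 c)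
    rw [even_act, hc]
    exact hy.1
  · change Even (g.act y.1 d)
    rw [even_act]
    exact hy.2 _ fun h => hd (g.perm.injective (h.trans hc.symm))

theorem act_step {g : SignedSymm T.toShape.fib} {c : T.toShape.Crd} (hc : g.perm c = c)
    (hs : g.sign c = -1) (y : T.toShape.Crd → ℤ) (v : ℤ) :
    g.act y + Pi.single c v = g.act (y + Pi.single c (-v)) := by
  rw [act_add]
  have := g.act_single c (-v)
  rw [hc, hs] at this
  rw [this]
  simp

theorem sum_odds_inr (hR : Even R) (hR0 : 0 < R) {f : Box T.toShape.fib R → ZMod 2}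
    (hf : ∀ k y, f ((negS T.toShape k).map y) = f y) (k : Fin 3) (l) :
    ∑ y ∈ odds T R (Sum.inr (k, l)), f y * (core T R (y.1 + Pi.single (Sum.inr (k, l)) 1) +
      core T R (y.1 + Pi.single (Sum.inr (k, l)) (-1))) = 0 := by
  have hp : (negS T.toShape k).perm (Sum.inr (k, l)) = Sum.inr (k, l) := rfl
  have hs : (negS T.toShape k).sign (Sum.inr (k, l)) = -1 := if_pos rfl
  refine sum_eq_zero (γ := (negS T.toShape k).map) (fun y hy => odds_map hp hy)
    (fun y _ => Subtype.ext (negS_negS k y.1))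
    (fun y _ h => negS_fix hR0 y.2 k (congrArg Subtype.val h)) fun y hy => ?_
  rw [hf]
  congr 1
  change core T R ((negS T.toShape k).act y.1 + _) + core T R ((negS T.toShape k).act y.1 + _) = _
  rw [act_step hp hs, act_step hp hs, _root_.neg_neg]
  have hstep : ∀ v : ℤˣ, core T R ((negS T.toShape k).act (y.1 + Pi.single (Sum.inr (k, l)) (v : ℤ)))
      + core T R (y.1 + Pi.single (Sum.inr (k, l)) (v : ℤ)) =
      (∏ ν, (1 + bit (state y.1 ν).1)) * ∏ j ∈ Finset.univ.erase k, (1 + sgm R j y.1) := by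
    intro v
    have hm := odds_step hR hy v
    unfold core
    rw [state_negS, state_step_inr, ← mul_add, ← Finset.mul_prod_erase _ _ (Finset.mem_univ k),
      ← Finset.mul_prod_erase _ (fun j => 1 + sgm R j (y.1 + _)) (Finset.mem_univ k),
      sgm_negS hR0 hm, if_pos rfl]
    have h1 : ∀ j ∈ Finset.univ.erase k, 1 + sgm R j (y.1 + Pi.single (Sum.inr (k, l)) (v : ℤ)) =
        1 + sgm R j y.1 := by
      intro j hj
      unfold sgm
      rw [state_step_inr, signs_step_ne _ (Finset.ne_of_mem_erase hj)]
    have h2 : ∀ j ∈ Finset.univ.erase k, 1 + sgm R j ((negS T.toShape k).act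
        (y.1 + Pi.single (Sum.inr (k, l)) (v : ℤ))) = 1 + sgm R j y.1 := by
      intro j hj
      rw [sgm_negS hR0 hm, if_neg (Finset.ne_of_mem_erase hj), add_zero, h1 j hj]
    rw [Finset.prod_congr rfl h1, Finset.prod_congr rfl h2, ← add_mul]
    congr 1
    have : ∀ a P : ZMod 2, (1 + (a + 1) + (1 + a)) * P = P := by decide
    exact this _ _
  have e1 := hstep 1
  have e2 := hstep (-1)
  rw [Units.val_one] at e1
  rw [Units.val_neg, Units.val_one] at e2
  have := e1.trans e2.symm
  revert this
  generalize core T R _ = a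
  generalize core T R _ = b
  generalize core T R _ = c
  generalize core T R _ = d
  revert a b c d
  decide

theorem core_inl (y : T.toShape.Crd → ℤ) (ν : T.toShape.N) (b v) :
    core T R (y + Pi.single (Sum.inl (ν, b)) v) =
      (∏ μ ∈ Finset.univ.erase ν, (1 + bit (state y μ).1)) *
      (1 + bit (state (y + Pi.single (Sum.inl (ν, b)) v) ν).1) *
      ∏ k, (1 + T.toShape.lead 0 (Function.update (state y) ν (false, false)) (signs R y k)) := by
  unfold core
  rw [← Finset.mul_prod_erase _ _ (Finset.mem_univ ν)]
  have h1 : ∀ μ ∈ Finset.univ.erase ν,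
      1 + bit (state (y + Pi.single (Sum.inl (ν, b)) v) μ).1 = 1 + bit (state y μ).1 := by
    intro μ hμ
    rw [state_step_ne _ (Finset.ne_of_mem_erase hμ)]
  rw [Finset.prod_congr rfl h1]
  rcases h : (state (y + Pi.single (Sum.inl (ν, b)) v) ν).1 with _ | _
  · have h2 : ∀ k, 1 + sgm R k (y + Pi.single (Sum.inl (ν, b)) v) =
        1 + T.toShape.lead 0 (Function.update (state y) ν (false, false)) (signs R y k) := by
      intro k
      unfold sgm
      rw [signs_step_inl]
      congr 1
      refine lead_congr _ _ (fun μ => ?_) _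
      by_cases hμ : μ = ν
      · subst hμ
        rw [h, Function.update_self]
      · rw [state_step_ne _ hμ, Function.update_of_ne hμ]
    simp only [h2]
    ring
  · have : 1 + bit true = 0 := by decide
    rw [h, this]
    ring

theorem sum_odds_inl (hR : Even R) (hR0 : 0 < R) {f : Box T.toShape.fib R → ZMod 2}
    (hf : ∀ k y, f ((negS T.toShape k).map y) = f y)
    (hf' : ∀ ν y, f ((swapS T ν).map y) = f y) (ν : T.toShape.N) (b) :
    ∑ y ∈ odds T R (Sum.inl (ν, b)), f y * (core T R (y.1 + Pi.single (Sum.inl (ν, b)) 1) +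
      core T R (y.1 + Pi.single (Sum.inl (ν, b)) (-1))) = 0 := by
  let P : (T.toShape.Crd → ℤ) → ZMod 2 := fun y =>
    bit (state (y + Pi.single (Sum.inl (ν, b)) 1) ν).1 +
      bit (state (y + Pi.single (Sum.inl (ν, b)) (-1)) ν).1
  let A : (T.toShape.Crd → ℤ) → ZMod 2 := fun y =>
    ∏ μ ∈ Finset.univ.erase ν, (1 + bit (state y μ).1)
  have e : ∀ y : Box T.toShape.fib R, f y * (core T R (y.1 + Pi.single (Sum.inl (ν, b)) 1) +
      core T R (y.1 + Pi.single (Sum.inl (ν, b)) (-1))) = (f y * (A y.1 * P y.1)) *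
        ∏ k, (1 + T.toShape.lead 0 (Function.update (state y.1) ν (false, false))
          (signs R y.1 k)) := by
    intro y
    rw [core_inl, core_inl]
    change f y * (A y.1 * _ * _ + A y.1 * _ * _) = _
    rw [← add_mul, ← mul_add, add_add_add_comm, CharTwo.add_self_eq_zero, zero_add]
    ring
  simp only [e]
  have hp : ∀ k, (negS T.toShape k).perm (Sum.inl (ν, b)) = Sum.inl (ν, b) := fun _ => rfl
  rw [sum_prod_replace (γ := fun k => (negS T.toShape k).map)
    (m' := fun k y => 1 + sgm R k y.1) (fun k y hy => odds_map (hp k) hy)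
    (fun k y _ => Subtype.ext (negS_negS k y.1))
    (fun k y _ h => negS_fix hR0 y.2 k (congrArg Subtype.val h))]
  · have hp' : (swapS T ν).perm (Sum.inl (ν, b)) = Sum.inl (ν, b) := by
      simp [swapS, swapN_self]
    have hs' : (swapS T ν).sign (Sum.inl (ν, b)) = -1 := if_pos rfl
    refine sum_eq_zero (γ := (swapS T ν).map) (fun y hy => odds_map hp' hy)
      (fun y _ => Subtype.ext (swapS_swapS ν y.1))
      (fun y _ h => swapS_fix hR0 y.2 ν (congrArg Subtype.val h)) fun y hy => ?_
    rw [hf']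
    have h1 : ∀ k, sgm R k ((swapS T ν).map y).1 = sgm R k y.1 := fun k => sgm_swapS hR0 y.2 ν k
    have h2 : A ((swapS T ν).map y).1 = A y.1 := by
      refine Finset.prod_bij (fun μ _ => T.swapN ν μ) ?_ ?_ ?_ ?_
      · intro μ hμ
        exact Finset.mem_erase.2 ⟨swapN_ne (Finset.ne_of_mem_erase hμ), Finset.mem_univ _⟩
      · intro μ _ μ' _ h
        exact (T.swapN ν).injective h
      · intro μ hμ
        exact ⟨T.swapN ν μ, Finset.mem_erase.2 ⟨swapN_ne (Finset.ne_of_mem_erase hμ),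
          Finset.mem_univ _⟩, swapN_swapN _ _ _⟩
      · intro μ hμ
        rw [← state_swapS_ne (Finset.ne_of_mem_erase hμ)]
        rfl
    have h3 : P ((swapS T ν).map y).1 = P y.1 := by
      change bit (state ((swapS T ν).act y.1 + _) ν).1 + bit (state ((swapS T ν).act y.1 + _) ν).1 = _
      have m1 := odds_step hR hy 1
      have m2 := odds_step hR hy (-1)
      rw [Units.val_one] at m1
      rw [Units.val_neg, Units.val_one] at m2
      rw [act_step hp' hs', act_step hp' hs', _root_.neg_neg, state_swapS_same hR0 m1,
        state_swapS_same hR0 m2]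
      change _ = bit _ + bit _
      generalize (state _ ν).1 = a
      generalize (state _ ν).1 = b
      revert a b
      decide
    simp only [h1, h2, h3]
  · intro k y hy
    rw [hf]
    change f y * ((∏ μ ∈ _, (1 + bit (state ((negS T.toShape k).act y.1) μ).1)) *
      (bit (state ((negS T.toShape k).act y.1 + _) ν).1 +
        bit (state ((negS T.toShape k).act y.1 + _) ν).1)) = _
    have h1 : ∀ v : ℤ, (negS T.toShape k).act y.1 + Pi.single (Sum.inl (ν, b)) v =
        (negS T.toShape k).act (y.1 + Pi.single (Sum.inl (ν, b)) v) := by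
      intro v
      rw [act_add]
      have := (negS T.toShape k).act_single (Sum.inl (ν, b)) v
      rw [hp k] at this
      rw [this]
      simp [negS]
    rw [h1, h1, state_negS, state_negS, state_negS]
  · intro k j y hy
    change 1 + lead _ 0 (Function.update (state ((negS T.toShape k).act y.1)) _ _)
      (signs R ((negS T.toShape k).act y.1) j) = _
    rw [state_negS]
    split_ifs with h
    · subst h
      rw [signs_negS_same hR0, lead_neg_of_ne _ (signs_ne_emp y.2 _), add_assoc]
    · rw [signs_negS_ne R h, add_zero]
  · intro k j y hy
    change 1 + sgm R j ((negS T.toShape k).act y.1) = _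
    rw [sgm_negS hR0 y.2, add_assoc]

/-- The machine attached to a tree. -/
noncomputable def machine (T : SymTree) (hR : Even R) (hR0 : 0 < R) :
    Machine (Box T.toShape.fib R) where
  U := cob
  G := Set.range (fun k => (negS T.toShape k).map) ∪ Set.range (fun ν => (swapS T ν).map)
  e := coc
  r := ∑ x, rho T R x • LinearMap.proj x
  sq := cob_sq hR
  U_e := cob_coc hR hR0
  pull_e := by
    rintro _ (⟨k, rfl⟩ | ⟨ν, rfl⟩)
    · exact pull_coc _
    · exact pull_coc _
  pull_U := by
    rintro _ (⟨k, rfl⟩ | ⟨ν, rfl⟩)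
    · exact pull_cob _
    · exact pull_cob _
  r_U := by
    intro f hf
    have h := sum_rho_cob (T := T) hR f
    have h1 : ∀ k y, f ((negS T.toShape k).map y) = f y := fun k y =>
      congrFun (hf _ (Or.inl ⟨k, rfl⟩)) y
    have h2 : ∀ ν y, f ((swapS T ν).map y) = f y := fun ν y =>
      congrFun (hf _ (Or.inr ⟨ν, rfl⟩)) y
    simp only [LinearMap.sum_apply, LinearMap.smul_apply, LinearMap.proj_apply, smul_eq_mul]
    rw [h]
    refine Finset.sum_eq_zero fun c _ => ?_
    rcases c with ⟨ν, b⟩ | ⟨k, l⟩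
    · exact sum_odds_inl hR hR0 h1 h2 ν b
    · exact sum_odds_inr hR hR0 h1 k l

end SymTree

namespace Shape

open Box

variable {t : Shape} {R : ℤ}

/-- The step towards the interior. -/
def inw (x : t.Crd → ℤ) (c : t.Crd) : ℤ := if x c < 0 then 1 else -1

/-- The step changing the orientation of a vertex. -/
def tip (x : t.Crd → ℤ) (ν : t.N) : ℤ := if (state x ν).1 then 1 else -1

/-- The point obtained by moving an extremal coordinate of a family. -/
noncomputable def moveL (x : t.Crd → ℤ) (k : Fin 3) (l : t.L) : t.Crd → ℤ :=
  x + Pi.single (Sum.inr (k, l)) (inw x (Sum.inr (k, l)))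

/-- The point obtained by changing the orientation of a vertex. -/
noncomputable def moveN (x : t.Crd → ℤ) (ν : t.N) : t.Crd → ℤ :=
  x + Pi.single (Sum.inl (ν, false)) (tip x ν)

theorem signs_inr_of {x : t.Crd → ℤ} {k : Fin 3} {l : t.L} :
    signs R x k l ≠ none ↔ |x (Sum.inr (k, l))| = R := by
  unfold signs
  split_ifs with h <;> simp [h]

theorem signs_moveL (hR : 0 < R) {x : t.Crd → ℤ} {k : Fin 3} {l : t.L}
    (h : |x (Sum.inr (k, l))| = R) : signs R (moveL x k l) k = del (signs R x k) l := by
  funext i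
  by_cases hi : i = l
  · subst hi
    have h1 : |moveL x k i (Sum.inr (k, i))| ≠ R := by
      rw [moveL, step_same, inw]
      split_ifs with h0
      · rw [abs_of_neg h0] at h
        rw [abs_of_nonpos (by omega)]
        omega
      · rw [abs_of_nonneg (by omega)] at h
        rw [abs_of_nonneg (by omega)]
        omega
    rw [signs, if_neg h1, del, Function.update_self]
  · have h1 : moveL x k l (Sum.inr (k, i)) = x (Sum.inr (k, i)) :=
      step_ne _ (fun h => hi (Prod.ext_iff.1 (Sum.inr.inj h)).2) _
    rw [del, Function.update_of_ne hi, signs, signs, h1]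

theorem signs_inner (hR : Even R) {x : t.Crd → ℤ} {k : Fin 3} {l : t.L}
    (h : |x (Sum.inr (k, l))| ≠ R) (he : Even (x (Sum.inr (k, l)))) (v : ℤˣ) :
    signs R (x + Pi.single (Sum.inr (k, l)) (v : ℤ)) k = signs R x k := by
  funext i
  by_cases hi : i = l
  · subst hi
    have h1 : |(x + Pi.single (Sum.inr (k, i)) (v : ℤ) : t.Crd → ℤ) (Sum.inr (k, i))| ≠ R := by
      intro h'
      have := even_of_abs hR h'
      rw [step_same] at this
      exact not_even_add he v this
    rw [signs, signs, if_neg h1, if_neg h]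
  · have h1 : (x + Pi.single (Sum.inr (k, l)) (v : ℤ) : t.Crd → ℤ) (Sum.inr (k, i)) =
        x (Sum.inr (k, i)) := step_ne _ (fun h => hi (Prod.ext_iff.1 (Sum.inr.inj h)).2) _
    rw [signs, signs, h1]

theorem notMem_outward {x : t.Crd → ℤ} {c : t.Crd} (h : |x c| = R) :
    x + Pi.single c (-inw x c) ∉ Box t.fib R := by
  intro h'
  have := h'.1 c
  rw [step_same, inw] at this
  split_ifs at this with h0
  · rw [abs_of_neg h0] at h
    rw [abs_of_neg (by omega)] at this
    omega
  · rw [abs_of_nonneg (by omega)] at h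
    rw [abs_of_nonneg (by omega)] at this
    omega

theorem state_moveN {x : t.Crd → ℤ} {ν : t.N} (h : (state x ν).2 = true) :
    state (moveN x ν) = flip (state x) ν := by
  have h0 : x (Sum.inl (ν, false)) = 0 := of_decide_eq_true h
  funext μ
  by_cases hμ : μ = ν
  · subst hμ
    have e : moveN x μ (Sum.inl (μ, false)) = tip x μ := by rw [moveN, step_same, h0, zero_add]
    rw [flip, Function.update_self]
    unfold tip at e
    rcases ho : (state x μ).1 with _ | _
    · rw [ho, if_neg Bool.false_ne_true] at e
      simp [state, e]
    · rw [ho, if_pos rfl] at e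
      simp [state, e]
  · rw [flip, Function.update_of_ne hμ, moveN, state_step_ne _ hμ]

theorem orient_away {x : t.Crd → ℤ} {ν : t.N} (h : (state x ν).2 = true) (μ : t.N) :
    (state (x + Pi.single (Sum.inl (ν, false)) (-tip x ν)) μ).1 = (state x μ).1 := by
  have h0 : x (Sum.inl (ν, false)) = 0 := of_decide_eq_true h
  by_cases hμ : μ = ν
  · subst hμ
    have e : (x + Pi.single (Sum.inl (μ, false)) (-tip x μ) : t.Crd → ℤ) (Sum.inl (μ, false)) =
      -tip x μ := by rw [step_same, h0, zero_add]
    unfold tip at e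
    rcases ho : (state x μ).1 with _ | _
    · simp only [ho, if_neg Bool.false_ne_true] at e
      simp [state, tip, h0] at ho ⊢
      omega
    · simp only [ho, if_true] at e
      simp [state, tip, h0] at ho ⊢
      omega
  · rw [state_step_ne _ hμ]

theorem orient_inner (hR : 0 < R) {x : t.Crd → ℤ} (hx : x ∈ Box t.fib R) {ν : t.N} {b : Bool}
    (he : Even (x (Sum.inl (ν, b)))) (h : b = false → (state x ν).2 = false) (v : ℤˣ) (μ : t.N) :
    (state (x + Pi.single (Sum.inl (ν, b)) (v : ℤ)) μ).1 = (state x μ).1 := by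
  by_cases hμ : μ = ν
  · subst hμ
    have hn := node_ne hR hx μ
    have hv : (v : ℤ) = 1 ∨ (v : ℤ) = -1 := by
      rcases Int.units_eq_one_or v with rfl | rfl <;> simp
    cases b with
    | false =>
      have h0 : x (Sum.inl (μ, false)) ≠ 0 := of_decide_eq_false (h rfl)
      obtain ⟨q, hq⟩ := he
      simp only [state, step_same]
      rw [step_ne _ (by simp)]
      rw [Bool.eq_iff_iff, decide_eq_true_iff, decide_eq_true_iff]
      omega
    | true =>
      obtain ⟨q, hq⟩ := he
      simp only [state, step_same]
      rw [step_ne _ (by simp)]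
      rw [Bool.eq_iff_iff, decide_eq_true_iff, decide_eq_true_iff]
      omega
  · rw [state_step_ne _ hμ]

theorem comm_sgm (hR : Even R) (hR0 : 0 < R) (k : Fin 3) (f : Box t.fib R → ZMod 2)
    (x : Box t.fib R) :
    (mulOp (fun x : Box t.fib R => sgm R k x.1) * cob + cob * mulOp (fun x : Box t.fib R => sgm R k x.1) :
      Module.End (ZMod 2) (Box t.fib R → ZMod 2)) f x =
      ∑ l, (t.lead 0 (state x.1) (signs R x.1 k) +
          t.lead 0 (state x.1) (del (signs R x.1 k) l)) * ext f (moveL x.1 k l) +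
      ∑ ν, if (state x.1 ν).2 then (t.lead 0 (state x.1) (signs R x.1 k) +
          t.lead 0 (flip (state x.1) ν) (signs R x.1 k)) * ext f (moveN x.1 ν) else 0 := by
  have hext : ∀ z : t.Crd → ℤ, ext (fun x => sgm R k x.1 * f x) z = sgm R k z * ext f z := by
    intro z
    by_cases hz : z ∈ Box t.fib R
    · rw [ext_mem _ hz, ext_mem _ hz]
    · rw [ext_notMem _ hz, ext_notMem _ hz, mul_zero]
  let G : t.Crd → ℤ → ZMod 2 := fun c v =>
    (sgm R k x.1 + sgm R k (x.1 + Pi.single c v)) * ext f (x.1 + Pi.single c v)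
  have hG : ∀ c (v : ℤ), v = 1 ∨ v = -1 → ∑ w : ℤˣ, G c w = G c v + G c (-v) := by
    intro c v hv
    rw [UnitsInt.univ, Finset.sum_pair (by decide), Units.val_one, Units.val_neg, Units.val_one]
    rcases hv with rfl | rfl
    · rfl
    · rw [_root_.neg_neg, add_comm]
  have h1 : (mulOp (fun x : Box t.fib R => sgm R k x.1) * cob +
      cob * mulOp (fun x : Box t.fib R => sgm R k x.1) :
      Module.End (ZMod 2) (Box t.fib R → ZMod 2)) f x =
      ∑ c, if Even (x.1 c) then ∑ v : ℤˣ, G c v else 0 := by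
    change sgm R k x.1 * cob f x + cob (fun x => sgm R k x.1 * f x) x = _
    rw [cob_apply, cob_apply, Finset.mul_sum, ← Finset.sum_add_distrib, Fintype.sum_prod_type]
    refine Finset.sum_congr rfl fun c _ => ?_
    split_ifs with h
    · refine Finset.sum_congr rfl fun v _ => ?_
      rw [hext]
      ring
    · simp
  have hL : ∀ j l, (if Even (x.1 (Sum.inr (j, l))) then ∑ v : ℤˣ, G (Sum.inr (j, l)) v else 0) =
      if j = k then (t.lead 0 (state x.1) (signs R x.1 k) +
          t.lead 0 (state x.1) (del (signs R x.1 k) l)) * ext f (moveL x.1 k l) else 0 := by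
    intro j l
    by_cases hj : j = k
    · subst hj
      rw [if_pos rfl]
      by_cases h : |x.1 (Sum.inr (j, l))| = R
      · rw [if_pos (even_of_abs hR h), hG _ (inw x.1 (Sum.inr (j, l)))
          (by unfold inw; split_ifs <;> simp)]
        have : G (Sum.inr (j, l)) (-inw x.1 (Sum.inr (j, l))) = 0 := by
          change _ * ext f _ = 0
          rw [ext_notMem _ (notMem_outward h), mul_zero]
        rw [this, add_zero]
        change (sgm R j x.1 + t.lead 0 (state (x.1 + _)) (signs R (moveL x.1 j l) j)) * _ = _
        rw [signs_moveL hR0 h, state_step_inr]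
        rfl
      · have h' : signs R x.1 j l = none := by
          by_contra h'
          exact h (signs_inr_of.1 h')
        rw [del_of_none h', CharTwo.add_self_eq_zero, zero_mul]
        split_ifs with he
        · refine Finset.sum_eq_zero fun v _ => ?_
          change (t.lead 0 _ _ + t.lead 0 _ _) * _ = 0
          rw [signs_inner hR h he, state_step_inr, CharTwo.add_self_eq_zero, zero_mul]
        · rfl
    · rw [if_neg hj]
      split_ifs
      · refine Finset.sum_eq_zero fun v _ => ?_
        change (t.lead 0 _ _ + t.lead 0 _ _) * _ = 0
        rw [state_step_inr, signs_step_ne _ (Ne.symm hj), CharTwo.add_self_eq_zero, zero_mul]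
      · rfl
  have hN : ∀ ν b, (if Even (x.1 (Sum.inl (ν, b))) then ∑ v : ℤˣ, G (Sum.inl (ν, b)) v else 0) =
      if b = false then (if (state x.1 ν).2 then (t.lead 0 (state x.1) (signs R x.1 k) +
          t.lead 0 (flip (state x.1) ν) (signs R x.1 k)) * ext f (moveN x.1 ν) else 0) else 0 := by
    intro ν b
    have hz : ∀ v : ℤ, (∀ μ, (state (x.1 + Pi.single (Sum.inl (ν, b)) v) μ).1 = (state x.1 μ).1) →
        G (Sum.inl (ν, b)) v = 0 := by
      intro v h
      change (t.lead 0 _ _ + t.lead 0 _ _) * _ = 0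
      rw [signs_step_inl, SymTree.lead_congr t 0 h, CharTwo.add_self_eq_zero, zero_mul]
    by_cases hb : b = false ∧ (state x.1 ν).2 = true
    · obtain ⟨rfl, hs⟩ := hb
      have h0 : x.1 (Sum.inl (ν, false)) = 0 := of_decide_eq_true hs
      rw [if_pos rfl, if_pos hs, h0, if_pos Even.zero, hG _ (tip x.1 ν)
          (by unfold tip; split_ifs <;> simp), hz (-tip x.1 ν) (orient_away hs), add_zero]
      change (t.lead 0 _ _ + t.lead 0 (state (moveN x.1 ν)) _) * ext f (moveN x.1 ν) = _
      rw [signs_step_inl, state_moveN hs]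
    · have hb' : b = false → (state x.1 ν).2 = false := fun h => by
        rcases h' : (state x.1 ν).2 with _ | _
        · rfl
        · exact absurd ⟨h, h'⟩ hb
      have : (if b = false then (if (state x.1 ν).2 then (t.lead 0 (state x.1) (signs R x.1 k) +
          t.lead 0 (flip (state x.1) ν) (signs R x.1 k)) * ext f (moveN x.1 ν) else 0) else 0)
          = 0 := by
        split_ifs with h1 h2
        · exact absurd ⟨h1, h2⟩ hb
        · rfl
        · rfl
      rw [this]
      split_ifs with he
      · exact Finset.sum_eq_zero fun v _ => hz v (orient_inner hR0 x.2 he hb' v)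
      · rfl
  rw [h1, Fintype.sum_sum_type, Fintype.sum_prod_type, Fintype.sum_prod_type, add_comm]
  simp only [hL, hN]
  congr 1
  · rw [Finset.sum_comm]
    simp
  · refine Finset.sum_congr rfl fun ν _ => ?_
    rw [Fintype.sum_bool, if_neg (by decide), if_pos rfl, zero_add]

end Shape

namespace Shape

variable {t : Shape}

theorem Dh_sum {ι : Type} (I : Finset ι) (r : ι → ZMod 2) (f : ι → t.NS → t.LS → ZMod 2) :
    Dh t (fun s u => ∑ i ∈ I, r i * f i s u) = fun s u => ∑ i ∈ I, r i * Dh t (f i) s u := by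
  classical
  funext s u
  induction I using Finset.induction_on with
  | empty =>
    simp [Dh, D]
  | insert i I hi ih =>
    simp only [Finset.sum_insert hi]
    rw [← ih]
    unfold Dh D
    rw [mul_add, Finset.mul_sum, Finset.mul_sum, add_add_add_comm, ← Finset.sum_add_distrib,
      ← Finset.sum_add_distrib]
    congr 1
    · refine Finset.sum_congr rfl fun x _ => ?_
      dsimp only
      split_ifs <;> ring
    · refine Finset.sum_congr rfl fun x _ => ?_
      dsimp only
      by_cases h : u = t.emp
      · simp only [if_pos h]
        split_ifs <;> ring
      · simp only [if_neg h]
        split_ifs <;> ring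

theorem iterate_Dh_sum {ι : Type} (I : Finset ι) (r : ι → ZMod 2)
    (f : ι → t.NS → t.LS → ZMod 2) (a : ℕ) :
    (Dh t)^[a] (fun s u => ∑ i ∈ I, r i * f i s u) =
      fun s u => ∑ i ∈ I, r i * (Dh t)^[a] (f i) s u := by
  induction a generalizing f with
  | zero => rfl
  | succ a ih =>
    rw [Function.iterate_succ_apply, Dh_sum, ih]
    rfl

theorem iterate_Dh_mul (r : ZMod 2) (f : t.NS → t.LS → ZMod 2) (a : ℕ) :
    (Dh t)^[a] (fun s u => r * f s u) = fun s u => r * (Dh t)^[a] f s u := by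
  have := iterate_Dh_sum (Finset.univ : Finset Unit) (fun _ => r) (fun _ => f) a
  simpa using this

/-- The operator `Dh` acting on one of three families. -/
noncomputable def DK (k : Fin 3) (f : t.NS → (Fin 3 → t.LS) → ZMod 2) (s : t.NS)
    (u : Fin 3 → t.LS) : ZMod 2 :=
  Dh t (fun s' w => f s' (Function.update u k w)) s (u k)

/-- The product of the operators `DK` along a list. -/
noncomputable def cword (l : List (Fin 3)) (f : t.NS → (Fin 3 → t.LS) → ZMod 2) :
    t.NS → (Fin 3 → t.LS) → ZMod 2 := l.foldr DK f

theorem cword_replicate (a : ℕ) (k : Fin 3) (f : t.NS → (Fin 3 → t.LS) → ZMod 2) (s : t.NS)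
    (u : Fin 3 → t.LS) : cword (List.replicate a k) f s u =
      (Dh t)^[a] (fun s' w => f s' (Function.update u k w)) s (u k) := by
  induction a generalizing s u with
  | zero => simp [cword]
  | succ a ih =>
    rw [Function.iterate_succ_apply']
    change Dh t (fun s' w => cword (List.replicate a k) f s' (Function.update u k w)) s (u k) = _
    simp only [ih, Function.update_idem, Function.update_self]

/-- The coarse form of the distinguished cocycle. -/
noncomputable def ecoarse (s : t.NS) (u : Fin 3 → t.LS) : ZMod 2 :=
  if nf s = 0 ∧ ∀ k, ns (u k) = 1 then 1 else 0

theorem ecoarse_update (s : t.NS) (u : Fin 3 → t.LS) (w0 w1 w2 : t.LS) :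
    ecoarse s (Function.update (Function.update (Function.update u 0 w0) 1 w1) 2 w2) =
      (if ns w0 = 1 then 1 else 0) * ((if ns w1 = 1 then 1 else 0) *
        one (fun s => if nf s = 0 then 1 else 0) s w2) := by
  unfold ecoarse one
  have h0 : Function.update (Function.update (Function.update u 0 w0) 1 w1) 2 w2 0 = w0 := by
    simp
  have h1 : Function.update (Function.update (Function.update u 0 w0) 1 w1) 2 w2 1 = w1 := by
    simp
  have h2 : Function.update (Function.update (Function.update u 0 w0) 1 w1) 2 w2 2 = w2 := by
    simp
  simp only [Fin.forall_fin_succ, Fin.succ_zero_eq_one, Fin.succ_one_eq_two, h0, h1, h2,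
    IsEmpty.forall_iff, and_true]
  split_ifs <;> first | rfl | (exfalso; tauto)

theorem sum_fin_three {α : Type} [Fintype α] (g : (Fin 3 → α) → ZMod 2) :
    ∑ v, g v = ∑ a, ∑ b, ∑ c, g ![a, b, c] := by
  rw [← Fintype.sum_prod_type', ← Fintype.sum_prod_type (f := fun p : (α × α) × α => g ![p.1.1, p.1.2, p.2])]
  refine Fintype.sum_equiv
    { toFun := fun v => ((v 0, v 1), v 2)
      invFun := fun p => ![p.1.1, p.1.2, p.2]
      left_inv := fun v => by
        funext i
        fin_cases i <;> rfl
      right_inv := fun p => rfl } _ _ fun v => ?_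
  congr 1
  funext i
  fin_cases i <;> rfl

/-- The coarse form of the evaluation. -/
theorem sum_cword (a b c : ℕ) :
    ∑ v : Fin 3 → t.L → Bool, (∏ k, (1 + t.lead 0 (fun _ => (false, true)) (ful (v k)))) *
      cword (List.replicate a 0 ++ List.replicate b 1 ++ List.replicate c 2) ecoarse
        (fun _ => (false, true)) (fun k => ful (v k)) = Q3 t a b c := by
  let s0 : t.NS := fun _ => (false, true)
  let lam : (t.L → Bool) → ZMod 2 := fun v => 1 + t.lead 0 s0 (ful v)
  let g0 : t.NS → ZMod 2 := fun s => if nf s = 0 then 1 else 0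
  have e : ∀ u : Fin 3 → t.LS, cword (List.replicate a 0 ++ List.replicate b 1 ++
      List.replicate c 2) ecoarse s0 u = (Dh t)^[a] (fun s w0 => (if ns w0 = 1 then 1 else 0) *
        (Dh t)^[b] (fun s w1 => (if ns w1 = 1 then 1 else 0) * (Dh t)^[c] (one g0) s (u 2))
          s (u 1)) s0 (u 0) := by
    intro u
    have : cword (List.replicate a 0 ++ List.replicate b 1 ++ List.replicate c 2) ecoarse s0 u =
        cword (List.replicate a 0) (cword (List.replicate b 1) (cword (List.replicate c 2)
          ecoarse)) s0 u := by
      simp only [cword, List.foldr_append]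
    rw [this]
    simp only [cword_replicate, ecoarse_update, iterate_Dh_mul]
    rfl
  have push : ∀ (a : ℕ) (H : (t.L → Bool) → t.NS → ZMod 2) (s : t.NS) (w : t.LS),
      ∑ v, lam v * (Dh t)^[a] (fun s w => (if ns w = 1 then 1 else 0) * H v s) s w =
        (Dh t)^[a] (one fun s => ∑ v, lam v * H v s) s w := by
    intro a H s w
    refine (congrFun (congrFun (iterate_Dh_sum Finset.univ lam _ a) s) w).symm.trans ?_
    have e1 : (fun (s : t.NS) (w : t.LS) => ∑ v, lam v * ((if ns w = 1 then 1 else 0) * H v s)) =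
        one (fun s => ∑ v, lam v * H v s) := by
      funext s w
      unfold one
      split_ifs <;> simp
    rw [e1]
  rw [sum_fin_three]
  have hW : ∀ (a : ℕ) (g : t.NS → ZMod 2) (s : t.NS),
      ∑ v, lam v * (Dh t)^[a] (one g) s (ful v) = W t a g s := fun a g s => W_base s s0 a g
  have hone : ∀ (g : t.NS → ZMod 2),
      (fun (s : t.NS) (w : t.LS) => (if ns w = 1 then 1 else 0) * g s) = one g := by
    intro g
    funext s w
    simp [one]
  have h : ∀ v0 v1 v2 : t.L → Bool, (∏ k, (1 + t.lead 0 (fun _ => (false, true))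
      (ful ((![v0, v1, v2] : Fin 3 → t.L → Bool) k)))) *
      cword (List.replicate a 0 ++ List.replicate b 1 ++ List.replicate c 2) ecoarse
        (fun _ => (false, true)) (fun k => ful ((![v0, v1, v2] : Fin 3 → t.L → Bool) k)) =
      lam v0 * (lam v1 * (lam v2 * (Dh t)^[a] (fun s w0 => (if ns w0 = 1 then 1 else 0) *
        (Dh t)^[b] (fun s w1 => (if ns w1 = 1 then 1 else 0) * (Dh t)^[c] (one g0) s (ful v2))
          s (ful v1)) s0 (ful v0))) := by
    intro v0 v1 v2
    rw [e, Fin.prod_univ_three]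
    exact (mul_assoc _ _ _).trans (mul_assoc _ _ _)
  simp only [h, ← Finset.mul_sum]
  have e2 : ∀ v0 v1 : t.L → Bool, ∑ v2, lam v2 * (Dh t)^[a] (fun s w0 =>
      (if ns w0 = 1 then 1 else 0) * (Dh t)^[b] (fun s w1 => (if ns w1 = 1 then 1 else 0) *
        (Dh t)^[c] (one g0) s (ful v2)) s (ful v1)) s0 (ful v0) =
      (Dh t)^[a] (fun s w0 => (if ns w0 = 1 then 1 else 0) *
        (Dh t)^[b] (one (W t c g0)) s (ful v1)) s0 (ful v0) := by
    intro v0 v1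
    rw [push a (fun v2 s => (Dh t)^[b] (fun s w1 => (if ns w1 = 1 then 1 else 0) *
        (Dh t)^[c] (one g0) s (ful v2)) s (ful v1)) s0 (ful v0), hone]
    have e3 : (fun s => ∑ v2, lam v2 * (Dh t)^[b] (fun s w1 => (if ns w1 = 1 then 1 else 0) *
        (Dh t)^[c] (one g0) s (ful v2)) s (ful v1)) =
        fun s => (Dh t)^[b] (one (W t c g0)) s (ful v1) := by
      funext s
      rw [push b (fun v2 s => (Dh t)^[c] (one g0) s (ful v2)) s (ful v1)]
      simp only [hW]
    rw [e3]
  simp only [e2]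
  have e3 : ∀ v0 : t.L → Bool, ∑ v1, lam v1 * (Dh t)^[a] (fun s w0 =>
      (if ns w0 = 1 then 1 else 0) * (Dh t)^[b] (one (W t c g0)) s (ful v1)) s0 (ful v0) =
      (Dh t)^[a] (one (W t b (W t c g0))) s0 (ful v0) := by
    intro v0
    rw [push a (fun v1 s => (Dh t)^[b] (one (W t c g0)) s (ful v1)) s0 (ful v0)]
    simp only [hW]
  simp only [e3, hW]
  rfl

end Shape

namespace Shape

open Box

variable {t : Shape} {R : ℤ}

/-- The points close to the vertices of the cubes. -/
def Near (R : ℤ) (x : t.Crd → ℤ) : Prop :=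
  (∀ ν, |x (Sum.inl (ν, true))| = R ∧ |x (Sum.inl (ν, false))| ≤ 1) ∧
    ∀ c, |x (Sum.inr c)| = R ∨ |x (Sum.inr c)| = R - 1

theorem abs_add_inw (hR : 0 < R) {x : t.Crd → ℤ} {c : t.Crd} (h : |x c| = R) :
    |x c + inw x c| = R - 1 := by
  rw [inw]
  split_ifs with h0
  · rw [abs_of_neg h0] at h
    rw [abs_of_nonpos (by omega)]
    omega
  · rw [abs_of_nonneg (by omega)] at h
    rw [abs_of_nonneg (by omega)]
    omega

theorem moveL_mem (hR : 0 < R) {x : t.Crd → ℤ} (hx : x ∈ Box t.fib R) {k : Fin 3} {l : t.L}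
    (h : |x (Sum.inr (k, l))| = R) :
    moveL x k l ∈ Box t.fib R ↔ del (signs R x k) l ≠ t.emp := by
  rw [← signs_moveL hR h]
  refine ⟨fun h' => signs_ne_emp h' k, fun h' => ⟨fun c => ?_, fun φ => ?_⟩⟩
  · by_cases hc : c = Sum.inr (k, l)
    · subst hc
      rw [moveL, step_same, abs_add_inw hR h]
      omega
    · rw [moveL, step_ne _ hc]
      exact hx.1 c
  · by_cases hφ : φ = Sum.inr k
    · subst hφ
      obtain ⟨l', hl'⟩ := Function.ne_iff.1 h'
      exact ⟨Sum.inr (k, l'), rfl, signs_inr_of.1 hl'⟩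
    · obtain ⟨c, h1, h2⟩ := hx.2 φ
      refine ⟨c, h1, ?_⟩
      rw [moveL, step_ne _ _, h2]
      rintro rfl
      exact hφ h1.symm

theorem moveN_mem (hR : 0 < R) {x : t.Crd → ℤ} (hx : x ∈ Box t.fib R) {ν : t.N}
    (h : (state x ν).2 = true) : moveN x ν ∈ Box t.fib R := by
  have h0 : x (Sum.inl (ν, false)) = 0 := of_decide_eq_true h
  refine ⟨fun c => ?_, fun φ => ?_⟩
  · by_cases hc : c = Sum.inl (ν, false)
    · subst hc
      rw [moveN, step_same, h0, tip]
      split_ifs <;> simp <;> omega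
    · rw [moveN, step_ne _ hc]
      exact hx.1 c
  · obtain ⟨c, h1, h2⟩ := hx.2 φ
    refine ⟨c, h1, ?_⟩
    rw [moveN, step_ne _ _, h2]
    rintro rfl
    rw [h0, abs_zero] at h2
    omega

theorem Near.moveL (hR : 0 < R) {x : t.Crd → ℤ} (hx : Near R x) {k : Fin 3} {l : t.L}
    (h : |x (Sum.inr (k, l))| = R) : Near R (moveL x k l) := by
  refine ⟨fun ν => ?_, fun c => ?_⟩
  · rw [Shape.moveL, step_ne _ (by simp), step_ne _ (by simp)]
    exact hx.1 ν
  · by_cases hc : c = (k, l)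
    · subst hc
      right
      rw [Shape.moveL, step_same, abs_add_inw hR h]
    · rw [Shape.moveL, step_ne _ (by simpa using hc)]
      exact hx.2 c

theorem Near.moveN {x : t.Crd → ℤ} (hx : Near R x) {ν : t.N}
    (h : (state x ν).2 = true) : Near R (moveN x ν) := by
  have h0 : x (Sum.inl (ν, false)) = 0 := of_decide_eq_true h
  refine ⟨fun μ => ⟨?_, ?_⟩, fun c => ?_⟩
  · rw [Shape.moveN, step_ne _ (by simp)]
    exact (hx.1 μ).1
  · by_cases hμ : μ = ν
    · subst hμ
      rw [Shape.moveN, step_same, h0, tip]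
      split_ifs <;> simp
    · rw [Shape.moveN, step_ne _ (by simpa using hμ)]
      exact (hx.1 μ).2
  · rw [Shape.moveN, step_ne _ (by simp)]
    exact hx.2 c

theorem signs_moveL_update (hR : 0 < R) {x : t.Crd → ℤ} {k : Fin 3} {l : t.L}
    (h : |x (Sum.inr (k, l))| = R) : signs R (moveL x k l) =
      Function.update (signs R x) k (del (signs R x k) l) := by
  funext j
  by_cases hj : j = k
  · subst hj
    rw [Function.update_self, signs_moveL hR h]
  · rw [Function.update_of_ne hj]
    exact signs_step_ne _ hj _ _

theorem comm_sgm_near (hR : Even R) (hR0 : 0 < R) (k : Fin 3) {f : Box t.fib R → ZMod 2}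
    {g : t.NS → (Fin 3 → t.LS) → ZMod 2}
    (hf : ∀ y : Box t.fib R, Near R y.1 → f y = g (state y.1) (signs R y.1))
    (x : Box t.fib R) (hx : Near R x.1) :
    (mulOp (fun x : Box t.fib R => sgm R k x.1) * cob + cob * mulOp (fun x : Box t.fib R => sgm R k x.1) :
      Module.End (ZMod 2) (Box t.fib R → ZMod 2)) f x = DK k g (state x.1) (signs R x.1) := by
  rw [comm_sgm hR hR0, DK, Dh, D]
  congr 1
  · refine Finset.sum_congr rfl fun l _ => ?_
    by_cases h : |x.1 (Sum.inr (k, l))| = R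
    · congr 1
      have h1 := moveL_mem hR0 x.2 h
      by_cases h2 : del (signs R x.1 k) l = t.emp
      · rw [if_pos h2, ext_notMem _ fun h' => h1.1 h' h2]
      · rw [if_neg h2, ext_mem _ (h1.2 h2), hf _ (hx.moveL hR0 h)]
        rw [signs_moveL_update hR0 h]
        congr 1
        exact state_step_inr _ _ _
    · have h' : signs R x.1 k l = none := by
        by_contra h'
        exact h (signs_inr_of.1 h')
      rw [del_of_none h', CharTwo.add_self_eq_zero, zero_mul, zero_mul]
  · refine Finset.sum_congr rfl fun ν _ => ?_
    by_cases h : (state x.1 ν).2 = true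
    · rw [if_pos h, if_pos h]
      congr 1
      rw [if_neg (signs_ne_emp x.2 k), ext_mem _ (moveN_mem hR0 x.2 h), hf _ (hx.moveN h),
        state_moveN h, Function.update_eq_self]
      congr 1
      funext j
      exact signs_step_inl _ _ _ _
    · rw [if_neg h, if_neg h]

theorem coc_near (hR : Even R) (x : Box t.fib R) (hx : Near R x.1) :
    coc x = ecoarse (state x.1) (signs R x.1) := by
  unfold coc top ecoarse
  congr 1
  rw [eq_iff_iff, Sum.forall]
  refine and_congr ?_ (forall_congr' fun k => ?_)
  · unfold nf
    rw [Finset.card_eq_zero, Finset.filter_eq_empty_iff]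
    have : ∀ ν, (evens t.fib x.1 (Sum.inl ν)).card = 1 ↔ ¬ (state x.1 ν).2 = true := by
      intro ν
      have h1 : Even (x.1 (Sum.inl (ν, true))) := even_of_abs hR (hx.1 ν).1
      have h2 : (state x.1 ν).2 = true ↔ Even (x.1 (Sum.inl (ν, false))) := by
        have h3 := abs_le.1 (hx.1 ν).2
        simp only [state, decide_eq_true_iff]
        rw [Int.even_iff]
        omega
      rw [h2]
      have hmem : Sum.inl (ν, true) ∈ evens t.fib x.1 (Sum.inl ν) := mem_evens.2 ⟨rfl, h1⟩
      constructor
      · intro h h'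
        have := Finset.card_le_one.1 h.le _ hmem _ (mem_evens.2 ⟨rfl, h'⟩)
        simp at this
      · intro h
        rw [Finset.card_eq_one]
        refine ⟨_, Finset.eq_singleton_iff_unique_mem.2 ⟨hmem, fun c hc => ?_⟩⟩
        obtain ⟨h4, h5⟩ := mem_evens.1 hc
        rcases c with ⟨μ, b⟩ | c
        · obtain rfl : μ = ν := Sum.inl.inj h4
          cases b with
          | true => rfl
          | false => exact absurd h5 h
        · exact absurd h4 (by simp [fib])
    simp only [this, Finset.mem_univ, true_implies]
  · have : (evens t.fib x.1 (Sum.inr k)).card = ns (signs R x.1 k) := by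
      unfold ns
      refine Finset.card_nbij' (fun c => Sum.elim (fun _ => (nonempty_L t).some) Prod.snd c)
        (fun l => Sum.inr (k, l)) ?_ ?_ ?_ ?_
      · intro c hc
        obtain ⟨h4, h5⟩ := mem_evens.1 hc
        rcases c with c | ⟨j, l⟩
        · exact absurd h4 (by simp [fib])
        · obtain rfl : j = k := Sum.inr.inj h4
          simp only [Finset.coe_filter, Set.mem_ofPred_eq, Finset.mem_univ, true_and]
          refine signs_inr_of.2 ((hx.2 (j, l)).resolve_right fun h => ?_)
          rw [← even_abs, h] at h5
          exact Int.even_sub_one.1 h5 hR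
      · intro l hl
        simp only [Finset.coe_filter, Set.mem_ofPred_eq, Finset.mem_univ, true_and] at hl
        exact mem_evens.2 ⟨rfl, even_of_abs hR (signs_inr_of.1 hl)⟩
      · intro c hc
        obtain ⟨h4, h5⟩ := mem_evens.1 hc
        rcases c with c | ⟨j, l⟩
        · exact absurd h4 (by simp [fib])
        · obtain rfl : j = k := Sum.inr.inj h4
          rfl
      · intro l _
        rfl
    rw [this]

end Shape

namespace SymTree

open Shape Box

variable {T : SymTree} {R : ℤ}

/-- The coarse labels. -/
def coarse (T : SymTree) (R : ℤ) (k : Fin 3) (x : Box T.toShape.fib R) : ZMod 2 := sgm R k x.1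

theorem word_near (hR : Even R) (hR0 : 0 < R) (l : List (Fin 3)) (x : Box T.toShape.fib R)
    (hx : Near R x.1) : (machine T hR hR0).word (l.map (coarse T R)) (machine T hR hR0).e x =
      cword l ecoarse (state x.1) (signs R x.1) := by
  induction l generalizing x with
  | nil =>
    exact coc_near hR x hx
  | cons k l ih =>
    rw [List.map_cons, Machine.word_cons]
    exact comm_sgm_near hR hR0 k ih x hx

/-- The number of moves available. -/
noncomputable def pot (R : ℤ) (x : T.toShape.Crd → ℤ) : ℕ := ∑ k, ns (signs R x k) + nf (state x)

theorem pot_moveL (hR0 : 0 < R) {x : T.toShape.Crd → ℤ} {k l}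
    (h : |x (Sum.inr (k, l))| = R) : pot R (moveL x k l) + 1 = pot R x := by
  unfold pot
  rw [signs_moveL_update hR0 h, ← Finset.add_sum_erase _ _ (Finset.mem_univ k),
    ← Finset.add_sum_erase (a := k) _ (fun k => ns (signs R x k)) (Finset.mem_univ k),
    Function.update_self, ← ns_del (signs_inr_of.2 h)]
  have h1 : state (moveL x k l) = state x := state_step_inr _ _ _
  have h2 : ∑ j ∈ Finset.univ.erase k, ns (Function.update (signs R x) k
      (del (signs R x k) l) j) = ∑ j ∈ Finset.univ.erase k, ns (signs R x j) :=
    Finset.sum_congr rfl fun j hj => by rw [Function.update_of_ne (Finset.ne_of_mem_erase hj)]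
  rw [h1, h2]
  omega

theorem pot_moveN {x : T.toShape.Crd → ℤ} {ν}
    (h : (state x ν).2 = true) : pot R (moveN x ν) + 1 = pot R x := by
  unfold pot
  have h1 : signs R (moveN x ν) = signs R x := funext fun j => signs_step_inl _ _ _ _
  rw [state_moveN h, h1, ← nf_flip h]
  omega

theorem three_le_pot (x : Box T.toShape.fib R) : 3 ≤ pot R x.1 := by
  have : ∀ k, 1 ≤ ns (signs R x.1 k) := fun k => ns_pos (signs_ne_emp x.2 k)
  unfold pot
  rw [Fin.sum_univ_three]
  have h0 := this 0
  have h1 := this 1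
  have h2 := this 2
  omega

theorem word_eq_zero (hR : Even R) (hR0 : 0 < R) (l : List (Fin 3)) (f : Box T.toShape.fib R → ZMod 2)
    (x : Box T.toShape.fib R) (hx : pot R x.1 < l.length + 3) :
    (machine T hR hR0).word (l.map (coarse T R)) f x = 0 := by
  induction l generalizing x with
  | nil => exact absurd (three_le_pot x) (by simpa using hx)
  | cons k l ih =>
    rw [List.map_cons, Machine.word_cons]
    have := comm_sgm hR hR0 k ((machine T hR hR0).word (l.map (coarse T R)) f) x
    refine this.trans ?_
    rw [List.length_cons] at hx
    have h1 : ∀ z : T.toShape.Crd → ℤ, pot R z + 1 = pot R x.1 →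
        ext ((machine T hR hR0).word (l.map (coarse T R)) f) z = 0 := by
      intro z hz
      by_cases h : z ∈ Box T.toShape.fib R
      · rw [ext_mem _ h]
        exact ih _ (by change pot R z < _; omega)
      · exact ext_notMem _ h
    rw [Finset.sum_eq_zero, Finset.sum_eq_zero, add_zero]
    · intro ν _
      split_ifs with h
      · rw [h1 _ (pot_moveN h), mul_zero]
      · rfl
    · intro i _
      by_cases h : |x.1 (Sum.inr (k, i))| = R
      · rw [h1 _ (pot_moveL hR0 h), mul_zero]
      · have h' : signs R x.1 k i = none := by
          by_contra h'
          exact h (signs_inr_of.1 h')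
        rw [del_of_none h', CharTwo.add_self_eq_zero, zero_mul]

/-- The corner given by a family of signs. -/
def corner (R : ℤ) (v : Fin 3 → T.toShape.L → Bool) : T.toShape.Crd → ℤ :=
  Sum.elim (fun p => if p.2 then R else 0) fun p => if v p.1 p.2 then -R else R

theorem bit_decide_neg (hR0 : 0 < R) (b : Bool) : decide ((if b then -R else R) < 0) = b := by
  cases b <;> simp <;> omega

theorem abs_corner (hR0 : 0 < R) (v : Fin 3 → T.toShape.L → Bool) (p) :
    |corner R v (Sum.inr p)| = R := by
  change |if v p.1 p.2 then -R else R| = R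
  split_ifs
  · rw [abs_neg, abs_of_pos hR0]
  · exact abs_of_pos hR0

theorem signs_corner (hR0 : 0 < R) (v : Fin 3 → T.toShape.L → Bool) :
    signs R (corner R v) = fun k => ful (v k) := by
  funext k l
  rw [signs, if_pos (abs_corner hR0 v _)]
  exact congrArg some (bit_decide_neg hR0 _)

theorem state_corner (hR0 : 0 < R) (v : Fin 3 → T.toShape.L → Bool) :
    state (corner R v) = fun _ => (false, true) := by
  funext ν
  simp only [state, corner, Sum.elim_inl]
  simp
  omega

theorem corner_mem (hR0 : 0 < R) (v : Fin 3 → T.toShape.L → Bool) :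
    corner R v ∈ Box T.toShape.fib R := by
  refine ⟨fun c => ?_, fun φ => ?_⟩
  · rcases c with ⟨ν, b⟩ | p
    · change |if b then R else 0| ≤ R
      split_ifs
      · exact (abs_of_pos hR0).le
      · rw [abs_zero]; exact hR0.le
    · exact (abs_corner hR0 v p).le
  · rcases φ with ν | k
    · exact ⟨Sum.inl (ν, true), rfl, abs_of_pos hR0⟩
    · exact ⟨Sum.inr (k, (nonempty_L _).some), rfl, abs_corner hR0 v _⟩

theorem near_corner (hR0 : 0 < R) (v : Fin 3 → T.toShape.L → Bool) : Near R (corner R v) :=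
  ⟨fun _ => ⟨abs_of_pos hR0, by simp [corner]⟩, fun _ => Or.inl (abs_corner hR0 v _)⟩

theorem even_corner (hR : Even R) (v : Fin 3 → T.toShape.L → Bool) (c) : Even (corner R v c) := by
  rcases c with ⟨ν, b⟩ | p
  · change Even (if b then R else 0)
    split_ifs
    · exact hR
    · exact Even.zero
  · change Even (if v p.1 p.2 then -R else R)
    split_ifs
    · exact hR.neg
    · exact hR

theorem core_corner (hR0 : 0 < R) (v : Fin 3 → T.toShape.L → Bool) : core T R (corner R v) =
    ∏ k, (1 + T.toShape.lead 0 (fun _ => (false, true)) (ful (v k))) := by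
  unfold core sgm
  rw [state_corner hR0, signs_corner hR0]
  simp [bit]

theorem eq_corner (hR0 : 0 < R) {x : T.toShape.Crd → ℤ} (hx : x ∈ Box T.toShape.fib R)
    (h1 : core T R x ≠ 0) (h2 : 3 * T.toShape.size + Fintype.card T.toShape.N ≤ pot R x) :
    ∃ v, corner R v = x := by
  have hns : ∀ k, ns (signs R x k) ≤ T.toShape.size := fun k => Finset.card_le_univ _
  have hnf : nf (state x) ≤ Fintype.card T.toShape.N := Finset.card_le_univ _
  have hs := h2
  unfold pot at hs
  rw [Fin.sum_univ_three] at hs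
  have e0 := hns 0
  have e1 := hns 1
  have e2 := hns 2
  have hk : ∀ k l, |x (Sum.inr (k, l))| = R := by
    intro k l
    have : ns (signs R x k) = T.toShape.size := by
      have hc : k = 0 ∨ k = 1 ∨ k = 2 := by revert k; decide
      rcases hc with rfl | rfl | rfl <;> omega
    have := (Finset.card_eq_iff_eq_univ _).1 this
    have h' : l ∈ Finset.univ.filter fun l => signs R x k l ≠ none := by
      rw [this]
      exact Finset.mem_univ l
    exact signs_inr_of.1 (Finset.mem_filter.1 h').2
  have hν : ∀ ν, x (Sum.inl (ν, false)) = 0 := by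
    intro ν
    have : nf (state x) = Fintype.card T.toShape.N := by omega
    have := (Finset.card_eq_iff_eq_univ _).1 this
    have h' : ν ∈ Finset.univ.filter fun ν => (state x ν).2 = true := by
      rw [this]
      exact Finset.mem_univ ν
    exact of_decide_eq_true (Finset.mem_filter.1 h').2
  have hν1 : ∀ ν, x (Sum.inl (ν, true)) = R := by
    intro ν
    have h3 : |x (Sum.inl (ν, true))| = R := by
      obtain ⟨c, h3, h4⟩ := hx.2 (Sum.inl ν)
      rcases c with ⟨μ, b⟩ | c
      · obtain rfl : μ = ν := Sum.inl.inj h3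
        cases b with
        | true => exact h4
        | false =>
          rw [hν, abs_zero] at h4
          omega
      · exact absurd h3 nofun
    have h5 : ¬ x (Sum.inl (ν, true)) < 0 := by
      intro h
      refine h1 ?_
      unfold core
      rw [Finset.prod_eq_zero (Finset.mem_univ ν), zero_mul]
      have : (state x ν).1 = true := decide_eq_true (Or.inr ⟨hν ν, h⟩)
      rw [this]
      rfl
    rwa [abs_of_nonneg (by omega)] at h3
  refine ⟨fun k l => decide (x (Sum.inr (k, l)) < 0), ?_⟩
  funext c
  rcases c with ⟨ν, b⟩ | ⟨k, l⟩
  · cases b with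
    | true => exact (hν1 ν).symm
    | false => exact (hν ν).symm
  · change (if decide (x (Sum.inr (k, l)) < 0) then -R else R) = x (Sum.inr (k, l))
    have := hk k l
    by_cases h : x (Sum.inr (k, l)) < 0
    · rw [abs_of_neg h] at this
      simp [h]
      omega
    · rw [abs_of_nonneg (by omega)] at this
      simp [h]
      omega

/-- The evaluation of a coarse word of maximal length. -/
theorem Q_coarse (hR : Even R) (hR0 : 0 < R) (a b c : ℕ)
    (h : a + b + c + 3 = 3 * T.toShape.size + Fintype.card T.toShape.N) :
    (machine T hR hR0).Q ((List.replicate a (0 : Fin 3) ++ List.replicate b 1 ++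
      List.replicate c 2).map (coarse T R)) = Q3 T.toShape a b c := by
  rw [← sum_cword]
  set l : List (Fin 3) := List.replicate a 0 ++ List.replicate b 1 ++ List.replicate c 2 with hl
  have hlen : l.length = a + b + c := by simp [hl, add_assoc]
  have e : (machine T hR hR0).Q (l.map (coarse T R)) = ∑ x, rho T R x *
      (machine T hR hR0).word (l.map (coarse T R)) (machine T hR hR0).e x := by
    change (∑ x, rho T R x • LinearMap.proj x : _ →ₗ[ZMod 2] ZMod 2) _ = _
    simp
  rw [e]
  symm
  refine Fintype.sum_of_injective (fun v => (⟨corner R v, corner_mem hR0 v⟩ : Box T.toShape.fib R))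
    ?_ _ _ ?_ ?_
  · intro v w hvw
    have := congrArg (signs R) (congrArg Subtype.val hvw)
    simp only [signs_corner hR0] at this
    funext k i
    exact Option.some.inj (congrFun (congrFun this k) i)
  · intro x hx
    by_contra h'
    refine hx ?_
    have hr : rho T R x ≠ 0 := left_ne_zero_of_mul h'
    have hw := right_ne_zero_of_mul h'
    obtain ⟨v, hv⟩ := eq_corner hR0 x.2 (fun h0 => hr (by unfold rho; rw [h0]; split_ifs <;> rfl))
      (not_lt.1 fun hp => hw (word_eq_zero hR hR0 _ _ _ (by omega)))
    exact ⟨v, Subtype.ext hv⟩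
  · intro v
    rw [word_near hR hR0 _ _ (near_corner hR0 v)]
    unfold rho
    rw [if_pos (even_corner hR v), core_corner hR0]
    simp only [signs_corner hR0, state_corner hR0]

end SymTree

namespace Machine

variable {X : Type} {Y : Machine X}

theorem Q_add_mid (p : List (X → ZMod 2)) (s t : X → ZMod 2) (l : List (X → ZMod 2)) :
    Y.Q (p ++ (s + t) :: l) = Y.Q (p ++ s :: l) + Y.Q (p ++ t :: l) := by
  simp only [Q, word_append, word_cons, D_add, add_mul, mul_add, LinearMap.add_apply, map_add]

/-- The evaluation only depends on the behaviour of the labels. -/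
theorem Q_forall_two {l l' : List (X → ZMod 2)} (h : List.Forall₂ (fun s t => ∀ γ ∈ Y.G,
    ∃ c : ZMod 2, (∀ x, s (γ x) = s x + c) ∧ ∀ x, t (γ x) = t x + c) l l')
    (p : List (X → ZMod 2)) (hp : ∀ s ∈ p, Y.IsLabel s) : Y.Q (p ++ l) = Y.Q (p ++ l') := by
  have H : ∀ {l l' : List (X → ZMod 2)}, List.Forall₂ (fun s t => ∀ γ ∈ Y.G,
      ∃ c : ZMod 2, (∀ x, s (γ x) = s x + c) ∧ ∀ x, t (γ x) = t x + c) l l' →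
      ∀ s ∈ l, Y.IsLabel s := by
    intro l l' h
    induction h with
    | nil => simp
    | cons h1 _ ih =>
      intro s hs
      rcases List.mem_cons.1 hs with rfl | hs
      · intro γ hγ
        obtain ⟨c, hc, _⟩ := h1 γ hγ
        exact ⟨c, hc⟩
      · exact ih s hs
  induction h generalizing p with
  | nil => rfl
  | @cons s t l l' h1 h2 ih =>
    have hl := H h2
    have hs : Y.IsLabel s := fun γ hγ => (h1 γ hγ).imp fun c hc => hc.1
    have ht : Y.IsLabel t := fun γ hγ => (h1 γ hγ).imp fun c hc => hc.2
    have hpl : ∀ r ∈ p ++ l, Y.IsLabel r := fun r hr =>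
      (List.mem_append.1 hr).elim (hp r) (hl r)
    have e1 : Y.Q (p ++ s :: l) = Y.Q (s :: (p ++ l)) := Q_perm List.perm_middle fun r hr => by
      rcases List.mem_append.1 hr with h | h
      · exact hp r h
      · rcases List.mem_cons.1 h with rfl | h
        · exact hs
        · exact hl r h
    have e2 : Y.Q (t :: (p ++ l)) = Y.Q (p ++ t :: l) := Q_perm List.perm_middle.symm fun r hr => by
      rcases List.mem_cons.1 hr with rfl | h
      · exact ht
      · exact hpl r h
    rw [e1, Q_replace hpl h1, e2]
    have := ih (p ++ [t]) fun r hr => by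
      rcases List.mem_append.1 hr with h | h
      · exact hp r h
      · rw [List.mem_singleton.1 h]; exact ht
    simpa using this

end Machine

namespace SymTree

open Shape Box

variable {T : SymTree} {R : ℤ}

/-- Functions with prescribed behaviour under negation of the families, invariant under exchange of
subtrees. -/
def IsChar (χ : Fin 3 → ZMod 2) (s : Box T.toShape.fib R → ZMod 2) : Prop :=
  (∀ k x, s ((negS T.toShape k).map x) = s x + χ k) ∧ ∀ ν x, s ((swapS T ν).map x) = s x

theorem IsChar.pair {hR : Even R} {hR0 : 0 < R} {χ : Fin 3 → ZMod 2}
    {s t : Box T.toShape.fib R → ZMod 2} (hs : IsChar χ s) (ht : IsChar χ t) :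
    ∀ γ ∈ (machine T hR hR0).G, ∃ c : ZMod 2, (∀ x, s (γ x) = s x + c) ∧
      ∀ x, t (γ x) = t x + c := by
  rintro _ (⟨k, rfl⟩ | ⟨ν, rfl⟩)
  · exact ⟨χ k, hs.1 k, ht.1 k⟩
  · exact ⟨0, fun x => by rw [hs.2, add_zero], fun x => by rw [ht.2, add_zero]⟩

theorem isChar_coarse (hR0 : 0 < R) (k : Fin 3) :
    IsChar (Pi.single k 1) (coarse T R k) := by
  refine ⟨fun j x => ?_, fun ν x => ?_⟩
  · rw [Pi.single_apply]
    have := sgm_negS hR0 x.2 k j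
    simp only [eq_comm (a := k)] at this
    exact this
  · exact sgm_swapS hR0 x.2 ν k

theorem IsChar.add {χ ψ : Fin 3 → ZMod 2} {s t : Box T.toShape.fib R → ZMod 2} (hs : IsChar χ s)
    (ht : IsChar ψ t) : IsChar (χ + ψ) (s + t) := by
  refine ⟨fun k x => ?_, fun ν x => ?_⟩
  · rw [Pi.add_apply, Pi.add_apply, Pi.add_apply, hs.1, ht.1]
    ring
  · rw [Pi.add_apply, Pi.add_apply, hs.2, ht.2]

/-- The letters which involve a single family. -/
def pures (N : ℕ) : List (Fin 3) :=
  List.replicate N 0 ++ (List.replicate N 1 ++ (List.replicate N 2 ++ [0, 0, 1]))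

theorem Q_count (hR : Even R) (hR0 : 0 < R) (l : List (Fin 3))
    (h : l.length + 3 = 3 * T.toShape.size + Fintype.card T.toShape.N) :
    (machine T hR hR0).Q (l.map (coarse T R)) =
      Q3 T.toShape (l.count 0) (l.count 1) (l.count 2) := by
  have hp : l.Perm (List.replicate (l.count 0) 0 ++ List.replicate (l.count 1) 1 ++
      List.replicate (l.count 2) 2) := by
    rw [List.perm_iff_count]
    intro a
    have hc : a = 0 ∨ a = 1 ∨ a = 2 := by revert a; decide
    rcases hc with rfl | rfl | rfl <;> simp [List.count_replicate]
  rw [← Q_coarse hR hR0]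
  · refine Machine.Q_perm (hp.map _) fun s hs => ?_
    obtain ⟨k, _, rfl⟩ := List.mem_map.1 hs
    intro γ hγ
    exact ((isChar_coarse hR0 k).pair (isChar_coarse hR0 k) γ hγ).imp fun c hc => hc.1
  · rw [← h, hp.length_eq]
    simp [add_assoc]

theorem Q_letters (hR : Even R) (hR0 : 0 < R) {n m N : ℕ} (hn : T.toShape.size = n)
    (hN : Fintype.card T.toShape.N = 3 * m) (ht : total T.toShape m = 1) (hm : 2 ≤ m)
    (h : N + 3 = n + m) :
    (machine T hR hR0).Q ((coarse T R 0 + coarse T R 1) :: (coarse T R 0 + coarse T R 2) ::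
      (coarse T R 1 + coarse T R 2) :: (pures N).map (coarse T R)) = 1 := by
  have q : ∀ a b c : Fin 3, (machine T hR hR0).Q (coarse T R a :: coarse T R b :: coarse T R c ::
      (pures N).map (coarse T R)) = Q3 T.toShape ((a :: b :: c :: pures N).count 0)
        ((a :: b :: c :: pures N).count 1) ((a :: b :: c :: pures N).count 2) := by
    intro a b c
    rw [← Q_count hR hR0]
    · rfl
    · simp [pures, hn, hN]
      omega
  have q' : ∀ (a b c : Fin 3) (a' b' c' : ℕ), (a :: b :: c :: pures N).count 0 + 1 = n + a' →
      (a :: b :: c :: pures N).count 1 + 1 = n + b' →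
      (a :: b :: c :: pures N).count 2 + 1 = n + c' →
      (machine T hR hR0).Q (coarse T R a :: coarse T R b :: coarse T R c ::
        (pures N).map (coarse T R)) = E T.toShape fun v => if v = ![a', b', c'] then 1 else 0 := by
    intro a b c a' b' c' h0 h1 h2
    rw [q, Q3_eq (by rw [hn, h0]) (by rw [hn, h1]) (by rw [hn, h2])]
  have m2 : ∀ a b c d : Box T.toShape.fib R → ZMod 2, ∀ l, (machine T hR hR0).Q (a :: (b + c) :: d :: l) =
      (machine T hR hR0).Q (a :: b :: d :: l) + (machine T hR hR0).Q (a :: c :: d :: l) :=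
    fun a b c d l => Machine.Q_add_mid [a] b c (d :: l)
  have m3 : ∀ a b c d : Box T.toShape.fib R → ZMod 2, ∀ l, (machine T hR hR0).Q (a :: b :: (c + d) :: l) =
      (machine T hR hR0).Q (a :: b :: c :: l) + (machine T hR hR0).Q (a :: b :: d :: l) :=
    fun a b c d l => Machine.Q_add_mid [a, b] c d l
  have cnt : ∀ k : Fin 3, (pures N).count k = N + [0, 0, (1 : Fin 3)].count k := by
    intro k
    have hc : k = 0 ∨ k = 1 ∨ k = 2 := by revert k; decide
    rcases hc with rfl | rfl | rfl <;> simp [pures, List.count_replicate]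
  have e1 := q' 0 0 1 (m + 2) m (m - 2) (by simp [cnt]; omega) (by simp [cnt]; omega)
    (by simp [cnt]; omega)
  have e2 := q' 0 0 2 (m + 2) (m - 1) (m - 1) (by simp [cnt]; omega) (by simp [cnt]; omega)
    (by simp [cnt]; omega)
  have e3 := q' 1 0 1 (m + 1) (m + 1) (m - 2) (by simp [cnt]; omega) (by simp [cnt]; omega)
    (by simp [cnt]; omega)
  have e4 := q' 1 2 1 m (m + 1) (m - 1) (by simp [cnt]; omega) (by simp [cnt]; omega)
    (by simp [cnt]; omega)
  have e5 := q' 0 2 2 (m + 1) (m - 1) m (by simp [cnt]; omega) (by simp [cnt]; omega)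
    (by simp [cnt]; omega)
  have e6 := q' 1 2 2 m m m (by simp [cnt]; omega) (by simp [cnt]; omega)
    (by simp [cnt]; omega)
  have e7 : (machine T hR hR0).Q (coarse T R 0 :: coarse T R 2 :: coarse T R 1 ::
        (pures N).map (coarse T R)) = (machine T hR hR0).Q (coarse T R 1 :: coarse T R 0 ::
        coarse T R 2 :: (pures N).map (coarse T R)) := by
    rw [q, q]
    simp [cnt]
  rw [Machine.Q_add, m2, m2, m3, m3, m3, m3, e1, e2, e3, e4, e5, e6, e7]
  refine Eq.trans ?_ ht
  have e8 := CharTwo.add_self_eq_zero ((machine T hR hR0).Q (coarse T R 1 :: coarse T R 0 ::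
        coarse T R 2 :: (pures N).map (coarse T R)))
  simp only [total]
  linear_combination e8

end SymTree

namespace Box

variable {C Φ : Type} [Fintype C] [DecidableEq C] [Fintype Φ] [DecidableEq Φ] {fib : C → Φ} {R : ℤ}

/-- The points obtained by moving even coordinates by one. -/
def Above (x y : C → ℤ) : Prop := ∀ c, y c = x c ∨ Even (x c) ∧ |y c - x c| = 1

theorem above_step (x : C → ℤ) {c : C} (h : Even (x c)) (v : ℤˣ) :
    Above x (x + Pi.single c (v : ℤ)) := by
  intro c'
  by_cases hc : c' = c
  · subst hc
    right
    refine ⟨h, ?_⟩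
    rw [step_same, add_sub_cancel_left]
    rcases Int.units_eq_one_or v with rfl | rfl <;> simp
  · left
    exact step_ne _ hc _

theorem Above.trans {x y z : C → ℤ} (h1 : Above x y) (h2 : Above y z) : Above x z := by
  intro c
  rcases h1 c with h | ⟨h, h'⟩
  · rcases h2 c with k | k
    · left; rw [k, h]
    · right; rwa [h] at k
  · rcases h2 c with k | ⟨k, _⟩
    · right; rw [k]; exact ⟨h, h'⟩
    · exfalso
      rw [Int.even_iff] at h k
      rcases abs_cases (y c - x c) with h3 | h3 <;> omega

theorem comm_eq_zero (s f : Box fib R → ZMod 2) (x : Box fib R)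
    (h : ∀ y : Box fib R, Above x.1 y.1 → s y = s x ∨ f y = 0) :
    (mulOp s * cob + cob * mulOp s : Module.End (ZMod 2) (Box fib R → ZMod 2)) f x = 0 := by
  change s x * cob f x + cob (fun x => s x * f x) x = 0
  rw [cob_apply, cob_apply, Finset.mul_sum, ← Finset.sum_add_distrib]
  refine Finset.sum_eq_zero fun p _ => ?_
  split_ifs with he
  · by_cases hz : x.1 + Pi.single p.1 (p.2 : ℤ) ∈ Box fib R
    · rw [ext_mem _ hz, ext_mem _ hz]
      rcases h ⟨_, hz⟩ (above_step x.1 he p.2) with h | h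
      · rw [h, CharTwo.add_self_eq_zero]
      · rw [h, mul_zero, mul_zero, add_zero]
    · rw [ext_notMem _ hz, ext_notMem _ hz, mul_zero, add_zero]
  · simp

end Box

namespace SymTree

open Shape Box

variable {T : SymTree} {R : ℤ}

theorem word_of_const (hR : Even R) (hR0 : 0 < R) (l : List (Box T.toShape.fib R → ZMod 2))
    (f : Box T.toShape.fib R → ZMod 2) (x : Box T.toShape.fib R) {s} (hs : s ∈ l)
    (h : ∀ y : Box T.toShape.fib R, Above x.1 y.1 → s y = s x) :
    (machine T hR hR0).word l f x = 0 := by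
  induction l generalizing x with
  | nil => exact absurd hs List.not_mem_nil
  | cons r l ih =>
    rw [Machine.word_cons]
    refine comm_eq_zero r _ x fun y hy => ?_
    rcases List.mem_cons.1 hs with rfl | hs
    · exact Or.inl (h y hy)
    · exact Or.inr (ih y hs fun z hz => (h z (hy.trans hz)).trans (h y hy).symm)

/-- The discrete form of the existence theorem. -/
theorem exists_mixed (hR : Even R) (hR0 : 0 < R) {n m N : ℕ} (hn : T.toShape.size = n)
    (hN : Fintype.card T.toShape.N = 3 * m) (ht : total T.toShape m = 1) (hm : 2 ≤ m)
    (h : N + 3 = n + m) (s : Fin 3 → Fin N → Box T.toShape.fib R → ZMod 2)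
    (hs : ∀ k j, IsChar (Pi.single k 1) (s k j)) (p : Fin 3 → Fin 3 → Box T.toShape.fib R → ZMod 2)
    (hp : ∀ k l, k < l → IsChar (Pi.single k 1 + Pi.single l 1) (p k l)) :
    ∃ x : Box T.toShape.fib R,
      (∀ k j, ∃ y : Box T.toShape.fib R, Above x.1 y.1 ∧ s k j y ≠ s k j x) ∧
      ∀ k l, k < l → ∃ y : Box T.toShape.fib R, Above x.1 y.1 ∧ p k l y ≠ p k l x := by
  by_contra H
  have hc := isChar_coarse (T := T) (R := R) hR0
  let L := p 0 1 :: p 0 2 :: p 1 2 :: ((List.finRange N).map (s 0) ++ ((List.finRange N).map (s 1) ++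
    ((List.finRange N).map (s 2) ++ [coarse T R 0, coarse T R 0, coarse T R 1])))
  have hQ : (machine T hR hR0).Q L = 1 := by
    rw [← Q_letters hR hR0 hn hN ht hm h]
    refine Machine.Q_forall_two (p := []) ?_ (by simp)
    have hr : ∀ k, List.Forall₂ (fun s t => ∀ γ ∈ (machine T hR hR0).G, ∃ c : ZMod 2,
        (∀ x, s (γ x) = s x + c) ∧ ∀ x, t (γ x) = t x + c) ((List.finRange N).map (s k))
        ((List.replicate N k).map (coarse T R)) := by
      intro k
      have : (List.replicate N k).map (coarse T R) = (List.finRange N).map fun _ => coarse T R k := by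
        simp
      rw [this, List.forall₂_map_left_iff, List.forall₂_map_right_iff, List.forall₂_same]
      intro j _
      exact (hs k j).pair (hc k)
    refine .cons ((hp 0 1 (by decide)).pair ((hc 0).add (hc 1))) <|
      .cons ((hp 0 2 (by decide)).pair ((hc 0).add (hc 2))) <|
      .cons ((hp 1 2 (by decide)).pair ((hc 1).add (hc 2))) ?_
    unfold pures
    rw [List.map_append, List.map_append, List.map_append]
    refine List.rel_append (hr 0) (List.rel_append (hr 1) (List.rel_append (hr 2) ?_))
    exact .cons ((hc 0).pair (hc 0)) (.cons ((hc 0).pair (hc 0)) (.cons ((hc 1).pair (hc 1)) .nil))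
  have h0 : (machine T hR hR0).word L (machine T hR hR0).e = 0 := by
    funext x
    push Not at H
    by_cases h1 : ∀ k j, ∃ y : Box T.toShape.fib R, Above x.1 y.1 ∧ s k j y ≠ s k j x
    · obtain ⟨k, l, hkl, h2⟩ := H x h1
      refine word_of_const hR hR0 L _ x (s := p k l) ?_ h2
      have : (k = 0 ∧ l = 1) ∨ (k = 0 ∧ l = 2) ∨ (k = 1 ∧ l = 2) := by
        clear h2
        revert k l
        decide
      rcases this with ⟨rfl, rfl⟩ | ⟨rfl, rfl⟩ | ⟨rfl, rfl⟩ <;> simp [L]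
    · push Not at h1
      obtain ⟨k, j, h2⟩ := h1
      refine word_of_const hR hR0 L _ x (s := s k j) ?_ h2
      have : k = 0 ∨ k = 1 ∨ k = 2 := by
        clear h2
        revert k
        decide
      rcases this with rfl | rfl | rfl <;> simp [L]
  rw [Machine.Q, h0, map_zero] at hQ
  exact zero_ne_one hQ

end SymTree

namespace SymTree

open Shape Box Filter Topology

variable {T : SymTree} {R : ℤ}

/-- The action of a signed symmetry on real points. -/
def ract (g : SignedSymm T.toShape.fib) (x : T.toShape.Crd → ℝ) : T.toShape.Crd → ℝ :=
  fun c => ((g.sign c : ℤ) : ℝ) * x (g.perm c)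

/-- The product of the boundaries of the unit cubes. -/
def Cubes (T : SymTree) : Set (T.toShape.Crd → ℝ) :=
  {x | (∀ c, |x c| ≤ 1) ∧ ∀ φ, ∃ c, T.toShape.fib c = φ ∧ |x c| = 1}

theorem isCompact_cubes : IsCompact (Cubes T) := by
  refine (isCompact_univ_pi fun _ : T.toShape.Crd => isCompact_Icc (a := (-1 : ℝ)) (b := 1)).of_isClosed_subset
    ?_ fun x hx c _ => abs_le.1 (hx.1 c)
  have e : Cubes T = (⋂ c, {x | |x c| ≤ 1}) ∩
      ⋂ φ, ⋃ c ∈ {c | T.toShape.fib c = φ}, {x | |x c| = 1} := by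
    ext x
    simp [Cubes]
  rw [e]
  refine (isClosed_iInter fun c => ?_).inter (isClosed_iInter fun φ =>
    (Set.toFinite _).isClosed_biUnion fun c _ => ?_)
  · exact isClosed_le (by fun_prop) continuous_const
  · exact isClosed_eq (by fun_prop) continuous_const

/-- Rescaling. -/
noncomputable def scl (R : ℤ) (x : T.toShape.Crd → ℤ) : T.toShape.Crd → ℝ := fun c => x c / R

theorem scl_act (g : SignedSymm T.toShape.fib) (x : T.toShape.Crd → ℤ) :
    scl R (g.act x) = ract g (scl R x) := by
  funext c
  simp [scl, ract, SignedSymm.act, mul_div_assoc]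

theorem scl_mem (hR : 0 < R) (x : Box T.toShape.fib R) : scl R x.1 ∈ Cubes T := by
  have hR' : (0 : ℝ) < R := by exact_mod_cast hR
  have h : ∀ c, |scl R x.1 c| = |(x.1 c : ℝ)| / R := fun c => by
    rw [scl, abs_div, abs_of_pos hR']
  refine ⟨fun c => ?_, fun φ => ?_⟩
  · rw [h, div_le_one hR']
    exact_mod_cast x.2.1 c
  · obtain ⟨c, h1, h2⟩ := x.2.2 φ
    refine ⟨c, h1, ?_⟩
    rw [h, div_eq_one_iff_eq hR'.ne']
    exact_mod_cast h2

/-- Real functions with prescribed behaviour under the symmetries. -/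
def RChar (χ : Fin 3 → ZMod 2) (F : (T.toShape.Crd → ℝ) → ℝ) : Prop :=
  (∀ k x, F (ract (negS T.toShape k) x) = (if χ k = 0 then 1 else -1) * F x) ∧
    ∀ ν x, F (ract (swapS T ν) x) = F x

open Classical in
/-- The sign of a function, as a label. -/
noncomputable def lab (F : (T.toShape.Crd → ℝ) → ℝ) (s : Box T.toShape.fib R → ZMod 2)
    (x : Box T.toShape.fib R) : ZMod 2 :=
  if F (scl R x.1) = 0 then s x else if F (scl R x.1) < 0 then 1 else 0

theorem IsChar.lab {χ : Fin 3 → ZMod 2} {F : (T.toShape.Crd → ℝ) → ℝ}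
    {s : Box T.toShape.fib R → ZMod 2} (hs : IsChar χ s) (hF : RChar χ F) :
    IsChar χ (lab F s) := by
  refine ⟨fun k x => ?_, fun ν x => ?_⟩
  · have h1 : F (scl R ((negS T.toShape k).map x).1) = (if χ k = 0 then 1 else -1) * F (scl R x.1) := by
      rw [← hF.1, ← scl_act]
      rfl
    unfold SymTree.lab
    rw [h1, hs.1]
    have h2 : χ k = 0 ∨ χ k = 1 := by
      generalize χ k = a
      revert a
      decide
    rcases h2 with h2 | h2
    · simp [h2]
    · rw [h2, if_neg one_ne_zero]
      rcases lt_trichotomy (F (scl R x.1)) 0 with h | h | h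
      · simp [h.ne, h, h.le, CharTwo.add_self_eq_zero]
      · simp [h]
      · simp [h.ne', h, h.le]
  · have h1 : F (scl R ((swapS T ν).map x).1) = F (scl R x.1) := by
      rw [← hF.2 ν (scl R x.1), ← scl_act]
      rfl
    unfold SymTree.lab
    rw [h1, hs.2]

theorem mul_nonpos_of_lab_ne {F : (T.toShape.Crd → ℝ) → ℝ} {s : Box T.toShape.fib R → ZMod 2}
    {x y : Box T.toShape.fib R} (h : lab F s y ≠ lab F s x) : F (scl R y.1) * F (scl R x.1) ≤ 0 := by
  by_contra! h'
  refine h ?_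
  unfold lab
  rcases pos_and_pos_or_neg_and_neg_of_mul_pos h' with ⟨h1, h2⟩ | ⟨h1, h2⟩
  · rw [if_neg h1.ne', if_neg h1.not_gt, if_neg h2.ne', if_neg h2.not_gt]
  · rw [if_neg h1.ne, if_pos h1, if_neg h2.ne, if_pos h2]

theorem dist_scl_le (hR : 0 < R) {x y : T.toShape.Crd → ℤ} (h : Above x y) :
    dist (scl R x) (scl R y) ≤ 1 / R := by
  have hR' : (0 : ℝ) < R := by exact_mod_cast hR
  refine (dist_pi_le_iff (by positivity)).2 fun c => ?_
  have h1 : |y c - x c| ≤ 1 := by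
    rcases h c with h | h
    · rw [h, sub_self, abs_zero]; exact zero_le_one
    · exact h.2.le
  rw [dist_comm, Real.dist_eq, scl, scl, ← sub_div, abs_div, abs_of_pos hR']
  gcongr
  exact_mod_cast h1

/-- Common zeros of equivariant functions. -/
theorem exists_zero {n m N : ℕ} (hn : T.toShape.size = n)
    (hN : Fintype.card T.toShape.N = 3 * m) (ht : total T.toShape m = 1) (hm : 2 ≤ m)
    (h : N + 3 = n + m) (F : Fin 3 → Fin N → (T.toShape.Crd → ℝ) → ℝ)
    (hF : ∀ k j, Continuous (F k j)) (hF' : ∀ k j, RChar (Pi.single k 1) (F k j))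
    (G : Fin 3 → Fin 3 → (T.toShape.Crd → ℝ) → ℝ) (hG : ∀ k l, Continuous (G k l))
    (hG' : ∀ k l, k < l → RChar (Pi.single k 1 + Pi.single l 1) (G k l)) :
    ∃ x ∈ Cubes T, (∀ k j, F k j x = 0) ∧ ∀ k l, k < l → G k l x = 0 := by
  let r : ℕ → ℤ := fun i => 2 * (i + 1)
  have hr : ∀ i, Even (r i) := fun i => even_two_mul _
  have hr0 : ∀ i, 0 < r i := fun i => by positivity
  have key := fun i => exists_mixed (T := T) (hr i) (hr0 i) hn hN ht hm h
    (fun k j => lab (F k j) (coarse T (r i) k))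
    (fun k j => (isChar_coarse (hr0 i) k).lab (hF' k j))
    (fun k l => lab (G k l) (coarse T (r i) k + coarse T (r i) l))
    (fun k l hkl => ((isChar_coarse (hr0 i) k).add (isChar_coarse (hr0 i) l)).lab (hG' k l hkl))
  choose x hx1 hx2 using key
  obtain ⟨z, hz, θ, hθ, hlim⟩ := isCompact_cubes.tendsto_subseq fun i => scl_mem (hr0 i) (x i)
  have hr1 : Tendsto (fun i => 1 / (r (θ i) : ℝ)) atTop (𝓝 0) := by
    refine (Tendsto.comp ?_ hθ.tendsto_atTop : Tendsto ((fun i => 1 / (r i : ℝ)) ∘ θ) atTop (𝓝 0))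
    have h1 := (tendsto_one_div_add_atTop_nhds_zero_nat (𝕜 := ℝ)).const_mul (1 / 2)
    rw [mul_zero] at h1
    refine h1.congr fun i => ?_
    simp only [r]
    push_cast
    field_simp
  have main : ∀ H : (T.toShape.Crd → ℝ) → ℝ, Continuous H →
      (∀ i, ∃ y : Box T.toShape.fib (r i), Above (x i).1 y.1 ∧
        H (scl (r i) y.1) * H (scl (r i) (x i).1) ≤ 0) → H z = 0 := by
    intro H hH hy
    choose y hy1 hy2 using hy
    have hylim : Tendsto (fun i => scl (r (θ i)) (y (θ i)).1) atTop (𝓝 z) :=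
      (tendsto_iff_of_dist (squeeze_zero (fun _ => dist_nonneg)
        (fun i => dist_scl_le (hr0 _) (hy1 (θ i))) hr1)).1 hlim
    have h1 : Tendsto (fun i => H (scl (r (θ i)) (y (θ i)).1) * H (scl (r (θ i)) (x (θ i)).1)) atTop
        (𝓝 (H z * H z)) := ((hH.tendsto z).comp hylim).mul ((hH.tendsto z).comp hlim)
    have h2 := le_of_tendsto h1 (Eventually.of_forall fun i => hy2 (θ i))
    nlinarith
  refine ⟨z, hz, fun k j => main _ (hF k j) fun i => ?_, fun k l hkl => main _ (hG k l) fun i => ?_⟩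
  · obtain ⟨y, h1, h2⟩ := hx1 i k j
    exact ⟨y, h1, mul_nonpos_of_lab_ne h2⟩
  · obtain ⟨y, h1, h2⟩ := hx2 i k l hkl
    exact ⟨y, h1, mul_nonpos_of_lab_ne h2⟩

end SymTree

section

open Filter Topology

/-- A signed measure on the index set both of whose images vanish is zero. -/
def NonRes {ι : Type*} [Fintype ι] (a b : ι → ℝ) : Prop :=
  ∀ w : ι → ℝ, (∀ g : ℝ → ℝ, Continuous g → ∑ x, w x * g (a x) = 0) →
    (∀ g : ℝ → ℝ, Continuous g → ∑ x, w x * g (b x) = 0) → w = 0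

/-- Robust version of `NonRes`: the first image may be nonzero in a short interval. -/
def RobRes {ι : Type*} [Fintype ι] (a b : ι → ℝ) (δ : ℝ) : Prop :=
  ∀ (w : ι → ℝ) (t : ℝ), |t| ≤ 8 →
    (∀ g : ℝ → ℝ, Continuous g → (∀ y, |y - t| ≤ δ → g y = 0) → ∑ x, w x * g (a x) = 0) →
    (∀ g : ℝ → ℝ, Continuous g → ∑ x, w x * g (b x) = 0) → w = 0

theorem RobRes.mono {ι : Type*} [Fintype ι] {a b : ι → ℝ} {δ δ' : ℝ} (h : RobRes a b δ) (hδ : δ' ≤ δ) :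
    RobRes a b δ' := fun w t ht h1 h2 =>
  h w t ht (fun g hg hg' => h1 g hg fun y hy => hg' y (hy.trans hδ)) h2

namespace NonRes

variable {ι κ : Type*}

/-- A function which separates points near `c` from points near `-c`. -/
theorem exists_sep {a : ι → ℝ} {b : κ → ℝ} {c : ℝ} (hc : 1 / 4 ≤ |c|)
    (ha : ∀ x, |a x - c| ≤ 1 / 8) (hb : ∀ y, |b y + c| ≤ 1 / 8) :
    ∃ χ : ℝ → ℝ, Continuous χ ∧ (∀ x, χ (a x) = 1) ∧ ∀ y, χ (b y) = 0 := by
  refine ⟨fun y => max 0 (min 1 (1 / 2 + 16 * y * c)), by fun_prop, fun x => ?_, fun y => ?_⟩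
  · have h1 := abs_le.1 (ha x)
    have h2 : 1 / 2 ≤ 16 * a x * c := by
      rcases le_abs'.1 hc with h | h <;> nlinarith [h1.1, h1.2]
    show max 0 (min 1 (1 / 2 + 16 * a x * c)) = 1
    rw [min_eq_left (by linarith), max_eq_right zero_le_one]
  · have h1 := abs_le.1 (hb y)
    have h2 : 16 * b y * c ≤ - (1 / 2) := by
      rcases le_abs'.1 hc with h | h <;> nlinarith [h1.1, h1.2]
    show max 0 (min 1 (1 / 2 + 16 * b y * c)) = 0
    exact max_eq_left ((min_le_right _ _).trans (by linarith))

theorem abs_cluster {c s u : ℝ} (hs : 0 < s) (hs' : s ≤ 1) (hu : |u| ≤ 2) :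
    |c + 1 / 16 * s * u - c| ≤ 1 / 8 := by
  rw [add_sub_cancel_left, abs_mul, abs_of_pos (by positivity)]
  nlinarith [abs_nonneg u]

variable [Fintype ι] [Fintype κ]

theorem symm {a b : ι → ℝ} (h : NonRes a b) : NonRes b a := fun w h1 h2 => h w h2 h1

theorem of_equiv (e : κ ≃ ι) {a b : ι → ℝ} (h : NonRes (a ∘ e) (b ∘ e)) : NonRes a b := by
  intro w h1 h2
  have := h (w ∘ e) (fun g hg => (e.sum_comp fun x => w x * g (a x)).trans (h1 g hg))
    (fun g hg => (e.sum_comp fun x => w x * g (b x)).trans (h2 g hg))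
  funext x
  simpa using congrFun this (e.symm x)

theorem affine {a b : ι → ℝ} (h : NonRes a b) (c d : ℝ) {t : ℝ} (ht : t ≠ 0) :
    NonRes (fun x => c + t * a x) (fun x => d + t * b x) := by
  intro w h1 h2
  refine h w (fun g hg => ?_) fun g hg => ?_
  · refine Eq.trans (Finset.sum_congr rfl fun x _ => ?_) (h1 (fun y => g ((y - c) / t)) (by fun_prop))
    rw [add_sub_cancel_left, mul_div_cancel_left₀ _ ht]
  · refine Eq.trans (Finset.sum_congr rfl fun x _ => ?_) (h2 (fun y => g ((y - d) / t)) (by fun_prop))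
    rw [add_sub_cancel_left, mul_div_cancel_left₀ _ ht]

/-- Two clusters whose second projections can be separated. -/
theorem sum {a₁ b₁ : ι → ℝ} {a₂ b₂ : κ → ℝ} (χ : ℝ → ℝ) (hχ : Continuous χ)
    (hb₁ : ∀ x, χ (b₁ x) = 1) (hb₂ : ∀ y, χ (b₂ y) = 0)
    (h1 : ∀ w : ι → ℝ, (∀ g : ℝ → ℝ, Continuous g → (∀ y, g (a₂ y) = 0) → ∑ x, w x * g (a₁ x) = 0) →
      (∀ g : ℝ → ℝ, Continuous g → ∑ x, w x * g (b₁ x) = 0) → w = 0)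
    (h2 : NonRes a₂ b₂) : NonRes (Sum.elim a₁ a₂) (Sum.elim b₁ b₂) := by
  intro w ha hb
  have e1 : (fun x => w (Sum.inl x)) = 0 := by
    refine h1 _ (fun g hg h => ?_) fun g hg => ?_
    · have := ha g hg
      rw [Fintype.sum_sum_type] at this
      simpa [h] using this
    · have := hb (fun y => χ y * g y) (by fun_prop)
      rw [Fintype.sum_sum_type] at this
      simpa [hb₁, hb₂] using this
  have e1' : ∀ x, w (Sum.inl x) = 0 := fun x => congrFun e1 x
  have e2 : (fun x => w (Sum.inr x)) = 0 := by
    refine h2 _ (fun g hg => ?_) fun g hg => ?_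
    · have := ha g hg
      rw [Fintype.sum_sum_type] at this
      simpa [e1'] using this
    · have := hb g hg
      rw [Fintype.sum_sum_type] at this
      simpa [e1'] using this
  funext x
  rcases x with x | x
  · exact congrFun e1 x
  · exact congrFun e2 x

/-- Two clusters both of whose projections are disjoint. -/
theorem cluster {a₁ b₁ : ι → ℝ} {a₂ b₂ : κ → ℝ} {c d s₁ s₂ : ℝ} (hc : 1 / 4 ≤ |c|) (hd : 1 / 4 ≤ |d|)
    (hs₁ : 0 < s₁) (hs₁' : s₁ ≤ 1) (hs₂ : 0 < s₂) (hs₂' : s₂ ≤ 1)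
    (ha₁ : ∀ x, |a₁ x| ≤ 2) (hb₁ : ∀ x, |b₁ x| ≤ 2) (ha₂ : ∀ x, |a₂ x| ≤ 2) (hb₂ : ∀ x, |b₂ x| ≤ 2)
    (h1 : NonRes a₁ b₁) (h2 : NonRes a₂ b₂) :
    NonRes (Sum.elim (fun x => c + 1 / 16 * s₁ * a₁ x) (fun x => -c + 1 / 16 * s₂ * a₂ x))
      (Sum.elim (fun x => d + 1 / 16 * s₁ * b₁ x) (fun x => -d + 1 / 16 * s₂ * b₂ x)) := by
  obtain ⟨χ, e1, e2, e3⟩ := exists_sep hc (fun x => abs_cluster (c := c) hs₁ hs₁' (ha₁ x))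
    (b := fun x => -c + 1 / 16 * s₂ * a₂ x)
    (fun x => by simpa using abs_cluster (c := -c) hs₂ hs₂' (ha₂ x))
  obtain ⟨χ', e1', e2', e3'⟩ := exists_sep hd (fun x => abs_cluster (c := d) hs₁ hs₁' (hb₁ x))
    (b := fun x => -d + 1 / 16 * s₂ * b₂ x)
    (fun x => by simpa using abs_cluster (c := -d) hs₂ hs₂' (hb₂ x))
  refine NonRes.sum χ' e1' e2' e3' (fun w hw hw' => ?_) (h2.affine _ _ (by positivity))
  refine h1.affine c d (t := 1 / 16 * s₁) (by positivity) w (fun g hg => ?_) hw'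
  have := hw (fun y => χ y * g y) (by fun_prop) fun y => by rw [e3, zero_mul]
  simpa only [e2, one_mul] using this

/-- Two clusters, one of them tiny, with only one pair of projections overlapping. -/
theorem cluster_tiny {a₁ b₁ : ι → ℝ} {a₂ b₂ : κ → ℝ} {c d η δ : ℝ} (hc : |c| ≤ 1 / 4) (hd : |d| = 1)
    (hη : 0 < η) (hη' : η ≤ 1) (hδ : 2 * η ≤ δ)
    (hb₁ : ∀ x, |b₁ x| ≤ 2) (ha₂ : ∀ x, |a₂ x| ≤ 2) (hb₂ : ∀ x, |b₂ x| ≤ 2)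
    (h1 : RobRes a₁ b₁ δ) (h2 : NonRes a₂ b₂) :
    NonRes (Sum.elim (fun x => c + 1 / 16 * 1 * a₁ x) (fun x => -c + 1 / 16 * η * a₂ x))
      (Sum.elim (fun x => d + 1 / 16 * 1 * b₁ x) (fun x => -d + 1 / 16 * η * b₂ x)) := by
  obtain ⟨χ', e1', e2', e3'⟩ := exists_sep (c := d) (by rw [hd]; norm_num)
    (fun x => abs_cluster (c := d) one_pos le_rfl (hb₁ x))
    (b := fun x => -d + 1 / 16 * η * b₂ x)
    (fun x => by simpa using abs_cluster (c := -d) hη hη' (hb₂ x))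
  refine NonRes.sum χ' e1' e2' e3' (fun w hw hw' => ?_) (h2.affine _ _ (by positivity))
  refine h1 w (-(32 * c)) ?_ (fun g hg hg0 => ?_) fun g hg => ?_
  · rw [abs_neg, abs_mul, abs_of_pos (by norm_num)]; linarith
  · have := hw (fun y => g ((y - c) * 16)) (by fun_prop) fun y => hg0 _ ?_
    · refine Eq.trans (Finset.sum_congr rfl fun x _ => ?_) this
      congr 2
      ring
    · have : (-c + 1 / 16 * η * a₂ y - c) * 16 - -(32 * c) = η * a₂ y := by ring
      rw [this, abs_mul, abs_of_pos hη]
      nlinarith [ha₂ y]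
  · refine Eq.trans (Finset.sum_congr rfl fun x _ => ?_) (hw' (fun y => g ((y - d) * 16)) (by fun_prop))
    congr 2
    ring

end NonRes

section Double

variable {ι : Type*} [Fintype ι]

/-- The scale of a cluster. -/
noncomputable def scale (η : ℝ) (r : Bool → ℝ) : ℝ := max η (min 1 (1 - 2 * (r false + r true)))

/-- The two clusters at a flagged vertex. -/
noncomputable def dblPos (η : ℝ) (r : Bool → ℝ) (α β : Bool → ι → ℝ) (i : Bool) : ι ⊕ ι → ℝ :=
  Sum.elim (fun x => r i + 1 / 16 * scale η r * α i x)
    (fun x => -r i + 1 / 16 * scale η (-r) * β i x)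

variable {η δ : ℝ} {r : Bool → ℝ} {α β : Bool → ι → ℝ}

theorem scale_pos (hη : 0 < η) : 0 < scale η r := lt_max_of_lt_left hη

theorem scale_le (hη' : η ≤ 1) : scale η r ≤ 1 := max_le hη' (min_le_left _ _)

theorem scale_of_le (hη' : η ≤ 1) (h : r false + r true ≤ 0) : scale η r = 1 := by
  rw [scale, min_eq_left (by linarith), max_eq_right hη']

theorem scale_of_ge (hη : 0 < η) (h : 1 / 2 ≤ r false + r true) : scale η r = η :=
  max_eq_left ((min_le_right _ _).trans (by linarith))

theorem dblPos_tiny {i : Bool} (hη : 0 < η) (hη' : η ≤ 1) (hδ : 2 * η ≤ δ)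
    (hi : |r i| ≤ 1 / 4) (hr : |r (!i)| = 1) (h0 : r false + r true ≤ 0)
    (hα : ∀ i x, |α i x| ≤ 2) (hβ : ∀ i x, |β i x| ≤ 2)
    (hα' : RobRes (α i) (α (!i)) δ) (hβ' : NonRes (β i) (β (!i))) :
    NonRes (dblPos η r α β i) (dblPos η r α β (!i)) := by
  have h1 : scale η r = 1 := scale_of_le hη' h0
  have h2 : scale η (-r) = η := by
    refine scale_of_ge hη ?_
    have h3 := abs_le.1 hi
    have h4 : r (!i) = 1 ∨ r (!i) = -1 := eq_or_eq_neg_of_abs_eq hr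
    simp only [Pi.neg_apply]
    cases i <;> rcases h4 with h4 | h4 <;> simp only [Bool.not_true, Bool.not_false] at h4 <;> linarith
  unfold dblPos
  rw [h1, h2]
  exact NonRes.cluster_tiny hi hr hη hη' hδ (hα _) (hβ _) (hβ _) hα' hβ'

theorem nonRes_dblPos (hη : 0 < η) (hη' : η ≤ 1) (hδ : 2 * η ≤ δ)
    (hr' : ∃ i, |r i| = 1)
    (hα : ∀ i x, |α i x| ≤ 2) (hβ : ∀ i x, |β i x| ≤ 2)
    (hα' : ∀ i, RobRes (α i) (α (!i)) δ) (hβ' : ∀ i, RobRes (β i) (β (!i)) δ)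
    (hα0 : NonRes (α false) (α true)) (hβ0 : NonRes (β false) (β true)) :
    NonRes (dblPos η r α β false) (dblPos η r α β true) := by
  have sw : ∀ {γ : Bool → ι → ℝ}, NonRes (γ false) (γ true) → ∀ i, NonRes (γ i) (γ (!i)) := by
    rintro γ h (_ | _)
    exacts [h, h.symm]
  by_cases h : ∀ i, 1 / 4 ≤ |r i|
  · exact NonRes.cluster (h _) (h _) (scale_pos hη) (scale_le hη') (scale_pos hη) (scale_le hη')
      (hα _) (hα _) (hβ _) (hβ _) hα0 hβ0
  push Not at h
  obtain ⟨i, hi⟩ := h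
  have hi' : |r (!i)| = 1 := by
    obtain ⟨j, hj⟩ := hr'
    rcases Bool.eq_or_eq_not j i with h | h
    · rw [← h, hj] at hi
      norm_num at hi
    · rwa [← h]
  suffices h : NonRes (dblPos η r α β i) (dblPos η r α β (!i)) by
    cases i
    exacts [h, h.symm]
  rcases le_total (r false + r true) 0 with h | h
  · exact dblPos_tiny hη hη' hδ hi.le hi' h hα hβ (hα' i) (sw hβ0 i)
  · have := dblPos_tiny (r := -r) hη hη' hδ (i := i) (by simpa using hi.le) (by simpa using hi')
      (by simp only [Pi.neg_apply]; linarith) hβ hα (hβ' i) (sw hα0 i)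
    refine NonRes.of_equiv (Equiv.sumComm ι ι) ?_
    convert this using 1 <;>
    · funext x
      rcases x with x | x <;> simp [dblPos]

end Double

/-- A compact family of non-resonant configurations is uniformly robust. -/
theorem exists_robRes {ι X : Type*} [Fintype ι] [TopologicalSpace X]
    [FirstCountableTopology X] {K : Set X} (hK : IsCompact K)
    {a b : X → ι → ℝ} (ha : Continuous a) (hb : Continuous b) (h : ∀ p ∈ K, NonRes (a p) (b p)) :
    ∃ δ > 0, ∀ p ∈ K, RobRes (a p) (b p) δ := by
  by_contra! hcon
  have key : ∀ i : ℕ, ∃ p : X × ((ι → ℝ) × ℝ), p ∈ K ×ˢ (Metric.sphere 0 1 ×ˢ Set.Icc (-8) 8) ∧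
      (∀ g : ℝ → ℝ, Continuous g → (∀ y, |y - p.2.2| ≤ 1 / ((i : ℝ) + 1) → g y = 0) →
        ∑ x, p.2.1 x * g (a p.1 x) = 0) ∧
      (∀ g : ℝ → ℝ, Continuous g → ∑ x, p.2.1 x * g (b p.1 x) = 0) := by
    intro i
    obtain ⟨p, hp, hp'⟩ := hcon (1 / ((i : ℝ) + 1)) (by positivity)
    unfold RobRes at hp'
    push Not at hp'
    obtain ⟨w, t, ht, h1, h2, hw⟩ := hp'
    have hw' : ‖w‖ ≠ 0 := norm_ne_zero_iff.2 hw
    refine ⟨(p, ‖w‖⁻¹ • w, t), ⟨hp, ?_, abs_le.1 ht⟩, fun g hg hg' => ?_, fun g hg => ?_⟩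
    · rw [mem_sphere_zero_iff_norm, norm_smul, norm_inv, norm_norm, inv_mul_cancel₀ hw']
    · simp only [Pi.smul_apply, smul_eq_mul, mul_assoc]
      rw [← Finset.mul_sum, h1 g hg hg', mul_zero]
    · simp only [Pi.smul_apply, smul_eq_mul, mul_assoc]
      rw [← Finset.mul_sum, h2 g hg, mul_zero]
  choose q hq h1 h2 using key
  obtain ⟨⟨p, w, t⟩, ⟨hp, hw, -⟩, θ, hθ, hlim⟩ :=
    (hK.prod ((isCompact_sphere (0 : ι → ℝ) 1).prod isCompact_Icc)).tendsto_subseq hq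
  have lp : Tendsto (fun i => (q (θ i)).1) atTop (𝓝 p) := (continuous_fst.tendsto _).comp hlim
  have lw : Tendsto (fun i => (q (θ i)).2.1) atTop (𝓝 w) :=
    (continuous_fst.comp continuous_snd |>.tendsto _).comp hlim
  have lt : Tendsto (fun i => (q (θ i)).2.2) atTop (𝓝 t) :=
    (continuous_snd.comp continuous_snd |>.tendsto _).comp hlim
  have lw' : ∀ x, Tendsto (fun i => (q (θ i)).2.1 x) atTop (𝓝 (w x)) := fun x =>
    ((continuous_apply x).tendsto _).comp lw
  have la : ∀ x, Tendsto (fun i => a (q (θ i)).1 x) atTop (𝓝 (a p x)) := fun x =>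
    (((continuous_apply x).comp ha).tendsto _).comp lp
  have lb : ∀ x, Tendsto (fun i => b (q (θ i)).1 x) atTop (𝓝 (b p x)) := fun x =>
    (((continuous_apply x).comp hb).tendsto _).comp lp
  have lδ : Tendsto (fun i => 1 / ((θ i : ℝ) + 1)) atTop (𝓝 0) :=
    tendsto_one_div_add_atTop_nhds_zero_nat.comp hθ.tendsto_atTop
  have hb0 : ∀ g : ℝ → ℝ, Continuous g → ∑ x, w x * g (b p x) = 0 := by
    intro g hg
    have l : Tendsto (fun i => ∑ x, (q (θ i)).2.1 x * g (b (q (θ i)).1 x)) atTop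
        (𝓝 (∑ x, w x * g (b p x))) :=
      tendsto_finsetSum _ fun x _ => (lw' x).mul ((hg.tendsto _).comp (lb x))
    refine tendsto_nhds_unique l ?_
    simp only [h2 _ g hg]
    exact tendsto_const_nhds
  have hw0 : w = 0 := by
    refine h p hp w (fun g hg => ?_) hb0
    let cl : ℕ → ℝ → ℝ := fun i y =>
      y - max (-(1 / ((θ i : ℝ) + 1))) (min (1 / ((θ i : ℝ) + 1)) (y - (q (θ i)).2.2))
    have hcl : ∀ i, Continuous (cl i) := fun i => by fun_prop
    have hcl' : ∀ i y, |y - (q (θ i)).2.2| ≤ 1 / ((θ i : ℝ) + 1) → cl i y = (q (θ i)).2.2 := by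
      intro i y hy
      have := abs_le.1 hy
      simp only [cl]
      rw [min_eq_right this.2, max_eq_right this.1]
      ring
    have lcl : ∀ x, Tendsto (fun i => cl i (a (q (θ i)).1 x)) atTop (𝓝 (a p x)) := by
      intro x
      have l0 : Tendsto (fun i => max (-(1 / ((θ i : ℝ) + 1)))
          (min (1 / ((θ i : ℝ) + 1)) (a (q (θ i)).1 x - (q (θ i)).2.2))) atTop (𝓝 0) := by
        refine tendsto_of_tendsto_of_tendsto_of_le_of_le (by simpa using lδ.neg) lδ
          (fun i => le_max_left _ _) fun i => max_le ?_ (min_le_left _ _)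
        have : (0 : ℝ) < 1 / ((θ i : ℝ) + 1) := by positivity
        simp only
        linarith
      have l1 := (la x).sub l0
      rwa [sub_zero] at l1
    have l : Tendsto (fun i => ∑ x, (q (θ i)).2.1 x *
        (g (cl i (a (q (θ i)).1 x)) - g (q (θ i)).2.2)) atTop
        (𝓝 (∑ x, w x * (g (a p x) - g t))) :=
      tendsto_finsetSum _ fun x _ => (lw' x).mul
        (((hg.tendsto _).comp (lcl x)).sub ((hg.tendsto _).comp lt))
    have l' := tendsto_nhds_unique l (by
      have : ∀ i, ∑ x, (q (θ i)).2.1 x * (g (cl i (a (q (θ i)).1 x)) - g (q (θ i)).2.2) = 0 := fun i =>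
        h1 (θ i) (fun y => g (cl i y) - g (q (θ i)).2.2) (by have := hcl i; fun_prop)
          fun y hy => by rw [hcl' i y hy, sub_self]
      simp only [this]
      exact tendsto_const_nhds)
    have l1 := hb0 (fun _ => 1) continuous_const
    simp only [mul_one] at l1
    simpa [mul_sub, Finset.sum_sub_distrib, ← Finset.sum_mul, l1] using l'
  rw [hw0, mem_sphere_zero_iff_norm, norm_zero] at hw
  exact zero_ne_one hw

end

namespace SymTree

open Shape

/-- Parameters of the positions. -/
abbrev Par (T : SymTree) := T.toShape.N × Bool → ℝ

/-- The product of the boundaries of the unit squares. -/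
def Squares (T : SymTree) : Set T.Par :=
  {p | (∀ c, |p c| ≤ 1) ∧ ∀ ν, ∃ b, |p (ν, b)| = 1}

theorem isCompact_squares (T : SymTree) : IsCompact T.Squares := by
  refine (isCompact_univ_pi fun _ : T.toShape.N × Bool =>
    isCompact_Icc (a := (-1 : ℝ)) (b := 1)).of_isClosed_subset ?_ fun x hx c _ => abs_le.1 (hx.1 c)
  have e : T.Squares = (⋂ c, {p | |p c| ≤ 1}) ∩ ⋂ ν, ⋃ b, {p | |p (ν, b)| = 1} := by
    ext x
    simp [Squares]
  rw [e]
  refine (isClosed_iInter fun c => ?_).inter (isClosed_iInter fun φ =>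
    isClosed_iUnion_of_finite fun b => ?_)
  · exact isClosed_le (by fun_prop) continuous_const
  · exact isClosed_eq (by fun_prop) continuous_const

/-- The exchange of two subtrees acting on the parameters. -/
noncomputable def parSwap (T : SymTree) (ν : T.toShape.N) (p : T.Par) : T.Par :=
  fun c => (if c.1 = ν then -1 else 1) * p (T.swapN ν c.1, c.2)

theorem parSwap_ne {T : SymTree} {μ ν : T.toShape.N} (h : μ ≠ ν) (p : T.Par) (b : Bool) :
    T.parSwap ν p (μ, b) = p (T.swapN ν μ, b) := by
  rw [parSwap, if_neg h, one_mul]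

theorem parSwap_self {T : SymTree} (ν : T.toShape.N) (p : T.Par) (b : Bool) :
    T.parSwap ν p (ν, b) = -p (ν, b) := by
  rw [parSwap, if_pos rfl, neg_one_mul, swapN_self]

theorem parSwap_congr {T T' : SymTree} {μ ν : T.toShape.N} {μ' ν' : T'.toShape.N}
    (h : μ = ν ↔ μ' = ν') {p : T.Par} {p' : T'.Par} {b : Bool}
    (hp : p (T.swapN ν μ, b) = p' (T'.swapN ν' μ', b)) :
    T.parSwap ν p (μ, b) = T'.parSwap ν' p' (μ', b) := by
  rw [parSwap, parSwap, hp]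
  simp only [h]

/-- Equivariant continuous non-resonant positions of the leaves. -/
theorem exists_positions (T : SymTree) : ∃ a : Bool → T.Par → T.toShape.L → ℝ,
    (∀ i, Continuous (a i)) ∧ (∀ i, ∀ p ∈ T.Squares, ∀ x, |a i p x| ≤ 2) ∧
    (∀ i ν p x, a i (T.parSwap ν p) x = a i p (T.swapL ν x)) ∧
    ∀ p ∈ T.Squares, NonRes (a false p) (a true p) := by
  induction T with
  | leaf =>
    refine ⟨fun _ _ _ => 0, fun _ => continuous_const, fun _ _ _ _ => by simp,
      fun _ _ _ _ => rfl, fun p _ w h1 _ => ?_⟩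
    have h := h1 (fun _ => 1) continuous_const
    funext x
    rw [Fintype.sum_eq_single x fun y hy => absurd (Subsingleton.elim (α := Unit) y x) hy, mul_one] at h
    exact h
  | cat A B hA hB =>
    obtain ⟨a, ha1, ha2, ha3, ha4⟩ := hA
    obtain ⟨b, hb1, hb2, hb3, hb4⟩ := hB
    let resA : (cat A B).Par → A.Par := fun p c => p (Sum.inr (Sum.inl c.1), c.2)
    let resB : (cat A B).Par → B.Par := fun p c => p (Sum.inr (Sum.inr c.1), c.2)
    have resA_mem : ∀ p ∈ (cat A B).Squares, resA p ∈ A.Squares := fun p hp =>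
      ⟨fun c => hp.1 _, fun ν => hp.2 (Sum.inr (Sum.inl ν))⟩
    have resB_mem : ∀ p ∈ (cat A B).Squares, resB p ∈ B.Squares := fun p hp =>
      ⟨fun c => hp.1 _, fun ν => hp.2 (Sum.inr (Sum.inr ν))⟩
    refine ⟨fun i p => Sum.elim (fun x => 1 + 1 / 16 * 1 * a i (resA p) x)
      (fun x => -1 + 1 / 16 * 1 * b i (resB p) x), fun i => ?_, fun i p hp x => ?_,
      fun i ν p x => ?_, fun p hp => ?_⟩
    · have h1 : Continuous fun p => a i (resA p) := (ha1 i).comp (by fun_prop)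
      have h2 : Continuous fun p => b i (resB p) := (hb1 i).comp (by fun_prop)
      refine continuous_pi fun x => ?_
      rcases x with x | x
      · exact continuous_const.add (continuous_const.mul ((continuous_apply x).comp h1))
      · exact continuous_const.add (continuous_const.mul ((continuous_apply x).comp h2))
    · rcases x with x | x
      · have := abs_le.1 (ha2 i _ (resA_mem p hp) x)
        exact abs_le.2 ⟨by simp only [Sum.elim_inl]; linarith, by simp only [Sum.elim_inl]; linarith⟩
      · have := abs_le.1 (hb2 i _ (resB_mem p hp) x)
        exact abs_le.2 ⟨by simp only [Sum.elim_inr]; linarith, by simp only [Sum.elim_inr]; linarith⟩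
    · rcases ν with h | ν | ν
      · exact absurd h.down Bool.false_ne_true
      · have e1 : resA ((cat A B).parSwap (Sum.inr (Sum.inl ν)) p) = A.parSwap ν (resA p) :=
          funext fun c => parSwap_congr
            ⟨fun h => Sum.inl_injective (Sum.inr_injective h), fun h => by rw [h]⟩ rfl
        have e2 : resB ((cat A B).parSwap (Sum.inr (Sum.inl ν)) p) = resB p :=
          funext fun c => parSwap_ne (fun h => Sum.inr_ne_inl (Sum.inr_injective h)) p _
        rcases x with x | x
        · simp only [e1, Sum.elim_inl, ha3]
          rfl
        · simp only [e2, Sum.elim_inr]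
          rfl
      · have e1 : resA ((cat A B).parSwap (Sum.inr (Sum.inr ν)) p) = resA p :=
          funext fun c => parSwap_ne (fun h => Sum.inl_ne_inr (Sum.inr_injective h)) p _
        have e2 : resB ((cat A B).parSwap (Sum.inr (Sum.inr ν)) p) = B.parSwap ν (resB p) :=
          funext fun c => parSwap_congr
            ⟨fun h => Sum.inr_injective (Sum.inr_injective h), fun h => by rw [h]⟩ rfl
        rcases x with x | x
        · simp only [e1, Sum.elim_inl]
          rfl
        · simp only [e2, Sum.elim_inr, hb3]
          rfl
    · exact NonRes.cluster (by norm_num) (by norm_num) one_pos le_rfl one_pos le_rfl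
        (ha2 _ _ (resA_mem p hp)) (ha2 _ _ (resA_mem p hp)) (hb2 _ _ (resB_mem p hp))
        (hb2 _ _ (resB_mem p hp)) (ha4 _ (resA_mem p hp)) (hb4 _ (resB_mem p hp))
  | dbl A hA =>
    obtain ⟨a, ha1, ha2, ha3, ha4⟩ := hA
    obtain ⟨δ₁, hδ₁, h₁⟩ := exists_robRes A.isCompact_squares (ha1 false) (ha1 true) ha4
    obtain ⟨δ₂, hδ₂, h₂⟩ := exists_robRes A.isCompact_squares (ha1 true) (ha1 false)
      fun p hp => (ha4 p hp).symm
    let η : ℝ := min 1 (min (δ₁ / 2) (δ₂ / 2))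
    have hη : 0 < η := by positivity
    have hη' : η ≤ 1 := min_le_left _ _
    have hη₁ : 2 * η ≤ δ₁ := by
      have : η ≤ δ₁ / 2 := (min_le_right _ _).trans (min_le_left _ _)
      linarith
    have hη₂ : 2 * η ≤ δ₂ := by
      have : η ≤ δ₂ / 2 := (min_le_right _ _).trans (min_le_right _ _)
      linarith
    let rt : (dbl A).Par → Bool → ℝ := fun p i => p (Sum.inl ⟨rfl⟩, i)
    let resA : (dbl A).Par → A.Par := fun p c => p (Sum.inr (Sum.inl c.1), c.2)
    let resB : (dbl A).Par → A.Par := fun p c => p (Sum.inr (Sum.inr c.1), c.2)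
    have resA_mem : ∀ p ∈ (dbl A).Squares, resA p ∈ A.Squares := fun p hp =>
      ⟨fun c => hp.1 _, fun ν => hp.2 (Sum.inr (Sum.inl ν))⟩
    have resB_mem : ∀ p ∈ (dbl A).Squares, resB p ∈ A.Squares := fun p hp =>
      ⟨fun c => hp.1 _, fun ν => hp.2 (Sum.inr (Sum.inr ν))⟩
    have rob : ∀ p ∈ A.Squares, ∀ i, RobRes (a i p) (a (!i) p) (2 * η) := by
      intro p hp i
      cases i
      · exact (h₁ p hp).mono hη₁
      · exact (h₂ p hp).mono hη₂
    refine ⟨fun i p => dblPos η (rt p) (fun i => a i (resA p)) (fun i => a i (resB p)) i,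
      fun i => ?_, fun i p hp x => ?_, fun i ν p x => ?_, fun p hp => ?_⟩
    · have h1 : Continuous fun p => a i (resA p) := (ha1 i).comp (by fun_prop)
      have h2 : Continuous fun p => a i (resB p) := (ha1 i).comp (by fun_prop)
      have h3 : Continuous rt := by fun_prop
      have h4 : Continuous fun p => scale η (rt p) := by unfold scale; fun_prop
      have h5 : Continuous fun p => scale η (-rt p) := by
        unfold scale; simp only [Pi.neg_apply]; fun_prop
      refine continuous_pi fun x => ?_
      rcases x with x | x <;> simp only [dblPos, Sum.elim_inl, Sum.elim_inr] <;> fun_prop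
    · rcases x with x | x
      · have h1 := NonRes.abs_cluster (c := rt p i) (scale_pos (r := rt p) hη) (scale_le hη')
          (ha2 i _ (resA_mem p hp) x)
        have h2 := abs_le.1 (hp.1 (Sum.inl ⟨rfl⟩, i))
        have h1 := abs_le.1 h1
        simp only [rt] at h1
        exact abs_le.2 ⟨by simp only [dblPos, Sum.elim_inl, rt]; linarith,
          by simp only [dblPos, Sum.elim_inl, rt]; linarith⟩
      · have h1 := NonRes.abs_cluster (c := -rt p i) (scale_pos (r := -rt p) hη) (scale_le hη')
          (ha2 i _ (resB_mem p hp) x)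
        have h2 := abs_le.1 (hp.1 (Sum.inl ⟨rfl⟩, i))
        have h1 := abs_le.1 h1
        simp only [rt] at h1
        exact abs_le.2 ⟨by simp only [dblPos, Sum.elim_inr, rt]; linarith,
          by simp only [dblPos, Sum.elim_inr, rt]; linarith⟩
    · rcases ν with h | ν | ν
      · have e0 : rt ((dbl A).parSwap (Sum.inl h) p) = -rt p :=
          funext fun c => parSwap_self _ p c
        have e1 : resA ((dbl A).parSwap (Sum.inl h) p) = resB p :=
          funext fun c => parSwap_ne Sum.inr_ne_inl p _
        have e2 : resB ((dbl A).parSwap (Sum.inl h) p) = resA p :=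
          funext fun c => parSwap_ne Sum.inr_ne_inl p _
        rcases x with x | x
        · simp only [e0, e1, e2, dblPos, Sum.elim_inl, Pi.neg_apply]
          rfl
        · simp only [e0, e1, e2, dblPos, Sum.elim_inr, Pi.neg_apply, _root_.neg_neg]
          rfl
      · have e0 : rt ((dbl A).parSwap (Sum.inr (Sum.inl ν)) p) = rt p :=
          funext fun c => parSwap_ne Sum.inl_ne_inr p _
        have e1 : resA ((dbl A).parSwap (Sum.inr (Sum.inl ν)) p) = A.parSwap ν (resA p) :=
          funext fun c => parSwap_congr
            ⟨fun h => Sum.inl_injective (Sum.inr_injective h), fun h => by rw [h]⟩ rfl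
        have e2 : resB ((dbl A).parSwap (Sum.inr (Sum.inl ν)) p) = resB p :=
          funext fun c => parSwap_ne (fun h => Sum.inr_ne_inl (Sum.inr_injective h)) p _
        rcases x with x | x
        · simp only [e0, e1, dblPos, Sum.elim_inl, ha3]
          rfl
        · simp only [e0, e2, dblPos, Sum.elim_inr]
          rfl
      · have e0 : rt ((dbl A).parSwap (Sum.inr (Sum.inr ν)) p) = rt p :=
          funext fun c => parSwap_ne Sum.inl_ne_inr p _
        have e1 : resA ((dbl A).parSwap (Sum.inr (Sum.inr ν)) p) = resA p :=
          funext fun c => parSwap_ne (fun h => Sum.inl_ne_inr (Sum.inr_injective h)) p _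
        have e2 : resB ((dbl A).parSwap (Sum.inr (Sum.inr ν)) p) = A.parSwap ν (resB p) :=
          funext fun c => parSwap_congr
            ⟨fun h => Sum.inr_injective (Sum.inr_injective h), fun h => by rw [h]⟩ rfl
        rcases x with x | x
        · simp only [e0, e1, dblPos, Sum.elim_inl]
          rfl
        · simp only [e0, e2, dblPos, Sum.elim_inr, ha3]
          rfl
    · exact nonRes_dblPos hη hη' le_rfl (hp.2 _) (fun _ => ha2 _ _ (resA_mem p hp))
        (fun _ => ha2 _ _ (resB_mem p hp)) (rob _ (resA_mem p hp)) (rob _ (resB_mem p hp))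
        (ha4 _ (resA_mem p hp)) (ha4 _ (resB_mem p hp))

end SymTree

theorem evalDiff_apply (a b : ℝ) (f : C(ℝ, ℝ)) : evalDiff a b f = f b - f a := rfl

theorem NonRes.linearIndependent {ι : Type*} [Fintype ι] {a b : ι → ℝ} (h : NonRes a b)
    (ha : ∀ x, |a x| ≤ 2) (hb : ∀ x, |b x| ≤ 2) :
    LinearIndependent ℝ fun x => evalDiff (a x) (b x + 6) := by
  refine Fintype.linearIndependent_iff.2 fun w hw => ?_
  have hw' : ∀ f : C(ℝ, ℝ), ∑ x, w x * (f (b x + 6) - f (a x)) = 0 := fun f => by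
    have := congrArg (fun φ : C(ℝ, ℝ) →ₗ[ℝ] ℝ => φ f) hw
    simpa [evalDiff_apply] using this
  let χ : ℝ → ℝ := fun y => max 0 (min 1 (3 - y))
  have hχ : Continuous χ := by fun_prop
  have h1 : ∀ x, χ (a x) = 1 := fun x => by
    have := abs_le.1 (ha x)
    show max 0 (min 1 (3 - a x)) = 1
    rw [min_eq_left (by linarith), max_eq_right zero_le_one]
  have h2 : ∀ x, χ (b x + 6) = 0 := fun x => by
    have := abs_le.1 (hb x)
    exact max_eq_left ((min_le_right _ _).trans (by linarith))
  have h0 : w = 0 := by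
    refine h w (fun g hg => ?_) fun g hg => ?_
    · have := hw' ⟨fun y => χ y * g y, by fun_prop⟩
      simpa [h1, h2] using this
    · have := hw' ⟨fun y => (1 - χ y) * g (y - 6), by fun_prop⟩
      simpa [h1, h2] using this
  exact fun i => congrFun h0 i

/-- Three nonzero, pairwise orthogonal vectors orthogonal to the range of a linear map bound its
rank. -/
theorem finrank_range_add_three_le {ι V : Type*} [Fintype ι] [AddCommGroup V] [Module ℝ V]
    (Φ : V →ₗ[ℝ] ι → ℝ) (u : Fin 3 → ι → ℝ) (hu : ∀ k, u k ≠ 0)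
    (ho : ∀ k l, k < l → ∑ i, u k i * u l i = 0) (hΦ : ∀ k v, ∑ i, u k i * Φ v i = 0) :
    Module.finrank ℝ (LinearMap.range Φ) + 3 ≤ Fintype.card ι := by
  classical
  let Ψ : (ι → ℝ) →ₗ[ℝ] Fin 3 → ℝ := Matrix.mulVecLin (Matrix.of u)
  have hΨ : ∀ v k, Ψ v k = ∑ i, u k i * v i := fun v k => rfl
  have ho' : ∀ k l, k ≠ l → ∑ i, u k i * u l i = 0 := by
    intro k l h
    rcases lt_or_gt_of_ne h with h | h
    · exact ho k l h
    · rw [← ho l k h]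
      exact Finset.sum_congr rfl fun i _ => mul_comm _ _
  have hs : ∀ k, ∑ i, u k i * u k i ≠ 0 := by
    intro k h
    refine hu k (funext fun i => ?_)
    have := (Finset.sum_eq_zero_iff_of_nonneg fun i _ => mul_self_nonneg (u k i)).1 h i (Finset.mem_univ _)
    exact mul_self_eq_zero.1 this
  have hsurj : Function.Surjective Ψ := by
    intro y
    refine ⟨∑ k, (y k / ∑ i, u k i * u k i) • u k, funext fun l => ?_⟩
    rw [map_sum, Finset.sum_apply, Finset.sum_eq_single l]
    · rw [map_smul, Pi.smul_apply, hΨ, smul_eq_mul, div_mul_cancel₀ _ (hs l)]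
    · intro k _ hk
      rw [map_smul, Pi.smul_apply, hΨ, ho' l k hk.symm, smul_zero]
    · simp
  have hle : LinearMap.range Φ ≤ LinearMap.ker Ψ := by
    rintro _ ⟨v, rfl⟩
    exact funext fun k => hΦ k v
  have h1 := Submodule.finrank_mono hle
  have h2 := Ψ.finrank_range_add_finrank_ker
  rw [LinearMap.range_eq_top.2 hsurj, finrank_top, Module.finrank_fin_fun,
    Module.finrank_fintype_fun_eq_card] at h2
  omega

namespace SymTree

open Shape

variable {T : SymTree}

/-- The parameters of the positions. -/
def par (x : T.toShape.Crd → ℝ) : T.Par := fun c => x (Sum.inl c)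

/-- The weights of the leaves. -/
def wt (x : T.toShape.Crd → ℝ) (k : Fin 3) (l : T.toShape.L) : ℝ := x (Sum.inr (k, l))

theorem continuous_par : Continuous (par (T := T)) := by unfold par; fun_prop

theorem continuous_wt (k : Fin 3) (l : T.toShape.L) : Continuous fun x => wt (T := T) x k l :=
  continuous_apply _

theorem par_mem {x : T.toShape.Crd → ℝ} (hx : x ∈ Cubes T) : par x ∈ T.Squares := by
  refine ⟨fun c => hx.1 _, fun ν => ?_⟩
  obtain ⟨c, h1, h2⟩ := hx.2 (Sum.inl ν)
  rcases c with ⟨μ, b⟩ | c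
  · obtain rfl : μ = ν := Sum.inl_injective h1
    exact ⟨b, h2⟩
  · exact absurd h1 Sum.inr_ne_inl

theorem wt_ne_zero {x : T.toShape.Crd → ℝ} (hx : x ∈ Cubes T) (k : Fin 3) : wt x k ≠ 0 := by
  intro h
  obtain ⟨c, h1, h2⟩ := hx.2 (Sum.inr k)
  rcases c with c | ⟨j, l⟩
  · exact absurd h1 Sum.inl_ne_inr
  · obtain rfl : j = k := Sum.inr_injective h1
    have h3 : x (Sum.inr (j, l)) = 0 := congrFun h l
    rw [h3, abs_zero] at h2
    exact zero_ne_one h2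

theorem par_negS (k : Fin 3) (x : T.toShape.Crd → ℝ) : par (ract (negS T.toShape k) x) = par x := by
  funext c
  simp [par, ract, negS]

theorem wt_negS (k j : Fin 3) (x : T.toShape.Crd → ℝ) (l : T.toShape.L) :
    wt (ract (negS T.toShape k) x) j l = (if j = k then -1 else 1) * wt x j l := by
  simp only [wt, ract, negS]
  split_ifs <;> simp_all

theorem par_swapS (ν : T.toShape.N) (x : T.toShape.Crd → ℝ) :
    par (ract (swapS T ν) x) = T.parSwap ν (par x) := by
  funext c
  simp only [par, ract, swapS, parSwap, Sum.elim_inl]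
  split_ifs <;> simp [Prod.map]

theorem wt_swapS (ν : T.toShape.N) (x : T.toShape.Crd → ℝ) (k : Fin 3) (l : T.toShape.L) :
    wt (ract (swapS T ν) x) k l = wt x k (T.swapL ν l) := by
  simp [wt, ract, swapS]

theorem rChar_pairing (φ : T.Par → T.toShape.L → ℝ)
    (hφ : ∀ ν p l, φ (T.parSwap ν p) l = φ p (T.swapL ν l)) (k : Fin 3) :
    RChar (Pi.single k 1) fun x : T.toShape.Crd → ℝ => ∑ l, wt x k l * φ (par x) l := by
  refine ⟨fun j x => ?_, fun ν x => ?_⟩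
  · simp only [par_negS, wt_negS, mul_assoc, ← Finset.mul_sum]
    congr 1
    by_cases h : k = j
    · subst h; simp
    · rw [if_neg h, Pi.single_eq_of_ne (Ne.symm h), if_pos rfl]
  · simp only [par_swapS, wt_swapS, hφ]
    exact Equiv.sum_comp (T.swapL ν) fun l => wt x k l * φ (par x) l

theorem rChar_inner {k l : Fin 3} (h : k ≠ l) :
    RChar (Pi.single k 1 + Pi.single l 1) fun x : T.toShape.Crd → ℝ => ∑ i, wt x k i * wt x l i := by
  refine ⟨fun j x => ?_, fun ν x => ?_⟩
  · simp only [wt_negS, mul_mul_mul_comm _ (wt x k _), ← Finset.mul_sum]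
    congr 1
    by_cases h1 : k = j
    · subst h1
      simp [h, h.symm]
    · by_cases h2 : l = j
      · subst h2
        simp [h]
      · simp [h1, h2, Ne.symm h1, Ne.symm h2]
  · simp only [wt_swapS]
    exact Equiv.sum_comp (T.swapL ν) fun i => wt x k i * wt x l i

end SymTree

/-- A chord diagram with many dependent conditions on the span of finitely many functions. -/
theorem exists_chords {n m N : ℕ}
    (h : (m = 4 ∧ 18 ≤ n) ∨ (m = 5 ∧ 22 ≤ n) ∨ (m = 6 ∧ 26 ≤ n) ∨ (m = 7 ∧ 30 ≤ n))
    (hN : N + 3 = n + m) (f : Fin N → C(ℝ, ℝ)) :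
    ∃ a b : Fin n → ℝ, (∀ i, a i < b i) ∧ LinearIndependent ℝ (fun i => evalDiff (a i) (b i)) ∧
      ∃ u : Fin 3 → Fin n → ℝ, (∀ k, u k ≠ 0) ∧ (∀ k l, k < l → ∑ i, u k i * u l i = 0) ∧
        ∀ k j, ∑ i, u k i * evalDiff (a i) (b i) (f j) = 0 := by
  obtain ⟨T, h1, h2, h3⟩ := SymTree.exists_tree h
  obtain ⟨a, ha1, ha2, ha3, ha4⟩ := T.exists_positions
  have hφ : ∀ j i l, Continuous fun x : T.toShape.Crd → ℝ => a i (SymTree.par x) l + j :=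
    fun j i l => (((continuous_apply l).comp (ha1 i)).comp SymTree.continuous_par).add continuous_const
  obtain ⟨x, hx, hF, hG⟩ := SymTree.exists_zero h1 h2 h3 (by omega) hN
    (fun k j x => ∑ l, SymTree.wt x k l *
      (f j (a true (SymTree.par x) l + 6) - f j (a false (SymTree.par x) l + 0)))
    (fun k j => continuous_finsetSum _ fun l _ => (SymTree.continuous_wt k l).mul
      (((f j).continuous.comp (hφ 6 true l)).sub ((f j).continuous.comp (hφ 0 false l))))
    (fun k j => SymTree.rChar_pairing (fun p l => f j (a true p l + 6) - f j (a false p l + 0))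
      (fun ν p l => by simp only [ha3]) k)
    (fun k l x => ∑ i, SymTree.wt x k i * SymTree.wt x l i)
    (fun k l => continuous_finsetSum _ fun i _ =>
      (SymTree.continuous_wt k i).mul (SymTree.continuous_wt l i))
    fun k l hkl => SymTree.rChar_inner hkl.ne
  have hp := SymTree.par_mem hx
  let e : Fin n ≃ T.toShape.L := (Fintype.equivFinOfCardEq h1).symm
  refine ⟨fun i => a false (SymTree.par x) (e i), fun i => a true (SymTree.par x) (e i) + 6,
    fun i => ?_, ((ha4 _ hp).linearIndependent (ha2 _ _ hp) (ha2 _ _ hp)).comp e e.injective,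
    fun k i => SymTree.wt x k (e i), fun k hk => ?_, fun k l hkl => ?_, fun k j => ?_⟩
  · have e1 := abs_le.1 (ha2 false _ hp (e i))
    have e2 := abs_le.1 (ha2 true _ hp (e i))
    linarith
  · refine SymTree.wt_ne_zero hx k (funext fun l => ?_)
    simpa using congrFun hk (e.symm l)
  · rw [← hG k l hkl]
    exact e.sum_comp fun i => SymTree.wt x k i * SymTree.wt x l i
  · rw [← hF k j]
    simp only [add_zero]
    exact e.sum_comp fun l => SymTree.wt x k l *
      (f j (a true (SymTree.par x) l + 6) - f j (a false (SymTree.par x) l))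

/-- Degeneration by at least 3: under the listed conditions on (n, N), every
N-dimensional subspace of C(ℝ, ℝ) admits a non-resonant n-chord diagram whose
conditions cut out a subspace of codimension at most n - 3. -/
theorem stmt5 (n N : ℕ) (hnN : n ≤ N)
    (h : (18 ≤ n ∧ N ≤ n + 1) ∨ (22 ≤ n ∧ N ≤ n + 2) ∨ (26 ≤ n ∧ N ≤ n + 3) ∨
         (34 ≤ n ∧ N ≤ n + 4))
    (F : Submodule ℝ C(ℝ, ℝ)) [FiniteDimensional ℝ F]
    (hF : Module.finrank ℝ F = N) :
    ∃ a b : Fin n → ℝ,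
      (∀ i, a i < b i) ∧
      Function.Injective (fun i => (a i, b i)) ∧
      LinearIndependent ℝ (fun i => evalDiff (a i) (b i)) ∧
      (N : ℤ) - n + 3 ≤
        Module.finrank ℝ ↥(F ⊓ ⨅ i, LinearMap.ker (evalDiff (a i) (b i))) := by
  obtain ⟨m, hm, hm'⟩ : ∃ m, ((m = 4 ∧ 18 ≤ n) ∨ (m = 5 ∧ 22 ≤ n) ∨ (m = 6 ∧ 26 ≤ n) ∨
      (m = 7 ∧ 30 ≤ n)) ∧ N + 3 ≤ n + m := by
    rcases h with h | h | h | h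
    · exact ⟨4, by omega, by omega⟩
    · exact ⟨5, by omega, by omega⟩
    · exact ⟨6, by omega, by omega⟩
    · exact ⟨7, by omega, by omega⟩
  let β := Module.finBasisOfFinrankEq ℝ F hF
  obtain ⟨a, b, hab, hli, u, hu, ho, hu'⟩ := exists_chords (N := n + m - 3) hm (by omega)
    fun j => if hj : (j : ℕ) < N then (β ⟨j, hj⟩ : C(ℝ, ℝ)) else 0
  refine ⟨a, b, hab, fun i j hij => hli.injective ?_, hli, ?_⟩
  · simp only [Prod.mk.injEq] at hij
    simp only [hij.1, hij.2]
  let Φ : F →ₗ[ℝ] Fin n → ℝ := (LinearMap.pi fun i => evalDiff (a i) (b i)) ∘ₗ F.subtype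
  have hβ : ∀ k j, ∑ i, u k i * Φ (β j) i = 0 := by
    intro k j
    have := hu' k ⟨j, by omega⟩
    simp only [j.isLt, dif_pos, Fin.eta] at this
    exact this
  have hΦ : ∀ k v, ∑ i, u k i * Φ v i = 0 := by
    intro k v
    let ψ : F →ₗ[ℝ] ℝ := ∑ i, u k i • (LinearMap.proj i ∘ₗ Φ)
    have hψ : ∀ v, ψ v = ∑ i, u k i * Φ v i := fun v => by simp [ψ]
    have h0 : ψ = 0 := β.ext fun j => by rw [hψ, hβ, LinearMap.zero_apply]
    rw [← hψ, h0, LinearMap.zero_apply]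
  have h1 := finrank_range_add_three_le Φ u hu ho hΦ
  have h2 := Φ.finrank_range_add_finrank_ker
  have h3 : (LinearMap.ker Φ).map F.subtype = F ⊓ ⨅ i, LinearMap.ker (evalDiff (a i) (b i)) := by
    rw [LinearMap.ker_comp, Submodule.map_comap_subtype, LinearMap.ker_pi]
  rw [← h3, Submodule.finrank_map_subtype_eq]
  rw [Fintype.card_fin] at h1
  omega
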